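/- arXiv:2406.12451 — 2 statements merged into one kernel-verified Lean document; each statement's English description precedes it below -/
import Mathlib

section
/- Let h = h(n), m = m(n) ∈ ℕ with h → ∞. Suppose that m h³ / n = O(1). Then there exists δ_0 = δ_0(γ,β) > 0 such that for every constant δ with 0 < δ ≤ δ_0 and all sufficiently large n, P(Y_t < h δ for all t ∈ [m h²]) ≤ exp(−m c_0) for some constant c_0 = c_0(δ) > 0. -/
/-!
Statement 17 (Proposition `Prop2Gnpint`, random intersection graph `G(n,k,p)` with
`k = ⌊βn⌋`, `p = γ/n`, `βγ² = 1`): let `h, m ∈ ℕ` with `h → ∞` and suppose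
`m h³/n = O(1)`.  Then there exists `δ₀ = δ₀(γ,β) > 0` such that for every constant
`0 < δ ≤ δ₀` and all sufficiently large `n`,
`P(Y_t < hδ ∀ t ∈ [m h²]) ≤ exp(-m c₀)` for some constant `c₀ = c₀(δ) > 0`.
-/
open MeasureTheory Filter Asymptotics

noncomputable section

def bernoulliBool (p : ℝ) : Measure Bool :=
  (Real.toNNReal p) • Measure.dirac true + (Real.toNNReal (1 - p)) • Measure.dirac false

def riMeasure (n k : ℕ) (p : ℝ) : Measure (Fin n × Fin k → Bool) :=
  Measure.pi fun _ => bernoulliBool p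

/-- One step of the exploration process of `G(n,k,p)` (Algorithm 3).  The state records
(set of active vertices, set of explored vertices, set of discovered attributes). -/
def riStep {n k : ℕ} (ω : Fin n × Fin k → Bool)
    (st : Finset (Fin n) × Finset (Fin n) × Finset (Fin k)) :
    Finset (Fin n) × Finset (Fin n) × Finset (Fin k) :=
  let A := st.1; let E := st.2.1; let D := st.2.2
  let U := Finset.univ \ (A ∪ E)
  if hA : A.Nonempty then
    let u := A.min' hA
    let N := (Finset.univ \ D).filter fun w => ω (u, w) = true
    let R := (U.erase u).filter fun v => ∃ w ∈ N, ω (v, w) = true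
    ((A.erase u) ∪ R, insert u E, D ∪ N)
  else if hU : U.Nonempty then
    let u := U.min' hU
    let N := (Finset.univ \ D).filter fun w => ω (u, w) = true
    let R := (U.erase u).filter fun v => ∃ w ∈ N, ω (v, w) = true
    (R, insert u E, D ∪ N)
  else st

/-- The state of the exploration process of `G(n,k,p)` at time `t`; at time `0` the first
vertex is active, all other vertices are unseen and all attributes are fresh. -/
def riState {n k : ℕ} (ω : Fin n × Fin k → Bool) :
    ℕ → Finset (Fin n) × Finset (Fin n) × Finset (Fin k)
  | 0 => (Finset.univ.filter fun v : Fin n => (v : ℕ) = 0, ∅, ∅)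
  | t + 1 => riStep ω (riState ω t)

/-- `Y t`, the number of active vertices at the end of step `t`. -/
def riY {n k : ℕ} (ω : Fin n × Fin k → Bool) (t : ℕ) : ℕ := (riState ω t).1.card

/-- The hitting times `t_i`: `t_0 = 0` and `t_i = min {t > t_{i-1} : Y_t = 0}`. -/
def riHit {n k : ℕ} (ω : Fin n × Fin k → Bool) : ℕ → ℕ
  | 0 => 0
  | i + 1 => sInf {t | riHit ω i < t ∧ riY ω t = 0}

/-- `T = ⌈n^{2/3}/A⌉`. -/
def Tof (n : ℕ) (a : ℝ) : ℕ := Nat.ceil ((n : ℝ) ^ ((2 : ℝ) / 3) / a)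

/-- `τ = τ' ∧ mh²` where `τ' = min {t ≥ 1 : Y_t ≥ hδ}`. -/
def riTau {n k : ℕ} (ω : Fin n × Fin k → Bool) (hn : ℕ) (δ : ℝ) (cap : ℕ) : ℕ :=
  sInf ({t | 1 ≤ t ∧ (hn : ℝ) * δ ≤ (riY ω t : ℝ)} ∪ {cap})

/-! ### Expectations of functions of independent Bernoulli variables -/

/-- The probability of the configuration `ω` of independent Bernoulli(`p`) variables. -/
def bernoulliWeight {ι : Type*} [Fintype ι] (p : ℝ) (ω : ι → Bool) : ℝ :=
  ∏ i, if ω i = true then p else 1 - p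

/-- The expectation of `f` under independent Bernoulli(`p`) variables. -/
def bernoulliExp {ι : Type*} [Fintype ι] [DecidableEq ι] (p : ℝ) (f : (ι → Bool) → ℝ) : ℝ :=
  ∑ ω, bernoulliWeight p ω * f ω

/-- The indicator that all the variables indexed by `S` equal `b`. -/
def allEq {ι : Type*} (b : Bool) (S : Finset ι) (ω : ι → Bool) : ℝ :=
  open Classical in if ∀ i ∈ S, ω i = b then 1 else 0

section BernoulliExp

variable {ι : Type*} [Fintype ι] {p : ℝ}

lemma bernoulliWeight_nonneg (h0 : 0 ≤ p) (h1 : p ≤ 1) (ω : ι → Bool) :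
    0 ≤ bernoulliWeight p ω := by
  refine Finset.prod_nonneg fun i _ => ?_
  split_ifs <;> linarith

variable [DecidableEq ι]

lemma bernoulliExp_prod (g : ι → Bool → ℝ) :
    bernoulliExp p (fun ω => ∏ i, g i (ω i)) = ∏ i, (p * g i true + (1 - p) * g i false) := by
  have h : ∀ i, p * g i true + (1 - p) * g i false
      = ∑ b : Bool, (if b = true then p else 1 - p) * g i b := by
    intro i; simp
  simp only [h, Fintype.prod_sum, bernoulliExp, bernoulliWeight, Finset.prod_mul_distrib]

lemma bernoulliExp_allEq (b : Bool) (S : Finset ι) :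
    bernoulliExp p (allEq b S) = (if b = true then p else 1 - p) ^ S.card := by
  let g : ι → Bool → ℝ := fun i c => if i ∈ S then (if c = b then 1 else 0) else 1
  have h : allEq b S = fun ω : ι → Bool => ∏ i, g i (ω i) := by
    funext ω
    simp only [allEq, g, Finset.prod_ite_mem, Finset.univ_inter]
    rw [Finset.prod_ite_zero]
    simp
  have hg : ∀ i, p * g i true + (1 - p) * g i false
      = if i ∈ S then (if b = true then p else 1 - p) else 1 := by
    intro i
    by_cases hi : i ∈ S <;> cases b <;> simp [g, hi]
  rw [h, bernoulliExp_prod]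
  simp only [hg]
  simp

lemma bernoulliExp_allEq_true (S : Finset ι) :
    bernoulliExp p (allEq true S) = p ^ S.card := by
  simp [bernoulliExp_allEq]

lemma bernoulliExp_allEq_false (S : Finset ι) :
    bernoulliExp p (allEq false S) = (1 - p) ^ S.card := by
  simp [bernoulliExp_allEq]

lemma sum_bernoulliWeight : ∑ ω : ι → Bool, bernoulliWeight p ω = 1 := by
  have := bernoulliExp_prod (ι := ι) (p := p) (fun _ _ => 1)
  simpa [bernoulliExp] using this

lemma bernoulliExp_const (c : ℝ) : bernoulliExp p (fun _ : ι → Bool => c) = c := by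
  simp [bernoulliExp, ← Finset.sum_mul, sum_bernoulliWeight]

lemma bernoulliExp_add (f g : (ι → Bool) → ℝ) :
    bernoulliExp p (fun ω => f ω + g ω) = bernoulliExp p f + bernoulliExp p g := by
  simp [bernoulliExp, mul_add, Finset.sum_add_distrib]

lemma bernoulliExp_sub (f g : (ι → Bool) → ℝ) :
    bernoulliExp p (fun ω => f ω - g ω) = bernoulliExp p f - bernoulliExp p g := by
  simp [bernoulliExp, mul_sub, Finset.sum_sub_distrib]

lemma bernoulliExp_const_mul (c : ℝ) (f : (ι → Bool) → ℝ) :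
    bernoulliExp p (fun ω => c * f ω) = c * bernoulliExp p f := by
  simp only [bernoulliExp, Finset.mul_sum]
  exact Finset.sum_congr rfl fun _ _ => by ring

lemma bernoulliExp_sum {α : Type*} (s : Finset α) (f : α → (ι → Bool) → ℝ) :
    bernoulliExp p (fun ω => ∑ a ∈ s, f a ω) = ∑ a ∈ s, bernoulliExp p (f a) := by
  simp only [bernoulliExp, Finset.mul_sum]
  exact Finset.sum_comm

lemma bernoulliExp_mono (h0 : 0 ≤ p) (h1 : p ≤ 1) {f g : (ι → Bool) → ℝ}
    (hfg : ∀ ω, f ω ≤ g ω) : bernoulliExp p f ≤ bernoulliExp p g :=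
  Finset.sum_le_sum fun ω _ => mul_le_mul_of_nonneg_left (hfg ω) (bernoulliWeight_nonneg h0 h1 ω)

lemma allEq_mul_allEq (b : Bool) (S S' : Finset ι) (ω : ι → Bool) :
    allEq b S ω * allEq b S' ω = allEq b (S ∪ S') ω := by
  simp only [allEq, Finset.mem_union, or_imp, forall_and, ite_zero_mul_ite_zero, mul_one]

/-- Functions of disjoint families of independent variables are uncorrelated. -/
lemma bernoulliExp_mul_of_dependsOn (I : Set ι) {f g : (ι → Bool) → ℝ}
    (hf : DependsOn f I) (hg : DependsOn g Iᶜ) :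
    bernoulliExp p (fun ω => f ω * g ω) = bernoulliExp p f * bernoulliExp p g := by
  classical
  let mix : (ι → Bool) × (ι → Bool) → (ι → Bool) × (ι → Bool) := fun x =>
    (fun i => if i ∈ I then x.1 i else x.2 i, fun i => if i ∈ I then x.2 i else x.1 i)
  have hmix : Function.Involutive mix := by
    rintro ⟨x, y⟩
    ext i <;> by_cases hi : i ∈ I <;> simp [mix, hi]
  have hw : ∀ x, bernoulliWeight p (mix x).1 * bernoulliWeight p (mix x).2
      = bernoulliWeight p x.1 * bernoulliWeight p x.2 := by
    rintro ⟨x, y⟩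
    simp only [bernoulliWeight, ← Finset.prod_mul_distrib]
    refine Finset.prod_congr rfl fun i _ => ?_
    by_cases hi : i ∈ I <;> simp only [mix, hi, if_true, if_false]
    exact mul_comm _ _
  have hfm : ∀ x, f (mix x).1 = f x.1 := fun x => hf fun i hi => by simp [mix, hi]
  have hgm : ∀ x, g (mix x).1 = g x.2 := fun x => hg fun i hi => by
    have hi' : i ∉ I := hi
    simp [mix, hi']
  have h1 : bernoulliExp p (fun ω => f ω * g ω) = ∑ x : (ι → Bool) × (ι → Bool),
      bernoulliWeight p x.1 * bernoulliWeight p x.2 * (f x.1 * g x.1) := by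
    rw [Fintype.sum_prod_type]
    refine Finset.sum_congr rfl fun x _ => ?_
    simp only [← Finset.sum_mul, ← Finset.mul_sum, sum_bernoulliWeight, mul_one]
  have h2 : bernoulliExp p f * bernoulliExp p g = ∑ x : (ι → Bool) × (ι → Bool),
      bernoulliWeight p x.1 * bernoulliWeight p x.2 * (f x.1 * g x.2) := by
    rw [Fintype.sum_prod_type, bernoulliExp, bernoulliExp, Finset.sum_mul_sum]
    exact Finset.sum_congr rfl fun x _ => Finset.sum_congr rfl fun y _ => by ring
  rw [h1, h2, ← Equiv.sum_comp hmix.toPerm]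
  refine Finset.sum_congr rfl fun x _ => ?_
  simp only [Function.Involutive.coe_toPerm, hw, hfm, hgm]

/-- The law of total expectation when a random parameter `Z` and a function `J` of it are such
that, for each value `z` of `Z`, the event `Z = z` and `J z` depend on complementary families. -/
lemma bernoulliExp_comp_le (h0 : 0 ≤ p) (h1 : p ≤ 1) {α : Type*} [Fintype α] [DecidableEq α]
    (Z : (ι → Bool) → α) (J : α → (ι → Bool) → ℝ) (Q : α → ℝ) (I : α → Set ι)
    (hZ : ∀ ω ω', (∀ i ∈ I (Z ω), ω i = ω' i) → Z ω' = Z ω)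
    (hJ : ∀ ω, DependsOn (J (Z ω)) (I (Z ω))ᶜ)
    (hQ : ∀ ω, bernoulliExp p (J (Z ω)) ≤ Q (Z ω)) :
    bernoulliExp p (fun ω => J (Z ω) ω) ≤ bernoulliExp p (fun ω => Q (Z ω)) := by
  have e1 : (fun ω => J (Z ω) ω) = fun ω => ∑ z, (if Z ω = z then (1 : ℝ) else 0) * J z ω := by
    funext ω; simp
  have e2 : (fun ω => Q (Z ω)) = fun ω => ∑ z, Q z * (if Z ω = z then (1 : ℝ) else 0) := by
    funext ω; simp
  rw [e1, e2, bernoulliExp_sum, bernoulliExp_sum]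
  refine Finset.sum_le_sum fun z _ => ?_
  by_cases hz : ∃ ω, Z ω = z
  · obtain ⟨ω₀, rfl⟩ := hz
    have hdep : DependsOn (fun ω => if Z ω = Z ω₀ then (1 : ℝ) else 0) (I (Z ω₀)) := by
      intro ω ω' h
      have : Z ω = Z ω₀ ↔ Z ω' = Z ω₀ := by
        constructor
        · intro e
          rw [← e]
          exact hZ ω ω' (by rw [e]; exact h)
        · intro e
          rw [← e]
          exact hZ ω' ω (by rw [e]; exact fun i hi => (h i hi).symm)
      simp only [this]
    rw [bernoulliExp_mul_of_dependsOn _ hdep (hJ ω₀), bernoulliExp_const_mul, mul_comm]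
    refine mul_le_mul_of_nonneg_right (hQ ω₀) ?_
    have := bernoulliExp_mono (ι := ι) h0 h1 (f := fun _ => 0)
      (g := fun ω => if Z ω = Z ω₀ then (1 : ℝ) else 0) (fun ω => by positivity)
    rwa [bernoulliExp_const] at this
  · push Not at hz
    simp [hz, bernoulliExp_const]

end BernoulliExp

lemma riMeasure_eq_bernoulliExp {n k : ℕ} {p : ℝ} (h0 : 0 ≤ p) (h1 : p ≤ 1)
    (S : Set (Fin n × Fin k → Bool)) [DecidablePred (· ∈ S)] :
    riMeasure n k p S = ENNReal.ofReal (bernoulliExp p fun ω => if ω ∈ S then 1 else 0) := by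
  have hb : ∀ b, bernoulliBool p {b} = ENNReal.ofReal (if b = true then p else 1 - p) := by
    intro b
    simp only [bernoulliBool, Measure.add_apply, Measure.smul_apply, Measure.dirac_apply]
    cases b <;> simp [ENNReal.ofReal, ENNReal.smul_def]
  have : IsFiniteMeasure (bernoulliBool p) := by
    unfold bernoulliBool; infer_instance
  have hs : ∀ ω, riMeasure n k p {ω} = ENNReal.ofReal (bernoulliWeight p ω) := by
    intro ω
    rw [riMeasure, Measure.pi_singleton, bernoulliWeight, ENNReal.ofReal_prod_of_nonneg]
    · simp only [hb]
    · intro i _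
      split_ifs <;> linarith
  have hS : S = ↑(Finset.univ.filter (· ∈ S)) := by ext; simp
  conv_lhs => rw [hS]
  rw [← sum_measure_singleton, bernoulliExp, ENNReal.ofReal_sum_of_nonneg]
  · rw [Finset.sum_filter]
    refine Finset.sum_congr rfl fun ω _ => ?_
    split_ifs <;> simp [hs]
  · intro ω _
    have := bernoulliWeight_nonneg h0 h1 ω
    positivity

/-! ### One step of the exploration -/

section Explore

variable {n k : ℕ}

/-- The attributes of `W` adjacent to `u`. -/
def attrNbrs (ω : Fin n × Fin k → Bool) (u : Fin n) (W : Finset (Fin k)) : Finset (Fin k) :=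
  W.filter fun w => ω (u, w) = true

/-- The vertices of `U` that share with `u` an attribute of `W`. -/
def linkedVertices (ω : Fin n × Fin k → Bool) (u : Fin n) (U : Finset (Fin n))
    (W : Finset (Fin k)) : Finset (Fin n) :=
  U.filter fun v => ∃ w ∈ attrNbrs ω u W, ω (v, w) = true

/-- The result of exploring the vertex `u` from the state `st`. -/
def exploreVertex (ω : Fin n × Fin k → Bool) (u : Fin n)
    (st : Finset (Fin n) × Finset (Fin n) × Finset (Fin k)) :
    Finset (Fin n) × Finset (Fin n) × Finset (Fin k) :=
  (st.1.erase u ∪ linkedVertices ω u ((Finset.univ \ (st.1 ∪ st.2.1)).erase u)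
      (Finset.univ \ st.2.2),
    insert u st.2.1, st.2.2 ∪ attrNbrs ω u (Finset.univ \ st.2.2))

lemma riStep_cases {st : Finset (Fin n) × Finset (Fin n) × Finset (Fin k)}
    (hd : Disjoint st.1 st.2.1) :
    (∃ u, u ∉ st.2.1 ∧ (st.1.Nonempty → u ∈ st.1) ∧ ∀ ω, riStep ω st = exploreVertex ω u st) ∨
      (st.1 = ∅ ∧ st.2.1 = Finset.univ ∧ ∀ ω, riStep ω st = st) := by
  obtain ⟨A, E, D⟩ := st
  by_cases hA : A.Nonempty
  · left
    refine ⟨A.min' hA, fun h => Finset.disjoint_left.1 hd (A.min'_mem hA) h,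
      fun _ => A.min'_mem hA, fun ω => ?_⟩
    simp only [riStep, dif_pos hA]
    rfl
  · by_cases hU : (Finset.univ \ (A ∪ E)).Nonempty
    · left
      have hm := Finset.min'_mem _ hU
      simp only [Finset.mem_sdiff, Finset.mem_union, not_or] at hm
      refine ⟨(Finset.univ \ (A ∪ E)).min' hU, hm.2.2, fun h => absurd h hA, fun ω => ?_⟩
      simp only [riStep, dif_neg hA, dif_pos hU, exploreVertex, Finset.erase_eq_of_notMem hm.2.1]
      rw [Finset.not_nonempty_iff_eq_empty] at hA
      subst hA
      simp only [Finset.empty_union]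
      rfl
    · right
      rw [Finset.not_nonempty_iff_eq_empty] at hA
      subst hA
      refine ⟨rfl, ?_, fun ω => by
        simp only [riStep, dif_neg Finset.not_nonempty_empty, dif_neg hU]⟩
      simpa [Finset.not_nonempty_iff_eq_empty, Finset.sdiff_eq_empty_iff_subset,
        Finset.univ_subset_iff] using hU

/-- The pairs whose adjacency may already have been inspected when the exploration is in the
state `st`. -/
def revealed (st : Finset (Fin n) × Finset (Fin n) × Finset (Fin k)) : Set (Fin n × Fin k) :=
  {x | x.1 ∈ st.2.1 ∨ x.2 ∈ st.2.2}

lemma attrNbrs_congr {ω ω' : Fin n × Fin k → Bool} {u : Fin n} {W : Finset (Fin k)}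
    (h : ∀ w ∈ W, ω (u, w) = ω' (u, w)) : attrNbrs ω u W = attrNbrs ω' u W :=
  Finset.filter_congr fun w hw => by rw [h w hw]

lemma linkedVertices_congr {ω ω' : Fin n × Fin k → Bool} {u : Fin n} {U : Finset (Fin n)}
    {W : Finset (Fin k)} (h : attrNbrs ω u W = attrNbrs ω' u W)
    (h' : ∀ v ∈ U, ∀ w ∈ attrNbrs ω u W, ω (v, w) = ω' (v, w)) :
    linkedVertices ω u U W = linkedVertices ω' u U W := by
  refine Finset.filter_congr fun v hv => ?_
  rw [← h]
  refine exists_congr fun w => and_congr_right fun hw => ?_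
  rw [h' v hv w hw]

lemma exploreVertex_congr {ω ω' : Fin n × Fin k → Bool} {u : Fin n}
    {st : Finset (Fin n) × Finset (Fin n) × Finset (Fin k)}
    (h : ∀ w ∉ st.2.2, ω (u, w) = ω' (u, w))
    (h' : ∀ v ∉ st.2.1, ∀ w ∈ attrNbrs ω u (Finset.univ \ st.2.2), ω (v, w) = ω' (v, w)) :
    exploreVertex ω u st = exploreVertex ω' u st := by
  have e : attrNbrs ω u (Finset.univ \ st.2.2) = attrNbrs ω' u (Finset.univ \ st.2.2) :=
    attrNbrs_congr fun w hw => h w (by simpa using hw)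
  have e' := linkedVertices_congr (U := (Finset.univ \ (st.1 ∪ st.2.1)).erase u) e
    fun v hv => h' v (by simp at hv; tauto)
  simp only [exploreVertex, e', e]

lemma riStep_congr {ω ω' : Fin n × Fin k → Bool}
    {st : Finset (Fin n) × Finset (Fin n) × Finset (Fin k)} (hd : Disjoint st.1 st.2.1)
    (h : ∀ x ∈ (revealed st)ᶜ, ω x = ω' x) : riStep ω st = riStep ω' st := by
  rcases riStep_cases hd with ⟨u, hu, -, e⟩ | ⟨-, -, e⟩
  · rw [e, e]
    refine exploreVertex_congr (fun w hw => h _ (by simp [revealed, hu, hw]))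
      fun v hv w hw => h _ ?_
    simp only [attrNbrs, Finset.mem_filter, Finset.mem_sdiff, Finset.mem_univ, true_and] at hw
    simp [revealed, hv, hw.1]
  · rw [e, e]

lemma riStep_congr_of_revealed {ω ω' : Fin n × Fin k → Bool}
    {st : Finset (Fin n) × Finset (Fin n) × Finset (Fin k)} (hd : Disjoint st.1 st.2.1)
    (h : ∀ x ∈ revealed (riStep ω st), ω x = ω' x) : riStep ω' st = riStep ω st := by
  rcases riStep_cases hd with ⟨u, hu, -, e⟩ | ⟨-, -, e⟩
  · rw [e] at h
    rw [e, e]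
    refine (exploreVertex_congr (fun w hw => h _ ?_) fun v hv w hw => h _ ?_).symm
    · simp [revealed, exploreVertex]
    · simp [revealed, exploreVertex, hw]
  · rw [e, e]

lemma disjoint_riStep (ω : Fin n × Fin k → Bool)
    {st : Finset (Fin n) × Finset (Fin n) × Finset (Fin k)} (hd : Disjoint st.1 st.2.1) :
    Disjoint (riStep ω st).1 (riStep ω st).2.1 := by
  rcases riStep_cases hd with ⟨u, hu, -, e⟩ | ⟨-, -, e⟩
  · rw [e, Finset.disjoint_left]
    intro v hv hv'
    simp only [exploreVertex, linkedVertices, Finset.mem_union, Finset.mem_erase,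
      Finset.mem_filter, Finset.mem_sdiff, Finset.mem_insert, Finset.mem_univ] at hv hv'
    rw [Finset.disjoint_left] at hd
    have := @hd v
    tauto
  · rwa [e]

lemma revealed_subset_riStep (ω : Fin n × Fin k → Bool)
    {st : Finset (Fin n) × Finset (Fin n) × Finset (Fin k)} (hd : Disjoint st.1 st.2.1) :
    revealed st ⊆ revealed (riStep ω st) := by
  rcases riStep_cases hd with ⟨u, hu, -, e⟩ | ⟨-, -, e⟩
  · rw [e]
    rintro x (hx | hx)
    · exact Or.inl (Finset.mem_insert_of_mem hx)
    · exact Or.inr (Finset.mem_union_left _ hx)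
  · rw [e]

/-! ### Moments of one step -/

variable {p : ℝ}

/-- The indicator that `u` and `v` are both adjacent to the attribute `w`. -/
def linkInd (ω : Fin n × Fin k → Bool) (u v : Fin n) (w : Fin k) : ℝ :=
  allEq true {(u, w), (v, w)} ω

lemma linkInd_eq (ω : Fin n × Fin k → Bool) (u v : Fin n) (w : Fin k) :
    linkInd ω u v w = if ω (u, w) = true ∧ ω (v, w) = true then 1 else 0 := by
  simp [linkInd, allEq]

lemma bernoulliExp_linkInd {u v : Fin n} (huv : u ≠ v) (w : Fin k) :
    bernoulliExp p (fun ω => linkInd ω u v w) = p ^ 2 := by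
  have : ({(u, w), (v, w)} : Finset (Fin n × Fin k)).card = 2 := by
    rw [Finset.card_pair]; simp [huv]
  rw [← this]
  exact bernoulliExp_allEq_true _

lemma bernoulliExp_linkInd_mul_le (h0 : 0 ≤ p) {u v v' : Fin n} (huv : u ≠ v) (huv' : u ≠ v')
    (w w' : Fin k) :
    bernoulliExp p (fun ω => linkInd ω u v w * linkInd ω u v' w')
      ≤ p ^ 4 + (if w = w' then p ^ 3 else 0) + (if v = v' ∧ w = w' then p ^ 2 else 0) := by
  simp only [linkInd, allEq_mul_allEq]
  rw [show (fun ω : Fin n × Fin k → Bool => allEq true ({(u, w), (v, w)} ∪ {(u, w'), (v', w')}) ω)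
    = allEq true ({(u, w), (v, w)} ∪ {(u, w'), (v', w')}) from rfl, bernoulliExp_allEq_true]
  by_cases hw : w = w'
  · subst hw
    by_cases hv : v = v'
    · subst hv
      have : (({(u, w), (v, w)} : Finset (Fin n × Fin k)) ∪ {(u, w), (v, w)}).card = 2 := by
        rw [Finset.union_self, Finset.card_pair]; simp [huv]
      rw [this]
      simp only [and_self, if_true]
      have := pow_nonneg h0 3
      have := pow_nonneg h0 4
      linarith
    · have : (({(u, w), (v, w)} : Finset (Fin n × Fin k)) ∪ {(u, w), (v', w)}).card = 3 := by
        have : (({(u, w), (v, w)} : Finset (Fin n × Fin k)) ∪ {(u, w), (v', w)})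
            = {(u, w), (v, w), (v', w)} := by
          ext x
          simp only [Finset.mem_union, Finset.mem_insert, Finset.mem_singleton]
          tauto
        rw [this, Finset.card_eq_three]
        exact ⟨_, _, _, by simp [huv], by simp [huv'], by simp [hv], rfl⟩
      rw [this]
      simp only [hv, false_and, if_true, if_false]
      have := pow_nonneg h0 4
      linarith
  · have : (({(u, w), (v, w)} : Finset (Fin n × Fin k)) ∪ {(u, w'), (v', w')}).card = 4 := by
      rw [Finset.card_union_of_disjoint, Finset.card_pair, Finset.card_pair]
      · simp [huv']
      · simp [huv]
      · simp [Finset.disjoint_left, hw]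
    rw [this]
    simp [hw]

lemma card_linkedVertices (ω : Fin n × Fin k → Bool) (u : Fin n) (U : Finset (Fin n))
    (W : Finset (Fin k)) :
    ((linkedVertices ω u U W).card : ℝ)
      = ∑ v ∈ U, if ∃ w ∈ attrNbrs ω u W, ω (v, w) = true then 1 else 0 := by
  rw [linkedVertices, Finset.card_filter]
  push_cast
  rfl

lemma sum_linkInd (ω : Fin n × Fin k → Bool) (u v : Fin n) (W : Finset (Fin k)) :
    ∑ w ∈ W, linkInd ω u v w
      = (((attrNbrs ω u W).filter fun w => ω (v, w) = true).card : ℝ) := by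
  simp only [linkInd_eq, attrNbrs, Finset.filter_filter]
  rw [Finset.card_filter]
  push_cast
  rfl

lemma le_bernoulliExp_card_linkedVertices (h0 : 0 ≤ p) (h1 : p ≤ 1) {u : Fin n}
    {U : Finset (Fin n)} (hu : u ∉ U) (W : Finset (Fin k)) :
    (U.card : ℝ) * W.card * p ^ 2 - U.card * W.card ^ 2 * p ^ 4 - U.card * W.card * p ^ 3
      ≤ bernoulliExp p fun ω => ((linkedVertices ω u U W).card : ℝ) := by
  have hpt : ∀ ω : Fin n × Fin k → Bool,
      ∑ v ∈ U, (2 * (∑ w ∈ W, linkInd ω u v w)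
        - ∑ w ∈ W, ∑ w' ∈ W, linkInd ω u v w * linkInd ω u v w')
      ≤ ((linkedVertices ω u U W).card : ℝ) := by
    intro ω
    rw [card_linkedVertices]
    refine Finset.sum_le_sum fun v _ => ?_
    rw [← Finset.sum_mul_sum, sum_linkInd]
    split_ifs with h
    · nlinarith [sq_nonneg ((((attrNbrs ω u W).filter fun w => ω (v, w) = true).card : ℝ) - 1)]
    · have : (attrNbrs ω u W).filter (fun w => ω (v, w) = true) = ∅ := by
        rw [Finset.filter_eq_empty_iff]
        exact fun w hw hw' => h ⟨w, hw, hw'⟩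
      simp [this]
  refine le_trans ?_ (bernoulliExp_mono h0 h1 hpt)
  rw [bernoulliExp_sum]
  simp only [bernoulliExp_sub, bernoulliExp_const_mul, bernoulliExp_sum]
  have hv : ∀ v ∈ U, W.card * p ^ 2 - W.card ^ 2 * p ^ 4 - W.card * p ^ 3
      ≤ 2 * ∑ w ∈ W, bernoulliExp p (fun ω => linkInd ω u v w)
        - ∑ w ∈ W, ∑ w' ∈ W, bernoulliExp p (fun ω => linkInd ω u v w * linkInd ω u v w') := by
    intro v hv
    have huv : u ≠ v := (ne_of_mem_of_not_mem hv hu).symm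
    have h2 : ∑ w ∈ W, ∑ w' ∈ W, bernoulliExp p (fun ω => linkInd ω u v w * linkInd ω u v w')
        ≤ ∑ w ∈ W, ∑ w' ∈ W, (p ^ 4 + (if w = w' then p ^ 3 else 0)
          + (if v = v ∧ w = w' then p ^ 2 else 0)) :=
      Finset.sum_le_sum fun w _ => Finset.sum_le_sum fun w' _ =>
        bernoulliExp_linkInd_mul_le h0 huv huv w w'
    have h3 : ∑ w ∈ W, ∑ w' ∈ W, (p ^ 4 + (if w = w' then p ^ 3 else 0)
          + (if v = v ∧ w = w' then p ^ 2 else 0))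
        = W.card ^ 2 * p ^ 4 + W.card * p ^ 3 + W.card * p ^ 2 := by
      simp only [Finset.sum_add_distrib, true_and, Finset.sum_ite_eq]
      have e : ∀ c : ℝ, ∑ w ∈ W, (if w ∈ W then c else 0) = W.card * c := by
        intro c
        rw [Finset.sum_congr rfl fun w hw => if_pos hw]
        simp
      simp only [e, Finset.sum_const, nsmul_eq_mul]
      ring
    simp only [bernoulliExp_linkInd huv, Finset.sum_const, nsmul_eq_mul]
    linarith
  have := Finset.sum_le_sum hv
  rw [Finset.sum_const, nsmul_eq_mul] at this
  linarith

lemma bernoulliExp_card_linkedVertices_sq_le (h0 : 0 ≤ p) (h1 : p ≤ 1) {u : Fin n}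
    {U : Finset (Fin n)} (hu : u ∉ U) (W : Finset (Fin k)) :
    bernoulliExp p (fun ω => ((linkedVertices ω u U W).card : ℝ) ^ 2)
      ≤ (U.card * W.card * p ^ 2) ^ 2 + U.card ^ 2 * W.card * p ^ 3 + U.card * W.card * p ^ 2 := by
  have hpt : ∀ ω : Fin n × Fin k → Bool, ((linkedVertices ω u U W).card : ℝ) ^ 2
      ≤ ∑ x ∈ U ×ˢ W, ∑ y ∈ U ×ˢ W, linkInd ω u x.1 x.2 * linkInd ω u y.1 y.2 := by
    intro ω
    rw [← Finset.sum_mul_sum, ← sq]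
    refine pow_le_pow_left₀ (by positivity) ?_ 2
    rw [card_linkedVertices, Finset.sum_product]
    refine Finset.sum_le_sum fun v _ => ?_
    rw [sum_linkInd]
    split_ifs with h
    · obtain ⟨w, hw, hw'⟩ := h
      exact_mod_cast Finset.card_pos.2 ⟨w, Finset.mem_filter.2 ⟨hw, hw'⟩⟩
    · positivity
  refine (bernoulliExp_mono h0 h1 hpt).trans ?_
  rw [bernoulliExp_sum]
  simp only [bernoulliExp_sum]
  calc ∑ x ∈ U ×ˢ W, ∑ y ∈ U ×ˢ W,
        bernoulliExp p (fun ω => linkInd ω u x.1 x.2 * linkInd ω u y.1 y.2)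
      ≤ ∑ x ∈ U ×ˢ W, ∑ y ∈ U ×ˢ W, (p ^ 4 + (if x.2 = y.2 then p ^ 3 else 0)
          + (if x.1 = y.1 ∧ x.2 = y.2 then p ^ 2 else 0)) := by
        refine Finset.sum_le_sum fun x hx => Finset.sum_le_sum fun y hy => ?_
        rw [Finset.mem_product] at hx hy
        exact bernoulliExp_linkInd_mul_le h0 (ne_of_mem_of_not_mem hx.1 hu).symm
          (ne_of_mem_of_not_mem hy.1 hu).symm _ _
    _ = (U.card * W.card * p ^ 2) ^ 2 + U.card ^ 2 * W.card * p ^ 3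
        + U.card * W.card * p ^ 2 := by
        simp only [Finset.sum_add_distrib]
        congr 1
        · congr 1
          · simp only [Finset.sum_const, Finset.card_product, nsmul_eq_mul]
            push_cast; ring
          · simp only [Finset.sum_product, Finset.sum_ite_eq]
            have : ∀ w ∈ W, (if w ∈ W then p ^ 3 else 0) = p ^ 3 := fun w hw => if_pos hw
            rw [Finset.sum_congr rfl fun v _ => Finset.sum_congr rfl fun w hw =>
              Finset.sum_congr rfl fun v' _ => this w hw]
            simp only [Finset.sum_const, nsmul_eq_mul]
            ring
        · have : ∀ x y : Fin n × Fin k, (x.1 = y.1 ∧ x.2 = y.2) ↔ x = y := by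
            intro x y; exact Prod.ext_iff.symm
          simp only [this, Finset.sum_ite_eq]
          have : ∀ x ∈ U ×ˢ W, (if x ∈ U ×ˢ W then p ^ 2 else 0) = p ^ 2 := fun w hw => if_pos hw
          rw [Finset.sum_congr rfl this]
          simp

lemma le_bernoulliExp_linkedVertices_eq_empty (h0 : 0 ≤ p) (h1 : p ≤ 1) (u : Fin n)
    (U : Finset (Fin n)) (W : Finset (Fin k)) :
    (1 - p) ^ W.card
      ≤ bernoulliExp p fun ω => if (linkedVertices ω u U W).card = 0 then (1 : ℝ) else 0 := by
  have hc : (W.image fun w => (u, w)).card = W.card :=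
    Finset.card_image_of_injective _ fun a b h => by simpa using h
  rw [← hc, ← bernoulliExp_allEq_false]
  refine bernoulliExp_mono h0 h1 fun ω => ?_
  by_cases h : ∀ i ∈ W.image fun w => (u, w), ω i = false
  · rw [allEq, if_pos h, if_pos]
    rw [Finset.card_eq_zero, linkedVertices, Finset.filter_eq_empty_iff]
    rintro v - ⟨w, hw, -⟩
    rw [attrNbrs, Finset.mem_filter] at hw
    have := h (u, w) (Finset.mem_image_of_mem _ hw.1)
    simp [hw.2] at this
  · rw [allEq, if_neg h]
    positivity

lemma bernoulliExp_two_pow_card_attrNbrs (u : Fin n) (W : Finset (Fin k)) :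
    bernoulliExp p (fun ω => (2 : ℝ) ^ (attrNbrs ω u W).card) = (1 + p) ^ W.card := by
  have hpt : ∀ ω : Fin n × Fin k → Bool, (2 : ℝ) ^ (attrNbrs ω u W).card
      = ∑ S ∈ W.powerset, allEq true (S.image fun w => (u, w)) ω := by
    intro ω
    have : (2 : ℝ) ^ (attrNbrs ω u W).card = ((attrNbrs ω u W).powerset.card : ℝ) := by
      rw [Finset.card_powerset]; push_cast; rfl
    rw [this]
    have : (attrNbrs ω u W).powerset
        = W.powerset.filter fun S => ∀ i ∈ S.image fun w => (u, w), ω i = true := by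
      ext S
      simp only [Finset.mem_powerset, Finset.mem_filter, Finset.forall_mem_image, attrNbrs,
        Finset.subset_iff]
      exact forall₂_and
    rw [this, Finset.card_filter]
    push_cast
    refine Finset.sum_congr rfl fun S _ => ?_
    simp only [allEq]
    congr
  simp only [hpt]
  rw [bernoulliExp_sum]
  have : ∀ S : Finset (Fin k), bernoulliExp p (allEq true (S.image fun w => (u, w)))
      = p ^ S.card := by
    intro S
    rw [bernoulliExp_allEq_true, Finset.card_image_of_injective]
    exact fun a b h => by simpa using h
  simp only [this]
  have := Finset.sum_pow_mul_eq_add_pow p 1 W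
  simp only [one_pow, mul_one] at this
  rw [this, add_comm]

end Explore

/-! ### A supermartingale for the exploration killed at level `L` -/

/-- A potential decreasing in the number `y` of active vertices, which vanishes at the level `L`
and above. -/
def quadPot (M L : ℝ) (y : ℕ) : ℝ :=
  if (y : ℝ) < L then (M + 1) ^ 2 * L ^ 2 - (y : ℝ) ^ 2 else 0

section QuadPot

variable {M L : ℝ}

lemma quadPot_nonneg (hM : 1 ≤ M) (y : ℕ) : 0 ≤ quadPot M L y := by
  unfold quadPot
  split_ifs with h
  · have h0 : (0 : ℝ) ≤ y := by positivity
    have : (y : ℝ) ^ 2 ≤ L ^ 2 := pow_le_pow_left₀ h0 h.le 2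
    nlinarith [sq_nonneg L, mul_nonneg (by linarith : 0 ≤ M) (sq_nonneg L),
      mul_nonneg (mul_nonneg (by linarith : 0 ≤ M) (by linarith : 0 ≤ M)) (sq_nonneg L)]
  · exact le_rfl

lemma quadPot_add_le (hM : 1 ≤ M) {y s r : ℕ} (hy : (y : ℝ) < L) (hs : s + 1 = y + r) :
    quadPot M L s ≤ (M + 1) ^ 2 * L ^ 2 - (y : ℝ) ^ 2 - 2 * y * ((r : ℝ) - 1)
      - (if r = 0 then 1 else 0) + 2 / M * ((r : ℝ) ^ 2 + 1) := by
  have hs' : (s : ℝ) = y + (r - 1) := by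
    have : (s : ℝ) + 1 = y + r := by exact_mod_cast hs
    linarith
  have hs0 : (0 : ℝ) ≤ s := by positivity
  have hy0 : (0 : ℝ) ≤ y := by positivity
  have hr0 : (0 : ℝ) ≤ r := by positivity
  have hM0 : 0 < M := by linarith
  have hL : 0 < L := by linarith
  have hind : (if r = 0 then (1 : ℝ) else 0) ≤ ((r : ℝ) - 1) ^ 2 := by
    split_ifs with h
    · simp [h]
    · positivity
  have hpos : 0 ≤ 2 / M * ((r : ℝ) ^ 2 + 1) := by positivity
  rcases le_or_gt ((r : ℝ) - 1) (M * L) with h | h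
  · have key : quadPot M L s ≤ (M + 1) ^ 2 * L ^ 2 - (s : ℝ) ^ 2 := by
      unfold quadPot
      split_ifs with h'
      · exact le_rfl
      · have : (s : ℝ) ≤ (M + 1) * L := by rw [hs']; linarith
        have := pow_le_pow_left₀ hs0 this 2
        rw [mul_pow] at this
        linarith
    rw [hs'] at key
    nlinarith
  · have hML : L ≤ M * L := by nlinarith
    have h0 : quadPot M L s = 0 := by
      unfold quadPot
      rw [if_neg]
      rw [hs']; linarith
    have hr : r ≠ 0 := by
      rintro rfl
      simp only [Nat.cast_zero] at h
      nlinarith [mul_pos hM0 hL]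
    rw [h0, if_neg hr]
    have h1 : y * ((r : ℝ) - 1) ≤ 1 / M * ((r : ℝ) ^ 2 + 1) := by
      rw [div_mul_eq_mul_div, one_mul, le_div_iff₀ hM0]
      have e0 : 0 < (r : ℝ) - 1 := by nlinarith [mul_pos hM0 hL]
      have e1 : y * ((r : ℝ) - 1) * M ≤ L * ((r : ℝ) - 1) * M := by gcongr
      nlinarith
    have h2 : (y : ℝ) ^ 2 ≤ (M + 1) ^ 2 * L ^ 2 := by
      rw [← mul_pow]
      exact pow_le_pow_left₀ hy0 (by nlinarith) 2
    have h3 : 2 / M * ((r : ℝ) ^ 2 + 1) = 2 * (1 / M * ((r : ℝ) ^ 2 + 1)) := by ring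
    rw [h3]
    linarith

lemma quadPot_le (hM : 1 ≤ M) (hL : 1 ≤ L) (r : ℕ) :
    quadPot M L r ≤ (M + 1) ^ 2 * L ^ 2 - r + 1 / M * (r : ℝ) ^ 2 := by
  have hM0 : 0 < M := by linarith
  have hr0 : (0 : ℝ) ≤ r := by positivity
  have hr : (r : ℝ) ≤ (r : ℝ) ^ 2 := by exact_mod_cast Nat.le_self_pow two_ne_zero r
  have hpos : 0 ≤ 1 / M * (r : ℝ) ^ 2 := by positivity
  rcases le_or_gt (r : ℝ) (M * L) with h | h
  · unfold quadPot
    split_ifs with h'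
    · linarith
    · have : (r : ℝ) ≤ (M + 1) * L := by linarith
      have := pow_le_pow_left₀ hr0 this 2
      rw [mul_pow] at this
      linarith
  · have hML : L ≤ M * L := by nlinarith
    have h0 : quadPot M L r = 0 := by
      unfold quadPot
      rw [if_neg]
      linarith
    rw [h0]
    have h1 : (r : ℝ) ≤ 1 / M * (r : ℝ) ^ 2 := by
      rw [div_mul_eq_mul_div, one_mul, le_div_iff₀ hM0]
      nlinarith
    have : 0 ≤ (M + 1) ^ 2 * L ^ 2 := by positivity
    linarith

end QuadPot

section Survival

variable {n k : ℕ} {p : ℝ}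

/-- The indicator that the number of active vertices stays below `L` for `j` steps after the
state `st`. -/
def survInd (L : ℝ) (ω : Fin n × Fin k → Bool) :
    ℕ → Finset (Fin n) × Finset (Fin n) × Finset (Fin k) → ℝ
  | 0, _ => 1
  | j + 1, st => if ((riStep ω st).1.card : ℝ) < L then survInd L ω j (riStep ω st) else 0

lemma survInd_le_one (L : ℝ) (ω : Fin n × Fin k → Bool) (j : ℕ)
    (st : Finset (Fin n) × Finset (Fin n) × Finset (Fin k)) : survInd L ω j st ≤ 1 := by
  induction j generalizing st with
  | zero => exact le_rfl
  | succ j ih =>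
    rw [survInd]
    split_ifs
    exacts [ih _, zero_le_one]

lemma survInd_eq_one {L : ℝ} {ω : Fin n × Fin k → Bool} {j : ℕ}
    {st : Finset (Fin n) × Finset (Fin n) × Finset (Fin k)}
    (h : ∀ i, 1 ≤ i → i ≤ j → (((riStep ω)^[i] st).1.card : ℝ) < L) : survInd L ω j st = 1 := by
  induction j generalizing st with
  | zero => rfl
  | succ j ih =>
    rw [survInd, if_pos (by simpa using h 1 le_rfl (by omega))]
    refine ih fun i h1 hi => ?_
    rw [← Function.iterate_succ_apply]
    exact h (i + 1) (by omega) (by omega)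

lemma survInd_nonneg (L : ℝ) (ω : Fin n × Fin k → Bool) (j : ℕ)
    (st : Finset (Fin n) × Finset (Fin n) × Finset (Fin k)) : 0 ≤ survInd L ω j st := by
  induction j generalizing st with
  | zero => exact zero_le_one
  | succ j ih =>
    rw [survInd]
    split_ifs
    exacts [ih _, le_rfl]

lemma dependsOn_survInd (L : ℝ) (j : ℕ)
    {st : Finset (Fin n) × Finset (Fin n) × Finset (Fin k)} (hd : Disjoint st.1 st.2.1) :
    DependsOn (fun ω => survInd L ω j st) (revealed st)ᶜ := by
  induction j generalizing st with
  | zero => exact fun _ _ _ => rfl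
  | succ j ih =>
    intro ω ω' h
    have e := riStep_congr hd h
    have e' := ih (disjoint_riStep ω hd) fun i hi =>
      h i (Set.compl_subset_compl.2 (revealed_subset_riStep ω hd) hi)
    simp only [survInd, ← e] at e' ⊢
    rw [e']

lemma bernoulliExp_quadPot_riStep_le (h0 : 0 ≤ p) (h1 : p ≤ 1) {M L B q η e cap : ℝ}
    (hM : 1 ≤ M) (hL : 1 ≤ L) (hq1 : q ≤ 1) (hq0 : 0 < q) (hMB : 8 * (B + 1) ≤ M * q)
    (hη0 : 0 ≤ η) (hη : η ≤ 1 / 4) (hηL : L * η ≤ q / 8)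
    (hmean : ∀ (u : Fin n) (U : Finset (Fin n)) (W : Finset (Fin k)), u ∉ U → n - e ≤ U.card →
      k - cap ≤ W.card → 1 - η ≤ bernoulliExp p fun ω => ((linkedVertices ω u U W).card : ℝ))
    (hsq : ∀ (u : Fin n) (U : Finset (Fin n)) (W : Finset (Fin k)), u ∉ U →
      bernoulliExp p (fun ω => ((linkedVertices ω u U W).card : ℝ) ^ 2) ≤ B)
    (hzero : ∀ (u : Fin n) (U : Finset (Fin n)) (W : Finset (Fin k)),
      q ≤ bernoulliExp p fun ω => if (linkedVertices ω u U W).card = 0 then (1 : ℝ) else 0)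
    {st : Finset (Fin n) × Finset (Fin n) × Finset (Fin k)} (hd : Disjoint st.1 st.2.1)
    (hA : (st.1.card : ℝ) < L) (hE : st.2.1.card < n) (hEe : st.2.1.card + L + 1 ≤ e)
    (hD : (st.2.2.card : ℝ) ≤ cap) :
    bernoulliExp p (fun ω => quadPot M L (riStep ω st).1.card)
      ≤ (1 - q / (2 * (M + 1) ^ 2 * L ^ 2)) * quadPot M L st.1.card := by
  have hM0 : 0 < M := by linarith
  have hL0 : 0 < L := by linarith
  suffices hs : bernoulliExp p (fun ω => quadPot M L (riStep ω st).1.card)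
      ≤ (M + 1) ^ 2 * L ^ 2 - (st.1.card : ℝ) ^ 2 - q / 2 by
    refine hs.trans ?_
    have hF : quadPot M L st.1.card = (M + 1) ^ 2 * L ^ 2 - (st.1.card : ℝ) ^ 2 := if_pos hA
    rw [hF, sub_mul, one_mul]
    have : q / (2 * (M + 1) ^ 2 * L ^ 2) * ((M + 1) ^ 2 * L ^ 2 - (st.1.card : ℝ) ^ 2)
        ≤ q / (2 * (M + 1) ^ 2 * L ^ 2) * ((M + 1) ^ 2 * L ^ 2) := by
      gcongr
      linarith [sq_nonneg (st.1.card : ℝ)]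
    have e2 : q / (2 * (M + 1) ^ 2 * L ^ 2) * ((M + 1) ^ 2 * L ^ 2) = q / 2 := by
      field_simp
    linarith
  rcases riStep_cases hd with ⟨u, hu, huA, hstep⟩ | ⟨-, h, -⟩
  swap
  · rw [h] at hE; simp at hE
  set U := (Finset.univ \ (st.1 ∪ st.2.1)).erase u with hU
  set W := Finset.univ \ st.2.2 with hW
  have huU : u ∉ U := Finset.notMem_erase _ _
  have hUc : (n : ℝ) - e ≤ U.card := by
    have c1 : n ≤ U.card + st.1.card + st.2.1.card + 1 := by
      have a1 : (Finset.univ \ (st.1 ∪ st.2.1)).card ≤ U.card + 1 := by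
        have := Finset.pred_card_le_card_erase (s := Finset.univ \ (st.1 ∪ st.2.1)) (a := u)
        rw [hU]
        omega
      have a2 := Finset.card_sdiff_add_card (Finset.univ : Finset (Fin n)) (st.1 ∪ st.2.1)
      have a3 := Finset.card_union_le st.1 st.2.1
      have a4 := Finset.card_le_card (Finset.subset_union_left (s₁ := (Finset.univ : Finset (Fin n)))
        (s₂ := st.1 ∪ st.2.1))
      rw [Finset.card_univ, Fintype.card_fin] at a4
      omega
    have c2 : (n : ℝ) ≤ U.card + st.1.card + st.2.1.card + 1 := by exact_mod_cast c1
    linarith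
  have hWc : (k : ℝ) - cap ≤ W.card := by
    have a2 := Finset.card_sdiff_add_card (Finset.univ : Finset (Fin k)) st.2.2
    have a4 := Finset.card_le_card (Finset.subset_union_left (s₁ := (Finset.univ : Finset (Fin k)))
        (s₂ := st.2.2))
    rw [Finset.card_univ, Fintype.card_fin] at a4
    have c2 : (k : ℝ) ≤ W.card + st.2.2.card := by
      have : k ≤ W.card + st.2.2.card := by rw [hW]; omega
      exact_mod_cast this
    linarith
  have m1 := hmean u U W huU hUc hWc
  have m2 := hsq u U W huU
  have m3 := hzero u U W
  have hA' : ∀ ω, (riStep ω st).1 = st.1.erase u ∪ linkedVertices ω u U W := fun ω => by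
    rw [hstep]; rfl
  have hdisj : ∀ ω, Disjoint (st.1.erase u) (linkedVertices ω u U W) := by
    intro ω
    rw [Finset.disjoint_left]
    intro v hv hv'
    have hvU : v ∈ U := (Finset.mem_filter.1 hv').1
    rw [hU] at hvU
    simp only [Finset.mem_erase, Finset.mem_sdiff, Finset.mem_union] at hv hvU
    tauto
  have hcard : ∀ ω, (riStep ω st).1.card = (st.1.erase u).card + (linkedVertices ω u U W).card :=
    fun ω => by rw [hA', Finset.card_union_of_disjoint (hdisj ω)]
  have hB : 0 ≤ B := by
    refine le_trans ?_ m2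
    rw [← bernoulliExp_const (ι := Fin n × Fin k) (p := p) 0]
    exact bernoulliExp_mono h0 h1 fun ω => by positivity
  rcases Finset.eq_empty_or_nonempty st.1 with hemp | hne
  · have hp : ∀ ω, quadPot M L (riStep ω st).1.card ≤
        (M + 1) ^ 2 * L ^ 2 - ((linkedVertices ω u U W).card : ℝ)
          + 1 / M * ((linkedVertices ω u U W).card : ℝ) ^ 2 := by
      intro ω
      have : (riStep ω st).1.card = (linkedVertices ω u U W).card := by
        rw [hcard, hemp]; simp
      rw [this]
      exact quadPot_le hM hL _
    refine (bernoulliExp_mono h0 h1 hp).trans ?_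
    rw [bernoulliExp_add, bernoulliExp_sub, bernoulliExp_const, bernoulliExp_const_mul, hemp]
    have : 1 / M * bernoulliExp p (fun ω => ((linkedVertices ω u U W).card : ℝ) ^ 2) ≤ 1 / 8 := by
      rw [div_mul_eq_mul_div, one_mul, div_le_iff₀ hM0]
      nlinarith
    simp only [Finset.card_empty, Nat.cast_zero]
    linarith
  · have huA := huA hne
    have hc1 : (st.1.erase u).card + 1 = st.1.card := Finset.card_erase_add_one huA
    have hp : ∀ ω, quadPot M L (riStep ω st).1.card ≤
        ((M + 1) ^ 2 * L ^ 2 - (st.1.card : ℝ) ^ 2 + 2 * st.1.card + 2 / M)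
          - 2 * st.1.card * ((linkedVertices ω u U W).card : ℝ)
          - (if (linkedVertices ω u U W).card = 0 then 1 else 0)
          + 2 / M * ((linkedVertices ω u U W).card : ℝ) ^ 2 := by
      intro ω
      have := quadPot_add_le hM hA (s := (riStep ω st).1.card)
        (r := (linkedVertices ω u U W).card) (by rw [hcard]; omega)
      linarith
    refine (bernoulliExp_mono h0 h1 hp).trans ?_
    rw [bernoulliExp_add, bernoulliExp_sub, bernoulliExp_sub, bernoulliExp_const,
      bernoulliExp_const_mul, bernoulliExp_const_mul]
    have hy0 : (0 : ℝ) ≤ st.1.card := by positivity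
    have t1 : 2 / M * bernoulliExp p (fun ω => ((linkedVertices ω u U W).card : ℝ) ^ 2) + 2 / M
        ≤ q / 4 := by
      have : 2 / M * bernoulliExp p (fun ω => ((linkedVertices ω u U W).card : ℝ) ^ 2)
          ≤ 2 / M * B := by gcongr
      have e3 : 2 / M * B + 2 / M ≤ q / 4 := by
        have : 2 / M * B + 2 / M = 2 * (B + 1) / M := by ring
        rw [this, div_le_iff₀ hM0]
        linarith
      linarith
    have t2 : 2 * (st.1.card : ℝ) * (1 - η) ≤ 2 * st.1.card *
        bernoulliExp p (fun ω => ((linkedVertices ω u U W).card : ℝ)) := by gcongr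
    have t3 : (st.1.card : ℝ) * η ≤ L * η := by gcongr
    nlinarith

lemma bernoulliExp_two_pow_riStep_le (h0 : 0 ≤ p) (h1 : p ≤ 1) {c : ℝ} (hc : 1 ≤ c)
    (htwo : ∀ (u : Fin n) (W : Finset (Fin k)),
      bernoulliExp p (fun ω => (2 : ℝ) ^ (attrNbrs ω u W).card) ≤ c)
    {st : Finset (Fin n) × Finset (Fin n) × Finset (Fin k)} (hd : Disjoint st.1 st.2.1) :
    bernoulliExp p (fun ω => (2 : ℝ) ^ (riStep ω st).2.2.card) ≤ c * 2 ^ st.2.2.card := by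
  rcases riStep_cases hd with ⟨u, -, -, hstep⟩ | ⟨-, -, hstep⟩
  · have hp : ∀ ω, (2 : ℝ) ^ (riStep ω st).2.2.card
        ≤ 2 ^ st.2.2.card * 2 ^ (attrNbrs ω u (Finset.univ \ st.2.2)).card := by
      intro ω
      rw [hstep, ← pow_add]
      exact pow_le_pow_right₀ one_le_two (Finset.card_union_le _ _)
    refine (bernoulliExp_mono h0 h1 hp).trans ?_
    rw [bernoulliExp_const_mul, mul_comm c]
    gcongr
    exact htwo _ _
  · simp only [hstep]
    rw [bernoulliExp_const]
    exact le_mul_of_one_le_left (by positivity) hc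

/-- The probability that the number of active vertices stays below `L` for `j` steps decays
exponentially in `j / L ^ 2`, up to the probability that many attributes are discovered. -/
lemma bernoulliExp_survInd_le (h0 : 0 ≤ p) (h1 : p ≤ 1) {M L B q η e c : ℝ} {cap T : ℕ}
    (hM : 1 ≤ M) (hL : 1 ≤ L) (hq1 : q ≤ 1) (hq0 : 0 < q) (hMB : 8 * (B + 1) ≤ M * q)
    (hη0 : 0 ≤ η) (hη : η ≤ 1 / 4) (hηL : L * η ≤ q / 8) (hc : 1 ≤ c)
    (hmean : ∀ (u : Fin n) (U : Finset (Fin n)) (W : Finset (Fin k)), u ∉ U → n - e ≤ U.card →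
      k - (cap : ℝ) ≤ W.card →
      1 - η ≤ bernoulliExp p fun ω => ((linkedVertices ω u U W).card : ℝ))
    (hsq : ∀ (u : Fin n) (U : Finset (Fin n)) (W : Finset (Fin k)), u ∉ U →
      bernoulliExp p (fun ω => ((linkedVertices ω u U W).card : ℝ) ^ 2) ≤ B)
    (hzero : ∀ (u : Fin n) (U : Finset (Fin n)) (W : Finset (Fin k)),
      q ≤ bernoulliExp p fun ω => if (linkedVertices ω u U W).card = 0 then (1 : ℝ) else 0)
    (htwo : ∀ (u : Fin n) (W : Finset (Fin k)),
      bernoulliExp p (fun ω => (2 : ℝ) ^ (attrNbrs ω u W).card) ≤ c)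
    (hTn : T ≤ n) (hTe : T + L + 1 ≤ e) (j : ℕ)
    {st : Finset (Fin n) × Finset (Fin n) × Finset (Fin k)} (hd : Disjoint st.1 st.2.1)
    (hA : (st.1.card : ℝ) < L) (hE : st.2.1.card + j ≤ T) :
    bernoulliExp p (fun ω => survInd L ω j st)
      ≤ (1 - q / (2 * (M + 1) ^ 2 * L ^ 2)) ^ j / (((M + 1) ^ 2 - 1) * L ^ 2)
          * quadPot M L st.1.card + c ^ j / 2 ^ cap * 2 ^ st.2.2.card := by
  have hL0 : 0 < L := by linarith
  have ha : 0 < ((M + 1) ^ 2 - 1) * L ^ 2 := by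
    have : 0 < (M + 1) ^ 2 - 1 := by nlinarith
    positivity
  have hρ : 0 ≤ 1 - q / (2 * (M + 1) ^ 2 * L ^ 2) := by
    have e1 : (1 : ℝ) ≤ (M + 1) ^ 2 * L ^ 2 := by
      rw [← mul_pow]
      exact one_le_pow₀ (by nlinarith)
    have : q / (2 * (M + 1) ^ 2 * L ^ 2) ≤ 1 := by
      rw [div_le_one (by positivity)]
      nlinarith
    linarith
  induction j generalizing st with
  | zero =>
    simp only [survInd, bernoulliExp_const, pow_zero]
    have h2 : 1 ≤ 1 / (((M + 1) ^ 2 - 1) * L ^ 2) * quadPot M L st.1.card := by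
      rw [div_mul_eq_mul_div, one_mul, le_div_iff₀ ha, quadPot, if_pos hA]
      have : (st.1.card : ℝ) ^ 2 ≤ L ^ 2 := pow_le_pow_left₀ (by positivity) hA.le 2
      linarith
    have : (0 : ℝ) ≤ 1 / 2 ^ cap * 2 ^ st.2.2.card := by positivity
    linarith
  | succ j ih =>
    rcases lt_or_ge cap st.2.2.card with hD | hD
    · have h3 : (1 : ℝ) ≤ c ^ (j + 1) / 2 ^ cap * 2 ^ st.2.2.card := by
        rw [div_mul_eq_mul_div, le_div_iff₀ (by positivity), one_mul]
        calc (2 : ℝ) ^ cap ≤ 2 ^ st.2.2.card := pow_le_pow_right₀ one_le_two hD.le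
          _ ≤ c ^ (j + 1) * 2 ^ st.2.2.card :=
            le_mul_of_one_le_left (by positivity) (one_le_pow₀ hc)
      have h4 := bernoulliExp_mono h0 h1 fun ω => survInd_le_one L ω (j + 1) st
      rw [bernoulliExp_const] at h4
      have h5 : 0 ≤ (1 - q / (2 * (M + 1) ^ 2 * L ^ 2)) ^ (j + 1) / (((M + 1) ^ 2 - 1) * L ^ 2)
          * quadPot M L st.1.card :=
        mul_nonneg (div_nonneg (pow_nonneg hρ _) ha.le) (quadPot_nonneg hM _)
      linarith
    · have hEstep : ∀ ω, (riStep ω st).2.1.card ≤ st.2.1.card + 1 := by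
        intro ω
        rcases riStep_cases hd with ⟨u, -, -, hs⟩ | ⟨-, -, hs⟩
        · rw [hs]; exact Finset.card_insert_le _ _
        · rw [hs]; omega
      set K₁ := (1 - q / (2 * (M + 1) ^ 2 * L ^ 2)) ^ j / (((M + 1) ^ 2 - 1) * L ^ 2) with hK₁
      have hK₁0 : 0 ≤ K₁ := div_nonneg (pow_nonneg hρ _) ha.le
      set K₂ := c ^ j / (2 : ℝ) ^ cap with hK₂
      have hK₂0 : 0 ≤ K₂ := by positivity
      have hbell := bernoulliExp_comp_le h0 h1 (fun ω => riStep ω st)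
        (fun st' ω => if (st'.1.card : ℝ) < L then survInd L ω j st' else 0)
        (fun st' => K₁ * quadPot M L st'.1.card + K₂ * 2 ^ st'.2.2.card) revealed
        (fun ω ω' h => riStep_congr_of_revealed hd h)
        (fun ω ω₁ ω₂ h => by
          have := dependsOn_survInd L j (disjoint_riStep ω hd) h
          simp only at this ⊢
          rw [this])
        (fun ω => by
          by_cases hlt : ((riStep ω st).1.card : ℝ) < L
          · simp only [hlt, if_true]
            have := hEstep ω
            exact ih (disjoint_riStep ω hd) hlt (by omega)
          · simp only [hlt, if_false, bernoulliExp_const]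
            have := quadPot_nonneg (L := L) hM (riStep ω st).1.card
            positivity)
      refine hbell.trans ?_
      rw [bernoulliExp_add, bernoulliExp_const_mul, bernoulliExp_const_mul]
      have hEe : (st.2.1.card : ℝ) + L + 1 ≤ e := by
        have : (st.2.1.card : ℝ) ≤ T := by exact_mod_cast (by omega : st.2.1.card ≤ T)
        linarith
      have s1 := bernoulliExp_quadPot_riStep_le h0 h1 hM hL hq1 hq0 hMB hη0 hη hηL hmean hsq hzero
        hd hA (by omega) hEe (by exact_mod_cast hD)
      have s2 := bernoulliExp_two_pow_riStep_le h0 h1 hc htwo hd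
      calc _ ≤ K₁ * ((1 - q / (2 * (M + 1) ^ 2 * L ^ 2)) * quadPot M L st.1.card)
            + K₂ * (c * 2 ^ st.2.2.card) := by gcongr
        _ = _ := by rw [hK₁, hK₂, pow_succ, pow_succ]; ring

end Survival

/-! ### Estimates in the critical regime -/

section Critical

variable {γ β : ℝ} {n : ℕ}

lemma critical_le_bernoulliExp_card (hγ : 0 < γ) (hβ : 0 < β) (hcrit : β * γ ^ 2 = 1)
    (hn : 0 < n) (hp : γ / n ≤ 1) {T c : ℕ} (hT : 1 ≤ T) {x e : ℝ} (hTx : T ≤ x * n)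
    (he : e ≤ 3 * T) (hxc : γ ^ 2 * (1 + c) * x ≤ 1) {u : Fin n}
    {U : Finset (Fin n)} {W : Finset (Fin (Nat.floor (β * n)))} (hu : u ∉ U)
    (hU : n - e ≤ U.card) (hW : (Nat.floor (β * n) : ℝ) - ((c * T : ℕ) : ℝ) ≤ W.card) :
    1 - (4 + γ + γ ^ 2 * (1 + c)) * x
      ≤ bernoulliExp (γ / n) fun ω => ((linkedVertices ω u U W).card : ℝ) := by
  have hn' : (0 : ℝ) < n := by exact_mod_cast hn
  have hp0 : 0 ≤ γ / n := by positivity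
  refine le_trans ?_ (le_bernoulliExp_card_linkedVertices hp0 hp hu W)
  have hT' : (1 : ℝ) ≤ T := by exact_mod_cast hT
  have hx1 : 1 / (n : ℝ) ≤ x := by
    rw [div_le_iff₀ hn']; linarith
  have hx0 : 0 ≤ x := le_trans (by positivity) hx1
  have hUn : (U.card : ℝ) ≤ n := by
    exact_mod_cast (Finset.card_le_univ U).trans (by simp)
  have hWk : (W.card : ℝ) ≤ β * n := by
    have : W.card ≤ Nat.floor (β * n) := (Finset.card_le_univ W).trans (by simp)
    exact le_trans (by exact_mod_cast this) (Nat.floor_le (by positivity))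
  have hk : β * n - 1 ≤ (Nat.floor (β * n) : ℝ) := (Nat.sub_one_lt_floor _).le
  have e1 : (U.card : ℝ) * W.card ^ 2 * (γ / n) ^ 4 ≤ x := by
    calc (U.card : ℝ) * W.card ^ 2 * (γ / n) ^ 4 ≤ n * (β * n) ^ 2 * (γ / n) ^ 4 := by gcongr
      _ = (β * γ ^ 2) ^ 2 / n := by field_simp
      _ ≤ x := by rw [hcrit]; simpa using hx1
  have e2 : (U.card : ℝ) * W.card * (γ / n) ^ 3 ≤ γ * x := by
    calc (U.card : ℝ) * W.card * (γ / n) ^ 3 ≤ n * (β * n) * (γ / n) ^ 3 := by gcongr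
      _ = (β * γ ^ 2) * γ * (1 / n) := by field_simp
      _ ≤ γ * x := by rw [hcrit, one_mul]; gcongr
  have e3 : (1 - 3 * x) * n ≤ U.card := by nlinarith
  have e4 : (1 - γ ^ 2 * (1 + c) * x) * (β * n) ≤ W.card := by
    have : γ ^ 2 * (1 + c) * x * (β * n) = (1 + c) * (x * n) := by
      linear_combination (1 + c) * x * n * hcrit
    push_cast at hW
    have hc : (c : ℝ) * T ≤ c * (x * n) := by gcongr
    have : 1 ≤ x * n := by linarith
    nlinarith
  have e5 : (1 - 3 * x) * (1 - γ ^ 2 * (1 + c) * x) ≤ U.card * W.card * (γ / n) ^ 2 := by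
    calc (1 - 3 * x) * (1 - γ ^ 2 * (1 + c) * x)
        = ((1 - 3 * x) * n) * ((1 - γ ^ 2 * (1 + c) * x) * (β * n)) * (γ / n) ^ 2 := by
          field_simp
          linear_combination -(1 - 3 * x) * (1 - γ ^ 2 * (1 + c) * x) * hcrit
      _ ≤ U.card * W.card * (γ / n) ^ 2 := by
        have : 0 ≤ (1 - γ ^ 2 * (1 + c) * x) * (β * n) :=
          mul_nonneg (by linarith) (by positivity)
        gcongr
  have e6 : 0 ≤ 3 * x * (γ ^ 2 * (1 + c) * x) := by positivity
  nlinarith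

lemma critical_bernoulliExp_card_sq_le (hγ : 0 < γ) (hβ : 0 < β) (hcrit : β * γ ^ 2 = 1)
    (hn : 0 < n) (hp : γ / n ≤ 1) {u : Fin n} {U : Finset (Fin n)}
    {W : Finset (Fin (Nat.floor (β * n)))} (hu : u ∉ U) :
    bernoulliExp (γ / n) (fun ω => ((linkedVertices ω u U W).card : ℝ) ^ 2) ≤ 2 + γ := by
  have hn' : (0 : ℝ) < n := by exact_mod_cast hn
  have hp0 : 0 ≤ γ / n := by positivity
  refine (bernoulliExp_card_linkedVertices_sq_le hp0 hp hu W).trans ?_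
  have hUn : (U.card : ℝ) ≤ n := by
    exact_mod_cast (Finset.card_le_univ U).trans (by simp)
  have hWk : (W.card : ℝ) ≤ β * n := by
    have : W.card ≤ Nat.floor (β * n) := (Finset.card_le_univ W).trans (by simp)
    exact le_trans (by exact_mod_cast this) (Nat.floor_le (by positivity))
  calc _ ≤ ((n : ℝ) * (β * n) * (γ / n) ^ 2) ^ 2 + (n : ℝ) ^ 2 * (β * n) * (γ / n) ^ 3
        + n * (β * n) * (γ / n) ^ 2 := by gcongr
    _ = (β * γ ^ 2) ^ 2 + (β * γ ^ 2) * γ + β * γ ^ 2 := by field_simp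
    _ = 2 + γ := by rw [hcrit]; ring

lemma critical_le_bernoulliExp_eq_empty (hγ : 0 < γ) (hβ : 0 < β) (hn : 0 < n)
    (hp : γ / n ≤ 1 / 2) (u : Fin n) (U : Finset (Fin n))
    (W : Finset (Fin (Nat.floor (β * n)))) :
    Real.exp (-(2 * (β * γ)))
      ≤ bernoulliExp (γ / n) fun ω => if (linkedVertices ω u U W).card = 0 then (1 : ℝ) else 0 := by
  have hn' : (0 : ℝ) < n := by exact_mod_cast hn
  have hp0 : 0 ≤ γ / n := by positivity
  refine le_trans ?_ (le_bernoulliExp_linkedVertices_eq_empty hp0 (by linarith) u U W)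
  have hWk : (W.card : ℝ) ≤ β * n := by
    have : W.card ≤ Nat.floor (β * n) := (Finset.card_le_univ W).trans (by simp)
    exact le_trans (by exact_mod_cast this) (Nat.floor_le (by positivity))
  have h1 : Real.exp (-(2 * (γ / n))) ≤ 1 - γ / n := by
    have h2 : 1 + 2 * (γ / n) ≤ Real.exp (2 * (γ / n)) := by
      linarith [Real.add_one_le_exp (2 * (γ / n))]
    rw [Real.exp_neg, inv_le_comm₀ (Real.exp_pos _) (by linarith)]
    refine le_trans ?_ h2
    rw [inv_le_iff_one_le_mul₀ (by linarith)]
    nlinarith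
  calc Real.exp (-(2 * (β * γ))) = Real.exp (-(2 * (γ / n)) * (β * n)) := by
        congr 1; field_simp
    _ ≤ Real.exp (-(2 * (γ / n)) * W.card) := by
        apply Real.exp_le_exp.2
        apply mul_le_mul_of_nonpos_left hWk
        linarith
    _ = Real.exp (-(2 * (γ / n))) ^ W.card := by rw [← Real.exp_nat_mul]; congr 1; ring
    _ ≤ (1 - γ / n) ^ W.card := by gcongr

lemma critical_bernoulliExp_two_pow_le (hγ : 0 < γ) (hβ : 0 < β) (hn : 0 < n) (u : Fin n)
    (W : Finset (Fin (Nat.floor (β * n)))) :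
    bernoulliExp (γ / n) (fun ω => (2 : ℝ) ^ (attrNbrs ω u W).card) ≤ Real.exp (β * γ) := by
  have hn' : (0 : ℝ) < n := by exact_mod_cast hn
  have hp0 : 0 ≤ γ / n := by positivity
  have hWk : (W.card : ℝ) ≤ β * n := by
    have : W.card ≤ Nat.floor (β * n) := (Finset.card_le_univ W).trans (by simp)
    exact le_trans (by exact_mod_cast this) (Nat.floor_le (by positivity))
  rw [bernoulliExp_two_pow_card_attrNbrs]
  calc (1 + γ / n) ^ W.card ≤ Real.exp (γ / n) ^ W.card := by
        gcongr
        linarith [Real.add_one_le_exp (γ / n)]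
    _ = Real.exp (W.card * (γ / n)) := by rw [Real.exp_nat_mul]
    _ ≤ Real.exp (β * n * (γ / n)) := by gcongr
    _ = Real.exp (β * γ) := by congr 1; field_simp

end Critical

lemma geometric_add_geometric_le_exp {M δ q b s : ℝ} {h m c : ℕ} (hM : 1 ≤ M) (hδ : 0 < δ)
    (hq0 : 0 < q) (hq1 : q ≤ 1) (hL : 1 ≤ h * δ) (hδq : 8 * δ ^ 2 ≤ q)
    (hc : Real.exp (b + 1) ≤ 2 ^ c) (hm : 1 ≤ m) (hs : s = q / (2 * (M + 1) ^ 2 * δ ^ 2))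
    (hh : s / 4 - Real.log (1 - Real.exp (-(s / 4))) ≤ h) :
    (1 - q / (2 * (M + 1) ^ 2 * (h * δ) ^ 2)) ^ (m * h ^ 2) / (((M + 1) ^ 2 - 1) * (h * δ) ^ 2)
        * ((M + 1) ^ 2 * (h * δ) ^ 2) + Real.exp b ^ (m * h ^ 2) / 2 ^ (c * (m * h ^ 2))
      ≤ Real.exp (-(m * (s / 4))) := by
  have hh0 : (0 : ℝ) < h := by
    by_contra hcon
    have : (h : ℝ) * δ ≤ 0 := mul_nonpos_of_nonpos_of_nonneg (not_lt.1 hcon) hδ.le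
    linarith
  have hh1 : (1 : ℝ) ≤ h := by exact_mod_cast hh0
  have hm1 : (1 : ℝ) ≤ m := by exact_mod_cast hm
  have ha : 4 ≤ (M + 1) ^ 2 := by nlinarith
  set a := (M + 1) ^ 2 with ha'
  have hs0 : 0 < s := by rw [hs]; positivity
  have hρ0 : 0 ≤ 1 - q / (2 * a * (h * δ) ^ 2) := by
    have : q / (2 * a * (h * δ) ^ 2) ≤ 1 := by
      rw [div_le_one (by positivity)]
      have : 1 ≤ (h * δ) ^ 2 := one_le_pow₀ hL
      nlinarith
    linarith
  have h1 : (1 - q / (2 * a * (h * δ) ^ 2)) ^ (m * h ^ 2) ≤ Real.exp (-(m * s)) := by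
    calc (1 - q / (2 * a * (h * δ) ^ 2)) ^ (m * h ^ 2)
        ≤ Real.exp (-(q / (2 * a * (h * δ) ^ 2))) ^ (m * h ^ 2) := by
          gcongr
          linarith [Real.add_one_le_exp (-(q / (2 * a * (h * δ) ^ 2)))]
      _ = Real.exp (-(m * s)) := by
          rw [← Real.exp_nat_mul, hs]
          congr 1
          push_cast
          field_simp
  have h2 : a / (a - 1) ≤ Real.exp (s / 2) := by
    have e1 : a / (a - 1) = 1 + 1 / (a - 1) := by
      have : a - 1 ≠ 0 := by linarith
      field_simp
      ring
    have e2 : 1 / (a - 1) ≤ s / 2 := by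
      have e3 : 1 / (a - 1) ≤ 2 / a := by
        rw [div_le_div_iff₀ (by linarith) (by linarith)]; linarith
      have e4 : 2 / a ≤ s / 2 := by
        rw [hs, div_div, div_le_div_iff₀ (by linarith) (by positivity)]
        nlinarith
      linarith
    rw [e1]
    linarith [Real.add_one_le_exp (s / 2)]
  have h3 : (1 - q / (2 * a * (h * δ) ^ 2)) ^ (m * h ^ 2) / ((a - 1) * (h * δ) ^ 2)
      * (a * (h * δ) ^ 2) ≤ Real.exp (-(m * (s / 4))) * Real.exp (-(s / 4)) := by
    have e1 : (1 - q / (2 * a * (h * δ) ^ 2)) ^ (m * h ^ 2) / ((a - 1) * (h * δ) ^ 2)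
      * (a * (h * δ) ^ 2) = (1 - q / (2 * a * (h * δ) ^ 2)) ^ (m * h ^ 2) * (a / (a - 1)) := by
      have : a - 1 ≠ 0 := by linarith
      field_simp
    rw [e1]
    have e0 : 0 ≤ a / (a - 1) := div_nonneg (by linarith) (by linarith)
    calc _ ≤ Real.exp (-(m * s)) * Real.exp (s / 2) := by gcongr
      _ = Real.exp (-(m * s) + s / 2) := by rw [Real.exp_add]
      _ ≤ Real.exp (-(m * (s / 4)) + -(s / 4)) := by
        apply Real.exp_le_exp.2
        nlinarith
      _ = _ := by rw [Real.exp_add]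
  have hκ0 : 0 < 1 - Real.exp (-(s / 4)) := by
    have : Real.exp (-(s / 4)) < 1 := Real.exp_lt_one_iff.2 (by linarith)
    linarith
  have hκ1 : Real.log (1 - Real.exp (-(s / 4))) ≤ 0 :=
    Real.log_nonpos hκ0.le (by linarith [Real.exp_pos (-(s / 4))])
  have h4 : Real.exp b ^ (m * h ^ 2) / 2 ^ (c * (m * h ^ 2))
      ≤ Real.exp (-(m * (s / 4))) * (1 - Real.exp (-(s / 4))) := by
    calc Real.exp b ^ (m * h ^ 2) / 2 ^ (c * (m * h ^ 2))
        = (Real.exp b / 2 ^ c) ^ (m * h ^ 2) := by rw [div_pow, ← pow_mul]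
      _ ≤ Real.exp (-1) ^ (m * h ^ 2) := by
        gcongr
        rw [div_le_iff₀ (by positivity)]
        calc Real.exp b = Real.exp (-1) * Real.exp (b + 1) := by rw [← Real.exp_add]; ring_nf
          _ ≤ Real.exp (-1) * 2 ^ c := by gcongr
      _ = Real.exp (-((m : ℝ) * h ^ 2)) := by
        rw [← Real.exp_nat_mul]; push_cast; ring_nf
      _ ≤ Real.exp (-(m * (s / 4)) + Real.log (1 - Real.exp (-(s / 4)))) := by
        apply Real.exp_le_exp.2
        have e1 : (h : ℝ) ≤ h ^ 2 := by nlinarith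
        have e2 : 0 ≤ (h : ℝ) ^ 2 - s / 4 := by linarith
        nlinarith
      _ = _ := by rw [Real.exp_add, Real.exp_log hκ0]
  nlinarith [Real.exp_pos (-(m * (s / 4)))]

lemma riState_eq_iterate {n k : ℕ} (ω : Fin n × Fin k → Bool) (t : ℕ) :
    riState ω t = (riStep ω)^[t] (Finset.univ.filter fun v : Fin n => (v : ℕ) = 0, ∅, ∅) := by
  induction t with
  | zero => rfl
  | succ t ih => rw [Function.iterate_succ_apply', ← ih, riState]

theorem few_active_vertices_stretched_bound_RIG (γ β : ℝ) (hγ : 0 < γ) (hβ : 0 < β)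
    (hcrit : β * γ ^ 2 = 1) (h m : ℕ → ℕ) (hh : Tendsto h atTop atTop)
    (hO : (fun n : ℕ => (m n * (h n) ^ 3 : ℝ) / n) =O[atTop] (fun _ : ℕ => (1 : ℝ))) :
    ∃ δ₀ > (0 : ℝ), ∀ δ : ℝ, 0 < δ → δ ≤ δ₀ → ∃ c₀ > (0 : ℝ),
      ∀ᶠ n : ℕ in atTop,
        riMeasure n (Nat.floor (β * n)) (γ / n)
            {ω | ∀ t, 1 ≤ t → t ≤ m n * (h n) ^ 2 → (riY ω t : ℝ) < (h n : ℝ) * δ}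
          ≤ ENNReal.ofReal (Real.exp (-((m n : ℝ) * c₀))) := by
  obtain ⟨K₀, hK₀⟩ := hO.bound
  set K := max K₀ 1 with hK
  have hK1 : 1 ≤ K := le_max_right _ _
  have hb : 0 < β * γ := by positivity
  obtain ⟨c, hc⟩ := pow_unbounded_of_one_lt (Real.exp (β * γ + 1)) (one_lt_two : (1 : ℝ) < 2)
  set q := Real.exp (-(2 * (β * γ))) with hq
  have hq0 : 0 < q := Real.exp_pos _
  have hq1 : q ≤ 1 := Real.exp_le_one_iff.2 (by linarith)
  set M := 8 * (2 + γ + 1) / q with hM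
  have hMq : 8 * (2 + γ + 1) ≤ M * q := by rw [hM, div_mul_cancel₀ _ hq0.ne']
  have hM1 : 1 ≤ M := by
    rw [hM, one_le_div hq0]; linarith
  set D := 4 + γ + γ ^ 2 * (1 + c) with hD
  have hγc : 0 ≤ γ ^ 2 * (1 + (c : ℝ)) := by positivity
  have hD1 : 4 ≤ D := by rw [hD]; linarith
  have hDK : 1 ≤ D * K := by nlinarith only [hD1, hK1]
  refine ⟨q / (8 * (D * K)), by positivity, fun δ hδ0 hδ => ?_⟩
  have hδ' : δ * (D * K) ≤ q / 8 := by
    rw [le_div_iff₀ (by positivity)] at hδ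
    linarith
  have hδq : 8 * δ ≤ q := by nlinarith only [hδ', hδ0, hDK]
  have hδ1 : δ ≤ 1 := by linarith
  set s := q / (2 * (M + 1) ^ 2 * δ ^ 2) with hs
  have hs0 : 0 < s := by positivity
  refine ⟨s / 4, by positivity, ?_⟩
  have hhR : Tendsto (fun n => (h n : ℝ)) atTop atTop := tendsto_natCast_atTop_atTop.comp hh
  filter_upwards [hK₀, eventually_gt_atTop 0,
    tendsto_natCast_atTop_atTop.eventually_ge_atTop (2 * γ),
    hhR.eventually_ge_atTop (4 * (D * K)), hhR.eventually_ge_atTop (2 / δ),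
    hhR.eventually_ge_atTop (s / 4 - Real.log (1 - Real.exp (-(s / 4))))]
    with n hn1 hn0 hnγ hhD hhδ hhs
  have hn' : (0 : ℝ) < n := by exact_mod_cast hn0
  have hp0 : 0 ≤ γ / n := by positivity
  have hp2 : γ / n ≤ 1 / 2 := by
    rw [div_le_div_iff₀ hn' two_pos]; linarith
  have hp1 : γ / n ≤ 1 := by linarith
  classical
  rw [riMeasure_eq_bernoulliExp hp0 hp1]
  refine ENNReal.ofReal_le_ofReal ?_
  rcases Nat.eq_zero_or_pos (m n) with hm | hm
  · rw [hm]
    refine (bernoulliExp_mono hp0 hp1 (g := fun _ => 1) fun ω => ?_).trans ?_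
    · split_ifs <;> norm_num
    · rw [bernoulliExp_const]; simp
  have hm1 : (1 : ℝ) ≤ m n := by exact_mod_cast hm
  have hhpos : (0 : ℝ) < h n := by linarith
  have hh1 : (1 : ℝ) ≤ h n := by exact_mod_cast hhpos
  have hL2 : 2 ≤ h n * δ := by rwa [div_le_iff₀ hδ0] at hhδ
  set T := m n * h n ^ 2 with hT
  have hTR : (T : ℝ) = m n * h n ^ 2 := by rw [hT]; push_cast; ring
  have hTh : (h n : ℝ) ≤ T := by
    rw [hTR]; nlinarith only [hh1, hm1, mul_le_mul hm1 hh1 zero_le_one (by linarith)]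
  have hT1 : 1 ≤ T := by
    have : (1 : ℝ) ≤ T := hh1.trans hTh
    exact_mod_cast this
  have hTx : (T : ℝ) ≤ K / h n * n := by
    rw [norm_one, mul_one, Real.norm_of_nonneg (by positivity), div_le_iff₀ hn'] at hn1
    have : (m n : ℝ) * h n ^ 3 ≤ K * n :=
      hn1.trans (mul_le_mul_of_nonneg_right (le_max_left _ _) hn'.le)
    rw [div_mul_eq_mul_div, le_div_iff₀ hhpos, hTR]
    linarith
  have hx0 : 0 ≤ K / h n := by positivity
  have hDx : D * (K / h n) ≤ 1 / 4 := by
    rw [← mul_div_assoc, div_le_iff₀ hhpos]; linarith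
  have hxc : γ ^ 2 * (1 + c) * (K / h n) ≤ 1 := by
    have : γ ^ 2 * (1 + c) * (K / h n) ≤ D * (K / h n) := by
      gcongr
      rw [hD]; linarith
    linarith
  have hTn : T ≤ n := by
    have hx1 : K / h n ≤ 1 := by nlinarith only [hDx, hD1, hx0]
    have : (T : ℝ) ≤ n := hTx.trans (mul_le_of_le_one_left hn'.le hx1)
    exact_mod_cast this
  have he : (T : ℝ) + h n * δ + 1 ≤ 3 * T := by
    have : h n * δ ≤ h n := mul_le_of_le_one_right hhpos.le hδ1
    have : (1 : ℝ) ≤ T := by exact_mod_cast hT1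
    linarith
  set st₀ : Finset (Fin n) × Finset (Fin n) × Finset (Fin (Nat.floor (β * n))) :=
    (Finset.univ.filter fun v : Fin n => (v : ℕ) = 0, ∅, ∅) with hst₀
  have hA₀ : (st₀.1.card : ℝ) < h n * δ := by
    have : st₀.1.card ≤ 1 := by
      rw [Finset.card_le_one]
      intro a ha b hb
      simp only [hst₀, Finset.mem_filter, Finset.mem_univ, true_and] at ha hb
      exact Fin.ext (ha.trans hb.symm)
    have : (st₀.1.card : ℝ) ≤ 1 := by exact_mod_cast this
    linarith
  refine (bernoulliExp_mono hp0 hp1 (g := fun ω => survInd (h n * δ) ω T st₀) fun ω => ?_).trans ?_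
  · split_ifs with hω
    · rw [survInd_eq_one fun i h1 h2 => ?_]
      rw [← riState_eq_iterate]
      exact hω i h1 h2
    · exact survInd_nonneg _ _ _ _
  have hmain := bernoulliExp_survInd_le (M := M) (L := h n * δ) (B := 2 + γ) (q := q)
    (η := D * (K / h n)) (e := T + h n * δ + 1) (c := Real.exp (β * γ)) (cap := c * T) (T := T)
    hp0 hp1 hM1 (by linarith) hq1 hq0 hMq (by positivity) hDx
    (by
      have : h n * δ * (D * (K / h n)) = δ * (D * K) := by field_simp
      rw [this]; exact hδ')
    (Real.one_le_exp hb.le)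
    (fun u U W hu hU hW => critical_le_bernoulliExp_card hγ hβ hcrit hn0 hp1 hT1 hTx he hxc
      hu hU hW)
    (fun u U W hu => critical_bernoulliExp_card_sq_le hγ hβ hcrit hn0 hp1 hu)
    (fun u U W => critical_le_bernoulliExp_eq_empty hγ hβ hn0 hp2 u U W)
    (fun u W => critical_bernoulliExp_two_pow_le hγ hβ hn0 u W)
    hTn le_rfl T (st := st₀) (by simp [hst₀]) hA₀ (by simp [hst₀])
  refine hmain.trans ?_
  refine le_trans ?_ (geometric_add_geometric_le_exp (b := β * γ) hM1 hδ0 hq0 hq1 (by linarith)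
    (by nlinarith only [hδq, hδ1, hδ0]) hc.le hm hs hhs)
  have hpot : quadPot M (h n * δ) st₀.1.card ≤ (M + 1) ^ 2 * (h n * δ) ^ 2 := by
    rw [quadPot, if_pos hA₀]
    linarith [sq_nonneg (st₀.1.card : ℝ)]
  have hL1 : (1 : ℝ) ≤ (M + 1) ^ 2 * (h n * δ) ^ 2 := by
    rw [← mul_pow]
    exact one_le_pow₀ (by nlinarith only [hM1, hL2])
  have hρ : 0 ≤ 1 - q / (2 * (M + 1) ^ 2 * (h n * δ) ^ 2) := by
    rw [sub_nonneg, div_le_one (by positivity)]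
    linarith
  have ha : 0 ≤ (M + 1) ^ 2 - 1 := by nlinarith only [hM1]
  have hD₀ : (2 : ℝ) ^ st₀.2.2.card = 1 := by simp [hst₀]
  rw [hD₀, mul_one]
  gcongr

end
end

section
/- Suppose F(β,λ) = 1. Let h = h(n), m = m(n) ∈ ℕ with h → ∞ and let δ ∈ (0,1) be a constant. Suppose that m h² / n = O(1) and T² / (h n) ≤ δ/2. Then for all sufficiently large n, P({t*_i − t*_{i−1} < T for all i} ∩ {∃ t ∈ [m h²] : Y_t ≥ h δ}) ≤ max(e^{−c h}, e^{−c h²/T}) for some constant c = c(λ,β,δ) > 0. -/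
/-!
Statement 18 (Proposition `Prop1Gntheta`, reduced exploration process of the critical
quantum random graph, `F(β,λ) = 1`): let `h = h(n), m = m(n) ∈ ℕ` with `h → ∞` and
`δ ∈ (0,1)` a constant.  If `m h²/n = O(1)` and `T²/(hn) ≤ δ/2`, then for all
sufficiently large `n`,
`P({t*_i - t*_{i-1} < T ∀ i} ∩ {∃ t ∈ [m h²] : Y_t ≥ hδ}) ≤ max(e^{-ch}, e^{-ch²/T})`
for some constant `c = c(λ,β,δ) > 0`.
-/

open MeasureTheory Filter Asymptotics ProbabilityTheory

noncomputable section

/-- The binomial measure `Bin(N, p)` on `ℕ`. -/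
def binomialMeasure (N : ℕ) (p : ℝ) : Measure ℕ :=
  ∑ k ∈ Finset.range (N + 1),
    ENNReal.ofReal ((N.choose k : ℝ) * p ^ k * (1 - p) ^ (N - k)) • Measure.dirac k

/-- The cut-gamma law `Γ_θ(2,1)`, the law of `(J₁+J₂) ∧ θ` for `J₁, J₂` iid `Exp(1)`:
density `x e^{-x}` on `[0,θ)` and an atom of mass `(1+θ)e^{-θ}` at `θ`. -/
def cutGammaMeasure (θ : ℝ) : Measure ℝ :=
  volume.withDensity
      (fun x => ENNReal.ofReal (if 0 ≤ x ∧ x < θ then x * Real.exp (-x) else 0)) +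
    ENNReal.ofReal ((1 + θ) * Real.exp (-θ)) • Measure.dirac θ

/-- `(Ω, μ, F, Y, η, J)` is a realization of the reduced exploration process of the
quantum random graph `G(n,β,λ)` (in the equivalent description with circles of length
`θ = λβ`, rate-one Poisson holes and link intensity `1/(λn)`): `Y t` is the number of
active points at the end of step `t`, `η t` is the number of new active points created
at step `t`, `J t` are the iid cut-gamma `Γ_{λβ}(2,1)` lengths, and conditionally on
`F_{t-1}` and `J_t` the variable `η_t` is binomial
`Bin(n - (t-1) - Y_{t-1} - 1_{Y_{t-1}=0}, 1 - e^{-J_t/(λn)})`. -/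
structure IsReducedQuantumExploration (n : ℕ) (β lam : ℝ) {Ω : Type*}
    [m0 : MeasurableSpace Ω] (μ : Measure Ω) (F : ℕ → MeasurableSpace Ω)
    (Y η : ℕ → Ω → ℕ) (J : ℕ → Ω → ℝ) : Prop where
  prob : IsProbabilityMeasure μ
  F_mono : Monotone F
  F_le : ∀ t, F t ≤ m0
  Y_zero : ∀ ω, Y 0 ω = 1
  Y_adapted : ∀ t, @Measurable Ω ℕ (F t) _ (Y t)
  J_adapted : ∀ t, 1 ≤ t → @Measurable Ω ℝ (F t) _ (J t)
  J_law : ∀ t, 1 ≤ t → Measure.map (J t) μ = cutGammaMeasure (lam * β)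
  J_indep : ∀ t, 1 ≤ t →
    Indep (MeasurableSpace.comap (J t) (borel ℝ)) (F (t - 1)) μ
  Y_rec : ∀ t, 1 ≤ t → ∀ ω,
    Y t ω = if 0 < Y (t - 1) ω then Y (t - 1) ω + η t ω - 1 else η t ω
  eta_condLaw : ∀ t, 1 ≤ t → ∀ s : Set ℕ,
    (μ[Set.indicator {ω | η t ω ∈ s} (fun _ => (1 : ℝ)) |
        F (t - 1) ⊔ MeasurableSpace.comap (J t) (borel ℝ)])
      =ᵐ[μ] fun ω =>
        (binomialMeasure
            (n - (t - 1) - Y (t - 1) ω - (if Y (t - 1) ω = 0 then 1 else 0))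
            (1 - Real.exp (-(J t ω) / (lam * n))) s).toReal

/-- The hitting times of `0` of the process `Y`: `t*_0 = 0` and
`t*_i = min {t > t*_{i-1} : Y_t = 0}`. -/
def hitZero {Ω : Type*} (Y : ℕ → Ω → ℕ) (ω : Ω) : ℕ → ℕ
  | 0 => 0
  | i + 1 => sInf {t | hitZero Y ω i < t ∧ Y t ω = 0}

/-- The interval-hole density integrated against its length. -/
theorem integral_sq_mul_exp_neg (θ : ℝ) :
    ∫ x in (0 : ℝ)..θ, x ^ 2 * Real.exp (-x) = 2 - (θ ^ 2 + 2 * θ + 2) * Real.exp (-θ) := by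
  rw [intervalIntegral.integral_eq_sub_of_hasDerivAt
    (f := fun x => -((x ^ 2 + 2 * x + 2) * Real.exp (-x)))]
  · simp; ring
  · intro x _
    have h1 : HasDerivAt (fun x : ℝ => Real.exp (-x)) (-Real.exp (-x)) x := by
      simpa using (hasDerivAt_neg x).exp
    have h2 : HasDerivAt (fun x : ℝ => x ^ 2 + 2 * x + 2) (2 * x + 2) x := by
      simpa using (((hasDerivAt_pow 2 x).add ((hasDerivAt_id x).const_mul 2)).add_const 2)
    have h3 : HasDerivAt (fun x : ℝ => -((x ^ 2 + 2 * x + 2) * Real.exp (-x))) _ x :=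
      (h2.mul h1).neg
    exact h3.congr_deriv (by ring)
  · apply Continuous.intervalIntegrable
    fun_prop

theorem measurable_cutGamma_density (θ : ℝ) :
    Measurable (fun x : ℝ =>
      ENNReal.ofReal (if 0 ≤ x ∧ x < θ then x * Real.exp (-x) else 0)) := by
  apply Measurable.ennreal_ofReal
  apply Measurable.ite
  · exact (measurableSet_Ici (a := (0 : ℝ))).inter (measurableSet_Iio (a := θ))
  · fun_prop
  · fun_prop

theorem cutGammaMeasure_ae_mem {θ : ℝ} (hθ : 0 < θ) :
    ∀ᵐ x ∂cutGammaMeasure θ, x ∈ Set.Icc 0 θ := by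
  rw [cutGammaMeasure, ae_add_measure_iff]
  constructor
  · rw [ae_withDensity_iff (measurable_cutGamma_density θ)]
    refine ae_of_all _ fun x hx => ?_
    by_contra h
    apply hx
    rw [if_neg, ENNReal.ofReal_zero]
    exact fun h' => h ⟨h'.1, h'.2.le⟩
  · apply Measure.ae_smul_measure
    exact (ae_dirac_iff measurableSet_Icc).2 ⟨hθ.le, le_rfl⟩

theorem integral_cutGammaMeasure {θ : ℝ} (hθ : 0 < θ)
    [IsProbabilityMeasure (cutGammaMeasure θ)] :
    ∫ x, x ∂cutGammaMeasure θ = 2 * (1 - Real.exp (-θ)) - θ * Real.exp (-θ) := by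
  have hint : Integrable (fun x : ℝ => x) (cutGammaMeasure θ) := by
    refine Integrable.of_bound (by fun_prop) θ ?_
    filter_upwards [cutGammaMeasure_ae_mem hθ] with x hx
    rw [Real.norm_eq_abs, abs_of_nonneg hx.1]
    exact hx.2
  have hint' := hint
  rw [cutGammaMeasure, integrable_add_measure] at hint'
  rw [cutGammaMeasure, integral_add_measure hint'.1 hint'.2,
    integral_withDensity_eq_integral_toReal_smul (measurable_cutGamma_density θ) (by simp),
    integral_smul_measure, integral_dirac]
  have h1 : (fun x : ℝ => (ENNReal.ofReal
      (if 0 ≤ x ∧ x < θ then x * Real.exp (-x) else 0)).toReal • x)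
      = (Set.Ico 0 θ).indicator (fun x => x ^ 2 * Real.exp (-x)) := by
    funext x
    by_cases h : 0 ≤ x ∧ x < θ
    · rw [if_pos h, Set.indicator_of_mem (show x ∈ Set.Ico 0 θ from h),
        ENNReal.toReal_ofReal (mul_nonneg h.1 (Real.exp_pos _).le), smul_eq_mul]
      ring
    · rw [if_neg h, Set.indicator_of_notMem (show x ∉ Set.Ico 0 θ from h)]
      simp
  rw [h1, integral_indicator measurableSet_Ico, integral_Ico_eq_integral_Ioc,
    ← intervalIntegral.integral_of_le hθ.le, integral_sq_mul_exp_neg,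
    ENNReal.toReal_ofReal (by positivity), smul_eq_mul]
  ring

/-- Probability that two points of a configuration are joined, given interval length `j`. -/
def linkProb (n : ℕ) (lam j : ℝ) : ℝ := 1 - Real.exp (-j / (lam * n))

/-- The law of the number of offspring when `N` vertices are available. -/
def offspringProb (n : ℕ) (β lam : ℝ) (N k : ℕ) : ℝ :=
  ∫ j, ((N.choose k : ℝ) * linkProb n lam j ^ k * (1 - linkProb n lam j) ^ (N - k))
    ∂cutGammaMeasure (lam * β)

/-- The averaged link probability. -/
def meanLinkProb (n : ℕ) (β lam : ℝ) : ℝ := ∫ j, linkProb n lam j ∂cutGammaMeasure (lam * β)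

@[fun_prop]
theorem measurable_linkProb (n : ℕ) (lam : ℝ) : Measurable (linkProb n lam) := by
  unfold linkProb; fun_prop

section
variable {n : ℕ} {β lam : ℝ}

theorem linkProb_bounds (hn : 0 < n) (hlam : 0 < lam) {j : ℝ}
    (hj : j ∈ Set.Icc 0 (lam * β)) :
    0 ≤ linkProb n lam j ∧ linkProb n lam j ≤ 1 ∧ linkProb n lam j ≤ β / n ∧
      linkProb n lam j ≤ j / (lam * n) ∧
      j / (lam * n) - β ^ 2 / n ^ 2 ≤ linkProb n lam j ∧
      Real.exp (-(β / n)) ≤ 1 - linkProb n lam j := by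
  have hn' : (0 : ℝ) < n := by exact_mod_cast hn
  have hx0 : 0 ≤ j / (lam * n) := div_nonneg hj.1 (by positivity)
  have hx1 : j / (lam * n) ≤ β / n := by
    rw [div_le_div_iff₀ (by positivity) hn']
    nlinarith [hj.2]
  unfold linkProb
  rw [neg_div]
  set x := j / (lam * n)
  have h1 := Real.add_one_le_exp (-x)
  have h2 : Real.exp (-x) ≤ 1 := Real.exp_le_one_iff.2 (by linarith)
  refine ⟨by linarith, by linarith [Real.exp_pos (-x)], by linarith, by linarith, ?_, ?_⟩
  · have h3 : Real.exp (-x) ≤ 1 - x + x ^ 2 := by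
      rcases le_or_gt x 1 with h | h
      · have := (abs_le.1 (Real.abs_exp_sub_one_sub_id_le (x := -x)
          (by rw [abs_neg, abs_of_nonneg hx0]; exact h))).2
        nlinarith
      · nlinarith
    have h4 : x ^ 2 ≤ β ^ 2 / n ^ 2 := by
      rw [← div_pow]; exact pow_le_pow_left₀ hx0 hx1 2
    linarith
  · have : Real.exp (-(β / n)) ≤ Real.exp (-x) := Real.exp_le_exp.2 (by linarith)
    linarith

theorem meanLinkProb_nonneg (hβ : 0 < β) (hlam : 0 < lam) (hn : 0 < n) :
    0 ≤ meanLinkProb n β lam := by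
  refine integral_nonneg_of_ae ?_
  filter_upwards [cutGammaMeasure_ae_mem (mul_pos hlam hβ)] with j hj
  exact (linkProb_bounds hn hlam hj).1

theorem offspringProb_nonneg (hβ : 0 < β) (hlam : 0 < lam) (hn : 0 < n) (N k : ℕ) :
    0 ≤ offspringProb n β lam N k := by
  refine integral_nonneg_of_ae ?_
  filter_upwards [cutGammaMeasure_ae_mem (mul_pos hlam hβ)] with j hj
  have := linkProb_bounds hn hlam hj
  have h1 : 0 ≤ 1 - linkProb n lam j := by linarith
  have h0 := this.1
  simp only [Pi.zero_apply]
  positivity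

theorem sum_binomial_mul_pow (N : ℕ) (p w : ℝ) :
    ∑ k ∈ Finset.range (N + 1), (N.choose k : ℝ) * p ^ k * (1 - p) ^ (N - k) * w ^ k =
      (1 + p * (w - 1)) ^ N := by
  have : 1 + p * (w - 1) = p * w + (1 - p) := by ring
  rw [this, add_pow]
  refine Finset.sum_congr rfl fun k _ => ?_
  rw [mul_pow]; ring

variable [IsProbabilityMeasure (cutGammaMeasure (lam * β))]

theorem integrable_of_continuous_linkProb (hβ : 0 < β) (hlam : 0 < lam) (hn : 0 < n)
    {g : ℝ → ℝ} (hg : Continuous g) :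
    Integrable (fun j => g (linkProb n lam j)) (cutGammaMeasure (lam * β)) := by
  obtain ⟨M, hM⟩ := (isCompact_Icc (a := (0 : ℝ)) (b := 1)).exists_bound_of_continuousOn
    hg.continuousOn
  refine Integrable.of_bound
    (hg.measurable.comp (measurable_linkProb n lam)).aestronglyMeasurable M ?_
  filter_upwards [cutGammaMeasure_ae_mem (mul_pos hlam hβ)] with j hj
  have := linkProb_bounds hn hlam hj
  exact hM _ ⟨this.1, this.2.1⟩

theorem integrable_linkProb (hβ : 0 < β) (hlam : 0 < lam) (hn : 0 < n) :
    Integrable (linkProb n lam) (cutGammaMeasure (lam * β)) :=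
  integrable_of_continuous_linkProb hβ hlam hn (g := fun p => p) continuous_id'

theorem integrable_id_cutGammaMeasure (hβ : 0 < β) (hlam : 0 < lam) :
    Integrable (fun x : ℝ => x) (cutGammaMeasure (lam * β)) := by
  refine Integrable.of_bound (by fun_prop) (lam * β) ?_
  filter_upwards [cutGammaMeasure_ae_mem (mul_pos hlam hβ)] with x hx
  rw [Real.norm_eq_abs, abs_of_nonneg hx.1]
  exact hx.2

theorem integral_cutGammaMeasure_of_critical (hβ : 0 < β) (hlam : 0 < lam)
    (hcrit : lam⁻¹ * (2 * (1 - Real.exp (-(lam * β))) -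
      lam * β * Real.exp (-(lam * β))) = 1) :
    ∫ x, x ∂cutGammaMeasure (lam * β) = lam := by
  rw [integral_cutGammaMeasure (mul_pos hlam hβ)]
  rwa [inv_mul_eq_one₀ hlam.ne', eq_comm] at hcrit

theorem meanLinkProb_le (hβ : 0 < β) (hlam : 0 < lam) (hn : 0 < n)
    (hcrit : lam⁻¹ * (2 * (1 - Real.exp (-(lam * β))) -
      lam * β * Real.exp (-(lam * β))) = 1) :
    meanLinkProb n β lam ≤ 1 / n := by
  have hval : ∫ x, x / (lam * n) ∂cutGammaMeasure (lam * β) = 1 / n := by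
    rw [integral_div, integral_cutGammaMeasure_of_critical hβ hlam hcrit,
      div_mul_eq_div_div, div_self hlam.ne']
  rw [← hval]
  refine integral_mono_ae (integrable_linkProb hβ hlam hn)
    ((integrable_id_cutGammaMeasure hβ hlam).div_const _) ?_
  filter_upwards [cutGammaMeasure_ae_mem (mul_pos hlam hβ)] with j hj
  exact (linkProb_bounds hn hlam hj).2.2.2.1

theorem le_meanLinkProb (hβ : 0 < β) (hlam : 0 < lam) (hn : 0 < n)
    (hcrit : lam⁻¹ * (2 * (1 - Real.exp (-(lam * β))) -
      lam * β * Real.exp (-(lam * β))) = 1) :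
    1 / n - β ^ 2 / n ^ 2 ≤ meanLinkProb n β lam := by
  have hint : Integrable (fun x : ℝ => x / (lam * n)) (cutGammaMeasure (lam * β)) :=
    (integrable_id_cutGammaMeasure hβ hlam).div_const _
  have hval : ∫ x, (x / (lam * n) - β ^ 2 / n ^ 2) ∂cutGammaMeasure (lam * β)
      = 1 / n - β ^ 2 / n ^ 2 := by
    rw [integral_sub hint (integrable_const _), integral_div,
      integral_cutGammaMeasure_of_critical hβ hlam hcrit,
      div_mul_eq_div_div, div_self hlam.ne', integral_const, probReal_univ, one_smul]
  rw [← hval]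
  refine integral_mono_ae (hint.sub (integrable_const _))
    (integrable_linkProb hβ hlam hn) ?_
  filter_upwards [cutGammaMeasure_ae_mem (mul_pos hlam hβ)] with j hj
  exact (linkProb_bounds hn hlam hj).2.2.2.2.1

theorem sum_offspringProb_mul (hβ : 0 < β) (hlam : 0 < lam) (hn : 0 < n) (N : ℕ)
    (g : ℕ → ℝ) :
    ∑ k ∈ Finset.range (N + 1), offspringProb n β lam N k * g k =
      ∫ j, ∑ k ∈ Finset.range (N + 1), (N.choose k : ℝ) * linkProb n lam j ^ k *
        (1 - linkProb n lam j) ^ (N - k) * g k ∂cutGammaMeasure (lam * β) := by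
  rw [integral_finsetSum]
  · refine Finset.sum_congr rfl fun k _ => ?_
    rw [integral_mul_const]; rfl
  · intro k _
    exact integrable_of_continuous_linkProb hβ hlam hn
      (g := fun p => (N.choose k : ℝ) * p ^ k * (1 - p) ^ (N - k) * g k) (by fun_prop)

theorem sum_offspringProb (hβ : 0 < β) (hlam : 0 < lam) (hn : 0 < n) (N : ℕ) :
    ∑ k ∈ Finset.range (N + 1), offspringProb n β lam N k = 1 := by
  have := sum_offspringProb_mul hβ hlam hn N (fun _ => 1)
  simp only [mul_one] at this
  rw [this]
  have h : ∀ j, ∑ k ∈ Finset.range (N + 1), (N.choose k : ℝ) * linkProb n lam j ^ k *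
        (1 - linkProb n lam j) ^ (N - k) = 1 := fun j => by
    simpa using sum_binomial_mul_pow N (linkProb n lam j) 1
  simp [h]

theorem sum_offspringProb_mul_id (hβ : 0 < β) (hlam : 0 < lam) (hn : 0 < n) (N : ℕ) :
    ∑ k ∈ Finset.range (N + 1), offspringProb n β lam N k * k = N * meanLinkProb n β lam := by
  rw [sum_offspringProb_mul hβ hlam hn N (fun k => (k : ℝ)), meanLinkProb,
    ← integral_const_mul]
  congr 1
  funext j
  have := congrArg (Polynomial.eval (linkProb n lam j)) (bernsteinPolynomial.sum_smul ℝ N)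
  simp only [bernsteinPolynomial, Polynomial.eval_finsetSum, nsmul_eq_mul, Polynomial.eval_mul,
    Polynomial.eval_natCast, Polynomial.eval_pow, Polynomial.eval_X, Polynomial.eval_sub,
    Polynomial.eval_one] at this
  rw [← this]
  refine Finset.sum_congr rfl fun k _ => ?_
  ring

/-- Constant in the quadratic bound on the exponential moment of the offspring law. -/
def momentConst (β : ℝ) : ℝ := β + 4 * β ^ 2 * Real.exp (2 * β)

theorem exp_le_quadratic (u : ℝ) : Real.exp u ≤ 1 + u + u ^ 2 * Real.exp |u| := by
  have := Complex.norm_exp_sub_sum_le_norm_mul_exp (u : ℂ) 2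
  simp only [Finset.sum_range_succ, Finset.sum_range_zero] at this
  rw [Complex.norm_real] at this
  have h2 : Complex.exp (u : ℂ) - (0 + (u : ℂ) ^ 0 / (Nat.factorial 0 : ℂ) +
      (u : ℂ) ^ 1 / (Nat.factorial 1 : ℂ)) = ((Real.exp u - (1 + u) : ℝ) : ℂ) := by
    push_cast; simp
  rw [h2, Complex.norm_real, Real.norm_eq_abs, Real.norm_eq_abs, sq_abs] at this
  linarith [le_abs_self (Real.exp u - (1 + u))]

theorem sum_offspringProb_mul_exp_le (hβ : 0 < β) (hlam : 0 < lam) (hn : 0 < n) {N : ℕ}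
    (hN : N ≤ n) {s : ℝ} (hs : |s| ≤ 1) :
    ∑ k ∈ Finset.range (N + 1), offspringProb n β lam N k * Real.exp (s * k) ≤
      1 + s * (N * meanLinkProb n β lam) + momentConst β * s ^ 2 := by
  have hn' : (0 : ℝ) < n := by exact_mod_cast hn
  rw [sum_offspringProb_mul hβ hlam hn N (fun k => Real.exp (s * k))]
  have h1 : ∀ j, ∑ k ∈ Finset.range (N + 1), (N.choose k : ℝ) * linkProb n lam j ^ k *
        (1 - linkProb n lam j) ^ (N - k) * Real.exp (s * k) =
        (1 + linkProb n lam j * (Real.exp s - 1)) ^ N := fun j => by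
    rw [← sum_binomial_mul_pow]
    refine Finset.sum_congr rfl fun k _ => ?_
    rw [← Real.exp_nat_mul, mul_comm s]
  simp only [h1]
  have h2 : ∫ j, (1 + s * (N * linkProb n lam j) + momentConst β * s ^ 2)
      ∂cutGammaMeasure (lam * β) =
      1 + s * (N * meanLinkProb n β lam) + momentConst β * s ^ 2 := by
    have hi : Integrable (fun j => s * (N * linkProb n lam j)) (cutGammaMeasure (lam * β)) :=
      integrable_of_continuous_linkProb hβ hlam hn (g := fun p => s * (N * p)) (by fun_prop)
    have hi' : Integrable (fun j => 1 + s * (N * linkProb n lam j))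
        (cutGammaMeasure (lam * β)) := (integrable_const _).add hi
    rw [integral_add hi' (integrable_const _),
      integral_add (integrable_const _) hi, integral_const_mul, integral_const_mul]
    simp [meanLinkProb]
  rw [← h2]
  refine integral_mono_ae
    (integrable_of_continuous_linkProb hβ hlam hn
      (g := fun p => (1 + p * (Real.exp s - 1)) ^ N) (by fun_prop))
    (integrable_of_continuous_linkProb hβ hlam hn
      (g := fun p => 1 + s * (N * p) + momentConst β * s ^ 2) (by fun_prop)) ?_
  filter_upwards [cutGammaMeasure_ae_mem (mul_pos hlam hβ)] with j hj
  obtain ⟨hp0, hp1, hp2, -, -, -⟩ := linkProb_bounds hn hlam hj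
  set p := linkProb n lam j
  have ha : N * p ≤ β := by
    have : (N : ℝ) * p ≤ n * (β / n) :=
      mul_le_mul (by exact_mod_cast hN) hp2 hp0 hn'.le
    rwa [mul_div_cancel₀ _ hn'.ne'] at this
  have ha0 : 0 ≤ N * p := by positivity
  set z := Real.exp s - 1 with hz
  have hz1 : |z| ≤ 2 * |s| := Real.abs_exp_sub_one_le hs
  have hz2 : z ≤ s + s ^ 2 := by
    have := (abs_le.1 (Real.abs_exp_sub_one_sub_id_le hs)).2
    linarith
  have hbase : 0 ≤ 1 + p * z := by
    have : -1 ≤ z := by rw [hz]; linarith [Real.exp_pos s]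
    nlinarith
  have h3 : (1 + p * z) ^ N ≤ Real.exp (N * p * z) := by
    rw [mul_assoc, Real.exp_nat_mul]
    refine pow_le_pow_left₀ hbase ?_ N
    linarith [Real.add_one_le_exp (p * z)]
  have h4 := exp_le_quadratic (N * p * z)
  have h5 : |N * p * z| ≤ 2 * β * |s| := by
    rw [abs_mul, abs_of_nonneg ha0]
    calc N * p * |z| ≤ β * (2 * |s|) := mul_le_mul ha hz1 (abs_nonneg _) hβ.le
      _ = _ := by ring
  have h6 : (N * p * z) ^ 2 * Real.exp |N * p * z| ≤ 4 * β ^ 2 * s ^ 2 * Real.exp (2 * β) := by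
    refine mul_le_mul ?_ (Real.exp_le_exp.2 ?_) (Real.exp_pos _).le (by positivity)
    · rw [← sq_abs]
      calc |N * p * z| ^ 2 ≤ (2 * β * |s|) ^ 2 := pow_le_pow_left₀ (abs_nonneg _) h5 2
        _ = _ := by rw [mul_pow, sq_abs]; ring
    · nlinarith
  have h7 : N * p * z ≤ N * p * s + β * s ^ 2 := by
    nlinarith [mul_le_mul_of_nonneg_left hz2 ha0, mul_le_mul_of_nonneg_right ha (sq_nonneg s)]
  simp only [momentConst]
  nlinarith

theorem exp_neg_le_offspringProb_zero (hβ : 0 < β) (hlam : 0 < lam) (hn : 0 < n) {N : ℕ}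
    (hN : N ≤ n) : Real.exp (-β) ≤ offspringProb n β lam N 0 := by
  have hn' : (0 : ℝ) < n := by exact_mod_cast hn
  have h1 : ∫ _, Real.exp (-β) ∂cutGammaMeasure (lam * β) = Real.exp (-β) := by simp
  rw [← h1]
  refine integral_mono_ae (integrable_const _)
    (integrable_of_continuous_linkProb hβ hlam hn
      (g := fun p => (N.choose 0 : ℝ) * p ^ 0 * (1 - p) ^ (N - 0)) (by fun_prop)) ?_
  filter_upwards [cutGammaMeasure_ae_mem (mul_pos hlam hβ)] with j hj
  obtain ⟨hp0, hp1, -, -, -, hp⟩ := linkProb_bounds hn hlam hj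
  simp only [Nat.choose_zero_right, Nat.cast_one, pow_zero, mul_one, one_mul, Nat.sub_zero]
  calc Real.exp (-β) ≤ Real.exp (N * -(β / n)) := by
        apply Real.exp_le_exp.2
        have : (N : ℝ) * (β / n) ≤ n * (β / n) :=
          mul_le_mul_of_nonneg_right (by exact_mod_cast hN) (by positivity)
        rw [mul_div_cancel₀ _ hn'.ne'] at this
        linarith
    _ = Real.exp (-(β / n)) ^ N := Real.exp_nat_mul _ _
    _ ≤ _ := pow_le_pow_left₀ (Real.exp_pos _).le hp N

end

/-- Number of available vertices at step `t` when `y` points are active. -/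
def vacant (n t y : ℕ) : ℕ := n - (t - 1) - y - (if y = 0 then 1 else 0)

/-- Number of active points after a step with `k` offspring, starting from `y` active points. -/
def nextState (y k : ℕ) : ℕ := if 0 < y then y + k - 1 else k

/-- Expectation of `g` applied to the state after step `t`, starting from `y` active points. -/
def stepExp (n : ℕ) (β lam : ℝ) (t y : ℕ) (g : ℕ → ℝ) : ℝ :=
  ∑ k ∈ Finset.range (vacant n t y + 1),
    offspringProb n β lam (vacant n t y) k * g (nextState y k)

theorem binomialMeasure_singleton_toReal (N k : ℕ) {p : ℝ} (h0 : 0 ≤ p) (h1 : p ≤ 1) :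
    (binomialMeasure N p {k}).toReal = (N.choose k : ℝ) * p ^ k * (1 - p) ^ (N - k) := by
  have h1' : 0 ≤ 1 - p := by linarith
  have hval : binomialMeasure N p {k} =
      ENNReal.ofReal ((N.choose k : ℝ) * p ^ k * (1 - p) ^ (N - k)) := by
    simp only [binomialMeasure, Measure.coe_finsetSum, Finset.sum_apply, Measure.smul_apply,
      smul_eq_mul, Measure.dirac_apply' _ (measurableSet_singleton k)]
    by_cases hk : k ∈ Finset.range (N + 1)
    · rw [Finset.sum_eq_single_of_mem k hk]
      · simp
      · intro b _ hb
        simp [Set.indicator, hb]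
    · have : N < k := by simpa using hk
      rw [Nat.choose_eq_zero_of_lt this, Finset.sum_eq_zero]
      · simp
      · intro b hb
        have : b ≠ k := by rintro rfl; exact hk hb
        simp [Set.indicator, this]
  rw [hval, ENNReal.toReal_ofReal (by positivity)]

section Exploration

variable {n : ℕ} {β lam : ℝ} {Ω : Type*} [m0 : MeasurableSpace Ω] {μ : Measure Ω}
  {F : ℕ → MeasurableSpace Ω} {Y η : ℕ → Ω → ℕ} {J : ℕ → Ω → ℝ}

namespace IsReducedQuantumExploration

theorem measurable_Y (hX : IsReducedQuantumExploration n β lam μ F Y η J) (t : ℕ) :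
    Measurable (Y t) := (hX.Y_adapted t).mono (hX.F_le t) le_rfl

theorem measurable_J (hX : IsReducedQuantumExploration n β lam μ F Y η J) {t : ℕ} (ht : 1 ≤ t) :
    Measurable (J t) := (hX.J_adapted t ht).mono (hX.F_le t) le_rfl

theorem Y_eq_nextState (hX : IsReducedQuantumExploration n β lam μ F Y η J) {t : ℕ}
    (ht : 1 ≤ t) (ω : Ω) : Y t ω = nextState (Y (t - 1) ω) (η t ω) := hX.Y_rec t ht ω

theorem eta_eq (hX : IsReducedQuantumExploration n β lam μ F Y η J) {t : ℕ}
    (ht : 1 ≤ t) (ω : Ω) :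
    η t ω = if 0 < Y (t - 1) ω then Y t ω + 1 - Y (t - 1) ω else Y t ω := by
  have := hX.Y_rec t ht ω
  split_ifs at this ⊢ <;> omega

theorem measurable_eta (hX : IsReducedQuantumExploration n β lam μ F Y η J) {t : ℕ}
    (ht : 1 ≤ t) : Measurable (η t) := by
  have : η t = fun ω => (fun q : ℕ × ℕ => if 0 < q.1 then q.2 + 1 - q.1 else q.2)
      (Y (t - 1) ω, Y t ω) := funext fun ω => hX.eta_eq ht ω
  rw [this]
  exact (measurable_of_countable (fun q : ℕ × ℕ =>
    if 0 < q.1 then q.2 + 1 - q.1 else q.2)).comp ((hX.measurable_Y _).prodMk (hX.measurable_Y t))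

theorem isProbabilityMeasure_cutGamma (hX : IsReducedQuantumExploration n β lam μ F Y η J) :
    IsProbabilityMeasure (cutGammaMeasure (lam * β)) := by
  have := hX.prob
  rw [← hX.J_law 1 le_rfl]
  exact Measure.isProbabilityMeasure_map (hX.measurable_J le_rfl).aemeasurable

theorem J_ae_mem (hX : IsReducedQuantumExploration n β lam μ F Y η J) (hβ : 0 < β)
    (hlam : 0 < lam) {t : ℕ} (ht : 1 ≤ t) : ∀ᵐ ω ∂μ, J t ω ∈ Set.Icc 0 (lam * β) := by
  have := cutGammaMeasure_ae_mem (mul_pos hlam hβ)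
  rw [← hX.J_law t ht] at this
  exact ae_of_ae_map (hX.measurable_J ht).aemeasurable this

theorem measure_inter_eta_eq (hX : IsReducedQuantumExploration n β lam μ F Y η J) (hβ : 0 < β)
    (hlam : 0 < lam) (hn : 0 < n) {t : ℕ} (ht : 1 ≤ t) {B : Set Ω}
    (hB : MeasurableSet[F (t - 1)] B) (y k : ℕ) (hBy : ∀ ω ∈ B, Y (t - 1) ω = y) :
    μ (B ∩ {ω | η t ω = k}) =
      μ B * ENNReal.ofReal (offspringProb n β lam (vacant n t y) k) := by
  have := hX.prob
  have := hX.isProbabilityMeasure_cutGamma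
  have hB0 : MeasurableSet B := hX.F_le _ _ hB
  have hη : MeasurableSet {ω | η t ω ∈ ({k} : Set ℕ)} :=
    hX.measurable_eta ht (measurableSet_singleton k)
  have hJ : MeasurableSpace.comap (J t) (borel ℝ) ≤ m0 := by
    have := (hX.measurable_J ht).comap_le
    rwa [BorelSpace.measurable_eq (α := ℝ)] at this
  have hle : F (t - 1) ⊔ MeasurableSpace.comap (J t) (borel ℝ) ≤ m0 :=
    sup_le (hX.F_le _) hJ
  set φ : ℝ → ℝ := fun j => ((vacant n t y).choose k : ℝ) * linkProb n lam j ^ k *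
    (1 - linkProb n lam j) ^ (vacant n t y - k) with hφ
  have hφm : Measurable φ := by
    have : Continuous fun p : ℝ => ((vacant n t y).choose k : ℝ) * p ^ k *
      (1 - p) ^ (vacant n t y - k) := by fun_prop
    exact this.measurable.comp (measurable_linkProb n lam)
  have h1 := setIntegral_condExp (μ := μ) hle
    (f := Set.indicator {ω | η t ω ∈ ({k} : Set ℕ)} (fun _ => (1 : ℝ)))
    ((integrable_const 1).indicator hη)
    ((le_sup_left : F (t - 1) ≤ F (t - 1) ⊔ MeasurableSpace.comap (J t) (borel ℝ)) _ hB)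
  have h2 : ∫ ω in B, φ (J t ω) ∂μ =
      ∫ ω in B, (μ[Set.indicator {ω | η t ω ∈ ({k} : Set ℕ)} (fun _ => (1 : ℝ)) |
        F (t - 1) ⊔ MeasurableSpace.comap (J t) (borel ℝ)]) ω ∂μ := by
    refine setIntegral_congr_ae hB0 ?_
    filter_upwards [hX.eta_condLaw t ht {k}, hX.J_ae_mem hβ hlam ht] with ω h1 h2 hω
    obtain ⟨hp0, hp1, -⟩ := linkProb_bounds hn hlam h2
    rw [h1, hBy ω hω]
    exact (binomialMeasure_singleton_toReal (vacant n t y) k hp0 hp1).symm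
  rw [integral_indicator hη, setIntegral_const, smul_eq_mul, mul_one] at h1
  have h3 : ∫ ω in B, φ (J t ω) ∂μ = μ.real B * offspringProb n β lam (vacant n t y) k := by
    have hind : IndepFun (B.indicator fun _ => (1 : ℝ)) (fun ω => φ (J t ω)) μ := by
      have h4 := hX.J_indep t ht
      rw [IndepFun_iff_Indep]
      refine (indep_of_indep_of_le_right (indep_of_indep_of_le_left h4 ?_) ?_).symm
      · rintro _ ⟨u, hu, rfl⟩
        refine ⟨φ ⁻¹' u, ?_, rfl⟩
        rw [← BorelSpace.measurable_eq (α := ℝ)]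
        exact hφm hu
      · have : Measurable[F (t - 1)] (B.indicator fun _ => (1 : ℝ)) :=
          measurable_const.indicator hB
        exact this.comap_le
    have h5 := hind.integral_mul_eq_mul_integral
      ((measurable_const.indicator hB0).aestronglyMeasurable)
      ((hφm.comp (hX.measurable_J ht)).aestronglyMeasurable)
    have h6 : ((B.indicator fun _ => (1 : ℝ)) * fun ω => φ (J t ω)) =
        B.indicator fun ω => φ (J t ω) := by
      funext ω
      by_cases hω : ω ∈ B <;> simp [hω]
    have h7 : ∫ ω, φ (J t ω) ∂μ = offspringProb n β lam (vacant n t y) k := by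
      have := integral_map (μ := μ) (hX.measurable_J ht).aemeasurable
        (f := φ) hφm.aestronglyMeasurable
      rw [hX.J_law t ht] at this
      exact this.symm
    rw [h6, integral_indicator hB0, integral_indicator hB0, setIntegral_const, h7] at h5
    simpa using h5
  rw [← h2, h3] at h1
  have h8 : μ.real (B ∩ {ω | η t ω = k}) =
      μ.real B * offspringProb n β lam (vacant n t y) k := by
    rw [h1, measureReal_restrict_apply hη, Set.inter_comm]; rfl
  rw [← ofReal_measureReal, h8, ENNReal.ofReal_mul measureReal_nonneg, ofReal_measureReal]

theorem ae_eta_le_vacant (hX : IsReducedQuantumExploration n β lam μ F Y η J) (hβ : 0 < β)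
    (hlam : 0 < lam) (hn : 0 < n) :
    ∀ᵐ ω ∂μ, ∀ t, 1 ≤ t → η t ω ≤ vacant n t (Y (t - 1) ω) := by
  rw [ae_all_iff]
  intro t
  by_cases ht : 1 ≤ t
  swap
  · exact ae_of_all _ fun ω h => absurd h ht
  have h : ∀ y k : ℕ, ∀ᵐ ω ∂μ, Y (t - 1) ω = y → η t ω = k → k ≤ vacant n t y := by
    intro y k
    by_cases hk : k ≤ vacant n t y
    · exact ae_of_all _ fun _ _ _ => hk
    · have := hX.measure_inter_eta_eq hβ hlam hn ht (B := {ω | Y (t - 1) ω = y})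
        (hX.Y_adapted (t - 1) (measurableSet_singleton y)) y k (fun ω hω => hω)
      have h0 : offspringProb n β lam (vacant n t y) k = 0 := by
        simp [offspringProb, Nat.choose_eq_zero_of_lt (not_le.1 hk)]
      rw [h0, ENNReal.ofReal_zero, mul_zero] at this
      refine measure_mono_null ?_ this
      intro ω hω
      have h1 := Classical.not_imp.1 hω
      exact ⟨h1.1, (Classical.not_imp.1 h1.2).1⟩
  have h' : ∀ᵐ ω ∂μ, ∀ y k : ℕ, Y (t - 1) ω = y → η t ω = k → k ≤ vacant n t y := by
    rw [ae_all_iff]; intro y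
    rw [ae_all_iff]; exact h y
  filter_upwards [h'] with ω hω _ using hω _ _ rfl rfl

theorem lintegral_step_le (hX : IsReducedQuantumExploration n β lam μ F Y η J) (hβ : 0 < β)
    (hlam : 0 < lam) (hn : 0 < n) {t : ℕ} (ht : 1 ≤ t) {B : Set Ω}
    (hB : MeasurableSet[F (t - 1)] B) {g G : ℕ → ℝ} (hg : ∀ y, 0 ≤ g y)
    (hgG : ∀ ω ∈ B, stepExp n β lam t (Y (t - 1) ω) g ≤ G (Y (t - 1) ω)) :
    ∫⁻ ω in B, ENNReal.ofReal (g (Y t ω)) ∂μ ≤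
      ∫⁻ ω in B, ENNReal.ofReal (G (Y (t - 1) ω)) ∂μ := by
  have hB0 : MeasurableSet B := hX.F_le _ _ hB
  have hpart : B = ⋃ y : ℕ, B ∩ {ω | Y (t - 1) ω = y} := by
    ext ω; simp
  have hmF : ∀ y, MeasurableSet[F (t - 1)] (B ∩ {ω | Y (t - 1) ω = y}) := fun y =>
    hB.inter (hX.Y_adapted (t - 1) (measurableSet_singleton y))
  have hm : ∀ y, MeasurableSet (B ∩ {ω | Y (t - 1) ω = y}) := fun y => hX.F_le _ _ (hmF y)
  have hdisj : Pairwise (Function.onFun Disjoint fun y => B ∩ {ω | Y (t - 1) ω = y}) := by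
    intro y y' hyy'
    rw [Function.onFun, Set.disjoint_left]
    rintro ω ⟨_, h1⟩ ⟨_, h2⟩
    exact hyy' (h1.symm.trans h2)
  rw [hpart, lintegral_iUnion hm hdisj, lintegral_iUnion hm hdisj]
  refine ENNReal.tsum_le_tsum fun y => ?_
  rcases (B ∩ {ω | Y (t - 1) ω = y}).eq_empty_or_nonempty with he | ⟨ω₀, hω₀, hy₀⟩
  · simp [he]
  have hG := hgG ω₀ hω₀
  rw [hy₀] at hG
  set C := B ∩ {ω | Y (t - 1) ω = y}
  have hC : ∀ ω ∈ C, Y (t - 1) ω = y := fun ω hω => hω.2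
  have hR : ∫⁻ ω in C, ENNReal.ofReal (G (Y (t - 1) ω)) ∂μ = ENNReal.ofReal (G y) * μ C := by
    rw [← setLIntegral_const]
    exact setLIntegral_congr_fun (hm y) fun ω hω => by simp only [hC ω hω]
  have hη : ∀ k, MeasurableSet {ω | η t ω = k} := fun k =>
    hX.measurable_eta ht (measurableSet_singleton k)
  have hae : ∀ᵐ ω ∂μ, ω ∈ C → ENNReal.ofReal (g (Y t ω)) =
      ∑ k ∈ Finset.range (vacant n t y + 1),
        {ω | η t ω = k}.indicator (fun _ => ENNReal.ofReal (g (nextState y k))) ω := by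
    filter_upwards [hX.ae_eta_le_vacant hβ hlam hn] with ω hω hωC
    have h1 := hω t ht
    rw [hC ω hωC] at h1
    rw [Finset.sum_eq_single_of_mem (η t ω) (Finset.mem_range.2 (by omega))]
    · rw [Set.indicator_of_mem (by rfl), hX.Y_eq_nextState ht, hC ω hωC]
    · intro b _ hb
      exact Set.indicator_of_notMem (fun h => hb h.symm) _
  rw [hR, setLIntegral_congr_fun_ae (hm y) hae, lintegral_finsetSum]
  swap
  · intro k _
    exact measurable_const.indicator (hη k)
  have hterm : ∀ k, ∫⁻ ω in C, {ω | η t ω = k}.indicator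
      (fun _ => ENNReal.ofReal (g (nextState y k))) ω ∂μ =
      ENNReal.ofReal (offspringProb n β lam (vacant n t y) k * g (nextState y k)) * μ C := by
    intro k
    rw [lintegral_indicator (hη k), setLIntegral_const, Measure.restrict_apply (hη k),
      Set.inter_comm, hX.measure_inter_eta_eq hβ hlam hn ht (hmF y) y k hC,
      ENNReal.ofReal_mul (offspringProb_nonneg hβ hlam hn _ _)]
    ring
  rw [Finset.sum_congr rfl fun k _ => hterm k, ← Finset.sum_mul, ← ENNReal.ofReal_sum_of_nonneg]
  · gcongr
    exact hG
  · intro k _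
    exact mul_nonneg (offspringProb_nonneg hβ hlam hn _ _) (hg _)

end IsReducedQuantumExploration

end Exploration

section Exploration

variable {n : ℕ} {β lam : ℝ} {Ω : Type*} [m0 : MeasurableSpace Ω] {μ : Measure Ω}
  {F : ℕ → MeasurableSpace Ω} {Y η : ℕ → Ω → ℕ} {J : ℕ → Ω → ℝ}

namespace IsReducedQuantumExploration

/-- Maximal inequality: a nonnegative function `V` of time and state that increases on average
by at most `c t` per step while the process is alive bounds the probability of leaving the
alive region through a region where `V ≥ 1`. -/
theorem measure_exit_le (hX : IsReducedQuantumExploration n β lam μ F Y η J) (hβ : 0 < β)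
    (hlam : 0 < lam) (hn : 0 < n) {r R : ℕ} (hrR : r ≤ R) {B : Set Ω}
    (hB : MeasurableSet[F r] B) (V : ℕ → ℕ → ℝ) (hV : ∀ t y, 0 ≤ V t y)
    (alive exit : ℕ → ℕ → Prop) {c : ℕ → ℝ} (hc : ∀ t, 0 ≤ c t)
    (hdisj : ∀ t y, exit t y → ¬ alive t y)
    (hstep : ∀ t, r < t → t ≤ R → ∀ y, alive (t - 1) y →
      stepExp n β lam t y (V t) ≤ V (t - 1) y + c t)
    (hexit : ∀ t y, r < t → t ≤ R → exit t y → 1 ≤ V t y)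
    {v : ℝ} (hv : 0 ≤ v) (hBv : ∀ ω ∈ B, alive r (Y r ω) ∧ V r (Y r ω) ≤ v) :
    μ {ω | ω ∈ B ∧ ∃ t, r < t ∧ t ≤ R ∧ exit t (Y t ω) ∧
        ∀ u, r ≤ u → u < t → alive u (Y u ω)} ≤
      ENNReal.ofReal (v + ∑ t ∈ Finset.Ioc r R, c t) * μ B := by
  set D : ℕ → Set Ω := fun R => {ω | ω ∈ B ∧ ∃ t, r < t ∧ t ≤ R ∧ exit t (Y t ω) ∧
        ∀ u, r ≤ u → u < t → alive u (Y u ω)} with hD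
  set L : ℕ → Set Ω := fun t => {ω | ω ∈ B ∧ ∀ u, r ≤ u → u ≤ t → alive u (Y u ω)} with hL
  have hset : ∀ (P : ℕ → Prop) (u : ℕ), MeasurableSet[F u] {ω | P (Y u ω)} := fun P u =>
    hX.Y_adapted u (MeasurableSet.of_discrete (s := {y | P y}))
  have hLm : ∀ t, r ≤ t → MeasurableSet[F t] (L t) := by
    intro t ht
    have : L t = B ∩ ⋂ u ∈ Set.Icc r t, {ω | alive u (Y u ω)} := by
      ext ω; simp [hL]
    rw [this]
    refine (hX.F_mono ht _ hB).inter ?_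
    refine MeasurableSet.biInter (Set.to_countable _) fun u hu => ?_
    exact hX.F_mono hu.2 _ (hset (alive u) u)
  have hVm : ∀ t, Measurable fun ω => ENNReal.ofReal (V t (Y t ω)) := fun t =>
    ((measurable_of_countable (V t)).comp (hX.measurable_Y t)).ennreal_ofReal
  suffices h : μ (D R) + ∫⁻ ω in L R, ENNReal.ofReal (V R (Y R ω)) ∂μ ≤
      ENNReal.ofReal (v + ∑ t ∈ Finset.Ioc r R, c t) * μ B from le_self_add.trans h
  have key : ∀ m, r ≤ m → m ≤ R → μ (D m) + ∫⁻ ω in L m, ENNReal.ofReal (V m (Y m ω)) ∂μ ≤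
      ENNReal.ofReal (v + ∑ t ∈ Finset.Ioc r m, c t) * μ B := by
    intro m hm
    induction m, hm using Nat.le_induction with
    | base =>
      intro _
      have h0 : D r = ∅ := by
        ext ω
        simp only [hD, Set.mem_empty_iff_false, iff_false]
        rintro ⟨_, t, h1, h2, _⟩
        omega
      have hL0 : L r ⊆ B := fun ω hω => hω.1
      rw [h0, measure_empty, zero_add, Finset.Ioc_self, Finset.sum_empty, add_zero]
      calc ∫⁻ ω in L r, ENNReal.ofReal (V r (Y r ω)) ∂μ
          ≤ ∫⁻ ω in B, ENNReal.ofReal (V r (Y r ω)) ∂μ := lintegral_mono_set hL0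
        _ ≤ ∫⁻ _ in B, ENNReal.ofReal v ∂μ :=
            setLIntegral_mono' (hX.F_le _ _ hB) fun ω hω =>
              ENNReal.ofReal_le_ofReal (hBv ω hω).2
        _ = ENNReal.ofReal v * μ B := setLIntegral_const _ _
    | succ m hm ih =>
      intro hmR
      have ih := ih (by omega)
      set E : Set Ω := L m ∩ {ω | exit (m + 1) (Y (m + 1) ω)} with hE
      have hLm0 := hX.F_le _ _ (hLm m hm)
      have hEm : MeasurableSet E := hLm0.inter (hX.F_le _ _ (hset (exit (m + 1)) (m + 1)))
      have hL1 : MeasurableSet (L (m + 1)) := hX.F_le _ _ (hLm (m + 1) (by omega))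
      have hDsub : D (m + 1) ⊆ D m ∪ E := by
        rintro ω ⟨hωB, t, h1, h2, h3, h4⟩
        rcases Nat.lt_or_ge m t with h | h
        · have : t = m + 1 := by omega
          subst this
          exact Or.inr ⟨⟨hωB, fun u hu hu' => h4 u hu (by omega)⟩, h3⟩
        · exact Or.inl ⟨hωB, t, h1, h, h3, h4⟩
      have hEL : Disjoint E (L (m + 1)) := by
        rw [Set.disjoint_left]
        rintro ω ⟨_, h1⟩ ⟨_, h2⟩
        exact hdisj _ _ h1 (h2 (m + 1) (by omega) le_rfl)
      have hsub : E ∪ L (m + 1) ⊆ L m := by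
        rintro ω (h | h)
        · exact h.1
        · exact ⟨h.1, fun u hu hu' => h.2 u hu (by omega)⟩
      have hEle : μ E ≤ ∫⁻ ω in E, ENNReal.ofReal (V (m + 1) (Y (m + 1) ω)) ∂μ := by
        calc μ E = ∫⁻ _ in E, 1 ∂μ := by simp
          _ ≤ _ := setLIntegral_mono' hEm fun ω hω => by
            rw [← ENNReal.ofReal_one]
            exact ENNReal.ofReal_le_ofReal (hexit _ _ (by omega) hmR hω.2)
      have hone : ∫⁻ ω in L m, ENNReal.ofReal (V (m + 1) (Y (m + 1) ω)) ∂μ ≤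
          ∫⁻ ω in L m, ENNReal.ofReal (V m (Y m ω)) ∂μ + ENNReal.ofReal (c (m + 1)) * μ B := by
        calc ∫⁻ ω in L m, ENNReal.ofReal (V (m + 1) (Y (m + 1) ω)) ∂μ
            ≤ ∫⁻ ω in L m, ENNReal.ofReal (V m (Y m ω) + c (m + 1)) ∂μ :=
              hX.lintegral_step_le hβ hlam hn (t := m + 1) (by omega) (hLm m hm)
                (G := fun y => V m y + c (m + 1)) (hV _)
                (fun ω hω => hstep (m + 1) (by omega) hmR _ (hω.2 m hm le_rfl))
          _ = ∫⁻ ω in L m, ENNReal.ofReal (V m (Y m ω)) ∂μ +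
              ENNReal.ofReal (c (m + 1)) * μ (L m) := by
              rw [← setLIntegral_const, ← lintegral_add_right _ measurable_const]
              refine lintegral_congr fun ω => ?_
              exact ENNReal.ofReal_add (hV _ _) (hc _)
          _ ≤ _ := by
              gcongr
              exact fun ω hω => hω.1
      have hcs : 0 ≤ v + ∑ t ∈ Finset.Ioc r m, c t :=
        add_nonneg hv (Finset.sum_nonneg fun t _ => hc t)
      rw [Finset.sum_Ioc_succ_top (by omega), ← add_assoc, ENNReal.ofReal_add hcs (hc _), add_mul]
      calc μ (D (m + 1)) + ∫⁻ ω in L (m + 1), ENNReal.ofReal (V (m + 1) (Y (m + 1) ω)) ∂μ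
          ≤ (μ (D m) + μ E) +
            ∫⁻ ω in L (m + 1), ENNReal.ofReal (V (m + 1) (Y (m + 1) ω)) ∂μ := by
            gcongr
            exact (measure_mono hDsub).trans (measure_union_le _ _)
        _ ≤ μ (D m) + (∫⁻ ω in E, ENNReal.ofReal (V (m + 1) (Y (m + 1) ω)) ∂μ +
            ∫⁻ ω in L (m + 1), ENNReal.ofReal (V (m + 1) (Y (m + 1) ω)) ∂μ) := by
            rw [add_assoc]; gcongr
        _ = μ (D m) + ∫⁻ ω in E ∪ L (m + 1), ENNReal.ofReal (V (m + 1) (Y (m + 1) ω)) ∂μ := by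
            rw [lintegral_union hL1 hEL]
        _ ≤ μ (D m) + ∫⁻ ω in L m, ENNReal.ofReal (V (m + 1) (Y (m + 1) ω)) ∂μ := by
            gcongr
        _ ≤ _ := by
            refine (add_le_add le_rfl hone).trans ?_
            rw [← add_assoc]
            gcongr
  exact key R hrR le_rfl

end IsReducedQuantumExploration

end Exploration

section Step

theorem vacant_le (n t y : ℕ) : vacant n t y ≤ n := by
  unfold vacant; omega

variable {n : ℕ} {β lam : ℝ} [IsProbabilityMeasure (cutGammaMeasure (lam * β))]

/-- Mean number of offspring at step `t` from a state with `y` active points. -/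
def stepMean (n : ℕ) (β lam : ℝ) (t y : ℕ) : ℝ := vacant n t y * meanLinkProb n β lam

theorem stepMean_le (hβ : 0 < β) (hlam : 0 < lam) (hn : 0 < n)
    (hcrit : lam⁻¹ * (2 * (1 - Real.exp (-(lam * β))) -
      lam * β * Real.exp (-(lam * β))) = 1) {t : ℕ} (ht : 1 ≤ t) (htn : t ≤ n) (y : ℕ) :
    stepMean n β lam t y ≤ 1 - (t - 1) / n := by
  have hn' : (0 : ℝ) < n := by exact_mod_cast hn
  have h1 : (vacant n t y : ℝ) ≤ n - (t - 1) := by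
    have : vacant n t y + t ≤ n + 1 := by unfold vacant; omega
    have : (vacant n t y : ℝ) + t ≤ n + 1 := by exact_mod_cast this
    linarith
  have h0 : (0 : ℝ) ≤ vacant n t y := Nat.cast_nonneg _
  calc stepMean n β lam t y ≤ (n - (t - 1)) * (1 / n) :=
        mul_le_mul h1 (meanLinkProb_le hβ hlam hn hcrit) (meanLinkProb_nonneg hβ hlam hn)
          (h0.trans h1)
    _ = _ := by field_simp

theorem le_stepMean (hβ : 0 < β) (hlam : 0 < lam) (hn : 0 < n)
    (hcrit : lam⁻¹ * (2 * (1 - Real.exp (-(lam * β))) -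
      lam * β * Real.exp (-(lam * β))) = 1) {t : ℕ} (ht : 1 ≤ t) (y : ℕ) :
    1 - (t + y + β ^ 2) / n ≤ stepMean n β lam t y := by
  have hn' : (0 : ℝ) < n := by exact_mod_cast hn
  have h1 : (n : ℝ) - t - y ≤ vacant n t y := by
    have : n ≤ vacant n t y + t + y := by unfold vacant; split_ifs <;> omega
    have : (n : ℝ) ≤ vacant n t y + t + y := by exact_mod_cast this
    linarith
  have hπ := meanLinkProb_nonneg hβ hlam hn (β := β) (lam := lam)
  have hl := le_meanLinkProb hβ hlam hn hcrit
  have e : 1 - (t + y + β ^ 2) / n = ((n : ℝ) - t - y) / n - β ^ 2 / n := by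
    field_simp; ring
  have hb : 0 ≤ β ^ 2 / n := by positivity
  rcases le_or_gt 0 ((n : ℝ) - t - y) with h | h
  · calc 1 - (t + y + β ^ 2) / n ≤ ((n : ℝ) - t - y) * (1 / n - β ^ 2 / n ^ 2) := by
          have : ((n : ℝ) - t - y) * (1 / n - β ^ 2 / n ^ 2) =
            ((n : ℝ) - t - y) / n - β ^ 2 / n * (((n : ℝ) - t - y) / n) := by
              field_simp
          rw [this, e]
          have h2 : ((n : ℝ) - t - y) / n ≤ 1 := by
            rw [div_le_one hn']
            have := Nat.cast_nonneg (α := ℝ) t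
            have := Nat.cast_nonneg (α := ℝ) y
            linarith
          nlinarith
      _ ≤ ((n : ℝ) - t - y) * meanLinkProb n β lam := mul_le_mul_of_nonneg_left hl h
      _ ≤ _ := mul_le_mul_of_nonneg_right h1 hπ
  · have h2 : ((n : ℝ) - t - y) / n ≤ 0 := div_nonpos_of_nonpos_of_nonneg h.le hn'.le
    have : 0 ≤ stepMean n β lam t y := mul_nonneg (Nat.cast_nonneg _) hπ
    linarith

theorem stepExp_exp_neg_le (hβ : 0 < β) (hlam : 0 < lam) (hn : 0 < n) {t y : ℕ}
    (hy : 0 < y) {s : ℝ} (hs : |s| ≤ 1) :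
    stepExp n β lam t y (fun y' => Real.exp (s * y')) ≤
      Real.exp (s * y) * Real.exp (s * (stepMean n β lam t y - 1) + momentConst β * s ^ 2) := by
  have h1 : stepExp n β lam t y (fun y' => Real.exp (s * y')) =
      Real.exp (s * y) * Real.exp (-s) * ∑ k ∈ Finset.range (vacant n t y + 1),
        offspringProb n β lam (vacant n t y) k * Real.exp (s * k) := by
    rw [stepExp, Finset.mul_sum]
    refine Finset.sum_congr rfl fun k _ => ?_
    have : ((nextState y k : ℕ) : ℝ) = y + k - 1 := by
      rw [nextState, if_pos hy, Nat.cast_sub (by omega)]; push_cast; ring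
    rw [this, show s * ((y : ℝ) + k - 1) = s * y + (-s) + s * k by ring, Real.exp_add,
      Real.exp_add]
    ring
  rw [h1, mul_assoc]
  refine mul_le_mul_of_nonneg_left ?_ (Real.exp_pos _).le
  calc _ ≤ Real.exp (-s) * Real.exp (s * stepMean n β lam t y + momentConst β * s ^ 2) := by
        refine mul_le_mul_of_nonneg_left ?_ (Real.exp_pos _).le
        refine (sum_offspringProb_mul_exp_le hβ hlam hn (vacant_le _ _ _) hs).trans ?_
        have := Real.add_one_le_exp (s * stepMean n β lam t y + momentConst β * s ^ 2)
        rw [stepMean] at this ⊢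
        linarith
    _ = _ := by rw [← Real.exp_add]; ring_nf

theorem stepExp_natCast (hβ : 0 < β) (hlam : 0 < lam) (hn : 0 < n) (t y : ℕ) :
    stepExp n β lam t y (fun y' => (y' : ℝ)) =
      if 0 < y then (y : ℝ) + stepMean n β lam t y - 1 else stepMean n β lam t y := by
  have hm := sum_offspringProb_mul_id hβ hlam hn (vacant n t y)
  have h1 := sum_offspringProb hβ hlam hn (vacant n t y)
  rw [stepMean, ← hm, stepExp]
  split_ifs with hy
  · have : ∀ k ∈ Finset.range (vacant n t y + 1),
        offspringProb n β lam (vacant n t y) k * ((nextState y k : ℕ) : ℝ) =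
        offspringProb n β lam (vacant n t y) k * k +
          (y - 1) * offspringProb n β lam (vacant n t y) k := by
      intro k _
      rw [nextState, if_pos hy, Nat.cast_sub (by omega)]; push_cast; ring
    rw [Finset.sum_congr rfl this, Finset.sum_add_distrib, ← Finset.mul_sum, h1]
    ring
  · exact Finset.sum_congr rfl fun k _ => by rw [nextState, if_neg hy]

theorem stepExp_exp_sub_le (hβ : 0 < β) (hlam : 0 < lam) (hn : 0 < n) {t y : ℕ}
    {s : ℝ} (hs0 : 0 ≤ s) (hs1 : s ≤ 1) (hm1 : 0 ≤ stepMean n β lam t y)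
    (hs : momentConst β * s ≤ 1 - stepMean n β lam t y) :
    stepExp n β lam t y (fun y' => Real.exp (s * y') - s * y') ≤
      Real.exp (s * y) - s * y + (momentConst β + 1) * s ^ 2 := by
  have hsa : |s| ≤ 1 := by rwa [abs_of_nonneg hs0]
  have hC : 0 ≤ momentConst β := by unfold momentConst; positivity
  set m := stepMean n β lam t y with hm
  have hsplit : stepExp n β lam t y (fun y' => Real.exp (s * y') - s * y') =
      stepExp n β lam t y (fun y' => Real.exp (s * y')) -
        s * stepExp n β lam t y (fun y' => (y' : ℝ)) := by
    simp only [stepExp]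
    rw [Finset.mul_sum, ← Finset.sum_sub_distrib]
    exact Finset.sum_congr rfl fun k _ => by ring
  rw [hsplit, stepExp_natCast hβ hlam hn]
  by_cases hy : 0 < y
  · rw [if_pos hy]
    have h1 := stepExp_exp_neg_le hβ hlam hn (t := t) hy hsa
    rw [← hm] at h1
    set u := s * (m - 1) + momentConst β * s ^ 2 with hu
    have hu0 : u ≤ 0 := by rw [hu]; nlinarith
    have hu1 : -s ≤ u := by rw [hu]; nlinarith [mul_nonneg hC (sq_nonneg s), mul_nonneg hs0 hm1]
    have hexp : Real.exp u ≤ 1 + u + u ^ 2 := by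
      have := (abs_le.1 (Real.abs_exp_sub_one_sub_id_le (x := u)
        (abs_le.2 ⟨by linarith, by linarith⟩))).2
      linarith
    have hu2 : u ^ 2 ≤ s ^ 2 := by nlinarith
    have hey : 1 ≤ Real.exp (s * y) := Real.one_le_exp (by positivity)
    have heu : Real.exp u ≤ 1 := Real.exp_le_one_iff.2 hu0
    nlinarith
  · rw [if_neg hy]
    have hy0 : y = 0 := by omega
    have h1 : stepExp n β lam t y (fun y' => Real.exp (s * y')) ≤
        1 + s * m + momentConst β * s ^ 2 := by
      refine le_trans (le_of_eq ?_)
        (sum_offspringProb_mul_exp_le hβ hlam hn (vacant_le n t y) hsa)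
      exact Finset.sum_congr rfl fun k _ => by rw [nextState, if_neg hy]
    have h0 : Real.exp (s * y) - s * y = 1 := by simp [hy0]
    nlinarith [sq_nonneg s]

end Step

section HittingTimes

variable {Ω : Type*} {Y : ℕ → Ω → ℕ} {ω : Ω}

theorem hitZero_succ_mem (hz : ∀ N, ∃ t, N < t ∧ Y t ω = 0) (i : ℕ) :
    hitZero Y ω i < hitZero Y ω (i + 1) ∧ Y (hitZero Y ω (i + 1)) ω = 0 :=
  Nat.sInf_mem (s := {t | hitZero Y ω i < t ∧ Y t ω = 0}) (hz _)

theorem pos_of_lt_hitZero_succ {i u : ℕ} (h1 : hitZero Y ω i < u)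
    (h2 : u < hitZero Y ω (i + 1)) : 0 < Y u ω := by
  by_contra h
  have : u ∈ {t | hitZero Y ω i < t ∧ Y t ω = 0} := ⟨h1, by omega⟩
  exact absurd (Nat.sInf_le this) (not_le.2 h2)

theorem exists_hitZero_le_lt (hz : ∀ N, ∃ t, N < t ∧ Y t ω = 0) (τ : ℕ) :
    ∃ i, hitZero Y ω i ≤ τ ∧ τ < hitZero Y ω (i + 1) := by
  have hmono : StrictMono (hitZero Y ω) :=
    strictMono_nat_of_lt_succ fun i => (hitZero_succ_mem hz i).1
  have hex : ∃ i, τ < hitZero Y ω i := ⟨τ + 1, lt_of_lt_of_le (Nat.lt_succ_self τ) hmono.le_apply⟩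
  obtain ⟨i, hi⟩ : ∃ i, Nat.find hex = i + 1 := by
    refine Nat.exists_eq_succ_of_ne_zero fun h0 => ?_
    have := Nat.find_spec hex
    rw [h0] at this
    exact absurd this (by simp [hitZero])
  refine ⟨i, ?_, hi ▸ Nat.find_spec hex⟩
  exact not_lt.1 (Nat.find_min hex (by omega))

theorem exists_zero_of_eventually_pred {n : ℕ} (hdec : ∀ t, n < t → Y t ω = Y (t - 1) ω - 1)
    (N : ℕ) : ∃ t, N < t ∧ Y t ω = 0 := by
  have h : ∀ k, Y (n + k) ω ≤ Y n ω - k := by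
    intro k
    induction k with
    | zero => simp
    | succ k ih =>
      have := hdec (n + (k + 1)) (by omega)
      rw [show n + (k + 1) - 1 = n + k by omega] at this
      omega
  refine ⟨n + (Y n ω + N + 1), by omega, ?_⟩
  have := h (Y n ω + N + 1)
  omega

/-- A path whose excursions are all shorter than `T` and which reaches level `L` does so
either in an excursion ending before `t0 + T`, or after a zero which is later than `t0`. -/
theorem excursion_dichotomy {n T t0 : ℕ} {L : ℝ} (hL : 1 < L) (h0 : Y 0 ω = 1)
    (hdrop : ∀ t, Y t ω ≤ Y (t + 1) ω + 1)
    (hdec : ∀ t, n < t → Y t ω = Y (t - 1) ω - 1)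
    (hgap : ∀ i, 1 ≤ i → hitZero Y ω i - hitZero Y ω (i - 1) < T)
    (hreach : ∃ t, L ≤ (Y t ω : ℝ)) :
    L < T ∧ ∃ τ, L ≤ (Y τ ω : ℝ) ∧ (∀ u, u < τ → (Y u ω : ℝ) < L) ∧
      ((∃ e, τ < e ∧ e ≤ τ + T ∧ Y e ω = 0 ∧
          ∀ u, τ ≤ u → u < e → 0 < Y u ω ∧ u + Y u ω ≤ t0 + T) ∨
        (τ ≤ n ∧ ∃ σ, t0 < σ ∧ σ < τ ∧ Y σ ω = 0)) := by
  classical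
  have hz := exists_zero_of_eventually_pred hdec
  set τ := Nat.find hreach with hτ
  have hτL : L ≤ (Y τ ω : ℝ) := Nat.find_spec hreach
  have hτm : ∀ u, u < τ → (Y u ω : ℝ) < L := fun u hu => not_le.1 (Nat.find_min hreach hu)
  have hτn : τ ≤ n := by
    by_contra hlt
    have h1 := hτm (τ - 1) (by omega)
    have h2 := hdec τ (by omega)
    have h3 : (Y τ ω : ℝ) ≤ Y (τ - 1) ω := by exact_mod_cast (by omega : Y τ ω ≤ Y (τ - 1) ω)
    linarith
  obtain ⟨i, hi1, hi2⟩ := exists_hitZero_le_lt hz τ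
  obtain ⟨hi3, hi4⟩ := hitZero_succ_mem hz i
  have hg := hgap (i + 1) (by omega)
  rw [Nat.add_sub_cancel] at hg
  have hYτ : 1 < Y τ ω := by exact_mod_cast hL.trans_le hτL
  have hσlt : hitZero Y ω i < τ := by
    rcases Nat.eq_zero_or_pos i with rfl | hi
    · rcases Nat.eq_zero_or_pos τ with h | h
      · rw [h] at hYτ; omega
      · simpa [hitZero] using h
    · obtain ⟨j, rfl⟩ : ∃ j, i = j + 1 := ⟨i - 1, by omega⟩
      have := (hitZero_succ_mem hz j).2
      refine lt_of_le_of_ne hi1 fun he => ?_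
      rw [he] at this; omega
  set e := hitZero Y ω (i + 1) with he
  have hYe : ∀ k, k ≤ e → Y (e - k) ω ≤ k := by
    intro k
    induction k with
    | zero => intro _; simp [hi4]
    | succ k ih =>
      intro hk
      have h1 := ih (by omega)
      have h2 := hdrop (e - (k + 1))
      rw [show e - (k + 1) + 1 = e - k by omega] at h2
      omega
  have hYe' : ∀ u, u ≤ e → u + Y u ω ≤ e := by
    intro u hu
    have := hYe (e - u) (by omega)
    rw [show e - (e - u) = u by omega] at this
    omega
  refine ⟨?_, τ, hτL, hτm, ?_⟩
  · have h1 := hYe' τ hi2.le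
    have : (Y τ ω : ℝ) < T := by exact_mod_cast (by omega : Y τ ω < T)
    linarith
  rcases Nat.lt_or_ge (t0 + T) e with hlt | hle
  · right
    refine ⟨hτn, hitZero Y ω i, by omega, hσlt, ?_⟩
    obtain ⟨j, rfl⟩ : ∃ j, i = j + 1 := by
      refine Nat.exists_eq_succ_of_ne_zero fun h => ?_
      subst h
      have : hitZero Y ω 0 = 0 := rfl
      omega
    exact (hitZero_succ_mem hz j).2
  · left
    refine ⟨e, hi2, by omega, hi4, fun u hu1 hu2 => ⟨?_, ?_⟩⟩
    · exact pos_of_lt_hitZero_succ (by omega) hu2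
    · have := hYe' u hu2.le
      omega

end HittingTimes

/-- Paths in which the first passage above `L` happens in an excursion that dies within `T` steps
and before time `S`. -/
def earlyEvent {Ω : Type*} (Y : ℕ → Ω → ℕ) (T S : ℕ) (L : ℝ) : Set Ω :=
  {ω | ∃ τ, L ≤ (Y τ ω : ℝ) ∧ (∀ u, u < τ → (Y u ω : ℝ) < L) ∧
    ∃ e, τ < e ∧ e ≤ τ + T ∧ Y e ω = 0 ∧ ∀ u, τ ≤ u → u < e → 0 < Y u ω ∧ u + Y u ω ≤ S}

/-- Paths which reach level `L` for the first time by time `n` and after a zero later than `t0`. -/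
def lateEvent {Ω : Type*} (Y : ℕ → Ω → ℕ) (n t0 : ℕ) (L : ℝ) : Set Ω :=
  {ω | ∃ τ, L ≤ (Y τ ω : ℝ) ∧ (∀ u, u < τ → (Y u ω : ℝ) < L) ∧ τ ≤ n ∧
    ∃ σ, t0 < σ ∧ σ < τ ∧ Y σ ω = 0}

namespace IsReducedQuantumExploration

variable {n : ℕ} {β lam : ℝ} {Ω : Type*} [m0 : MeasurableSpace Ω] {μ : Measure Ω}
  {F : ℕ → MeasurableSpace Ω} {Y η : ℕ → Ω → ℕ} {J : ℕ → Ω → ℝ}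

theorem le_succ (hX : IsReducedQuantumExploration n β lam μ F Y η J) (ω : Ω) (t : ℕ) :
    Y t ω ≤ Y (t + 1) ω + 1 := by
  have := hX.Y_rec (t + 1) (by omega) ω
  rw [Nat.add_sub_cancel] at this
  split_ifs at this <;> omega

theorem ae_eventually_pred (hX : IsReducedQuantumExploration n β lam μ F Y η J) (hβ : 0 < β)
    (hlam : 0 < lam) (hn : 0 < n) : ∀ᵐ ω ∂μ, ∀ t, n < t → Y t ω = Y (t - 1) ω - 1 := by
  filter_upwards [hX.ae_eta_le_vacant hβ hlam hn] with ω hω t ht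
  have h1 := hω t (by omega)
  have h2 : vacant n t (Y (t - 1) ω) = 0 := by unfold vacant; omega
  have h3 := hX.Y_rec t (by omega) ω
  split_ifs at h3 <;> omega

theorem measure_short_excursions_le (hX : IsReducedQuantumExploration n β lam μ F Y η J)
    (hβ : 0 < β) (hlam : 0 < lam) (hn : 0 < n) {T : ℕ} (t0 M : ℕ) {L : ℝ} (hL : 1 < L) :
    μ ({ω | ∀ i, 1 ≤ i → hitZero Y ω i - hitZero Y ω (i - 1) < T} ∩
        {ω | ∃ t, 1 ≤ t ∧ t ≤ M ∧ L ≤ (Y t ω : ℝ)}) ≤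
      if L < T then μ (earlyEvent Y T (t0 + T) L) + μ (lateEvent Y n t0 L) else 0 := by
  have hae := hX.ae_eventually_pred hβ hlam hn
  split_ifs with hLT
  · refine le_trans (measure_mono_ae ?_) (measure_union_le _ _)
    filter_upwards [hae] with ω hω ⟨h1, t, _, _, ht⟩
    obtain ⟨_, τ, h2, h3, h4⟩ := excursion_dichotomy (t0 := t0) hL (hX.Y_zero ω) (hX.le_succ ω)
      hω h1 ⟨t, ht⟩
    exact h4.imp (fun h => ⟨τ, h2, h3, h⟩) (fun h => ⟨τ, h2, h3, h⟩)
  · rw [nonpos_iff_eq_zero, measure_eq_zero_iff_ae_notMem]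
    filter_upwards [hae] with ω hω ⟨h1, t, _, _, ht⟩
    exact hLT (excursion_dichotomy (t0 := t0) hL (hX.Y_zero ω) (hX.le_succ ω)
      hω h1 ⟨t, ht⟩).1

end IsReducedQuantumExploration

theorem measure_iUnion_le_of_disjoint {Ω : Type*} [MeasurableSpace Ω] {μ : Measure Ω}
    [IsProbabilityMeasure μ] {D B : ℕ → Set Ω} {v : ENNReal}
    (hB : ∀ r, MeasurableSet (B r)) (hd : Pairwise (Function.onFun Disjoint B))
    (h : ∀ r, μ (D r) ≤ v * μ (B r)) : μ (⋃ r, D r) ≤ v :=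
  calc μ (⋃ r, D r) ≤ ∑' r, μ (D r) := measure_iUnion_le _
    _ ≤ ∑' r, v * μ (B r) := ENNReal.tsum_le_tsum h
    _ = v * μ (⋃ r, B r) := by rw [ENNReal.tsum_mul_left, measure_iUnion hd hB]
    _ ≤ v := mul_le_of_le_one_right' prob_le_one

namespace IsReducedQuantumExploration

variable {n : ℕ} {β lam : ℝ} {Ω : Type*} [m0 : MeasurableSpace Ω] {μ : Measure Ω}
  {F : ℕ → MeasurableSpace Ω} {Y η : ℕ → Ω → ℕ} {J : ℕ → Ω → ℝ}

theorem measurableSet_Y (hX : IsReducedQuantumExploration n β lam μ F Y η J) {u t : ℕ}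
    (hut : u ≤ t) (P : ℕ → Prop) : MeasurableSet[F t] {ω | P (Y u ω)} :=
  hX.F_mono hut _ (hX.Y_adapted u (MeasurableSet.of_discrete (s := {y | P y})))

theorem measurableSet_Y_forall (hX : IsReducedQuantumExploration n β lam μ F Y η J) {t : ℕ}
    (Q P : ℕ → Prop) (hQ : ∀ u, Q u → u ≤ t) : MeasurableSet[F t] {ω | ∀ u, Q u → P (Y u ω)} := by
  have : {ω | ∀ u, Q u → P (Y u ω)} = ⋂ u ∈ {u | Q u}, {ω | P (Y u ω)} := by ext; simp
  rw [this]
  exact MeasurableSet.biInter (Set.to_countable _) fun u hu => hX.measurableSet_Y (hQ u hu) P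

theorem measure_earlyEvent_le (hX : IsReducedQuantumExploration n β lam μ F Y η J)
    (hβ : 0 < β) (hlam : 0 < lam) (hn : 0 < n)
    (hcrit : lam⁻¹ * (2 * (1 - Real.exp (-(lam * β))) -
      lam * β * Real.exp (-(lam * β))) = 1) {T S : ℕ} {L s : ℝ} (hs0 : 0 ≤ s) (hs1 : s ≤ 1) :
    μ (earlyEvent Y T S L) ≤ ENNReal.ofReal (Real.exp
      ((s * ((S + 1 + β ^ 2) / n) + momentConst β * s ^ 2) * T - s * L)) := by
  have := hX.prob
  have := hX.isProbabilityMeasure_cutGamma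
  set g : ℝ := s * ((S + 1 + β ^ 2) / n) + momentConst β * s ^ 2 with hg
  have hg0 : 0 ≤ g := by unfold g momentConst; positivity
  set B : ℕ → Set Ω := fun r =>
    {ω | L ≤ (Y r ω : ℝ) ∧ 0 < Y r ω ∧ r + Y r ω ≤ S} ∩ {ω | ∀ u, u < r → (Y u ω : ℝ) < L} with hB
  have hBm : ∀ r, MeasurableSet[F r] (B r) := fun r =>
    (hX.measurableSet_Y le_rfl fun y => L ≤ (y : ℝ) ∧ 0 < y ∧ r + y ≤ S).inter
      (hX.measurableSet_Y_forall (fun u => u < r) (fun y => (y : ℝ) < L) fun u hu => hu.le)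
  set alive : ℕ → ℕ → Prop := fun t y => 0 < y ∧ t + y ≤ S
  set exit : ℕ → ℕ → Prop := fun _ y => y = 0
  set D : ℕ → Set Ω := fun r => {ω | ω ∈ B r ∧ ∃ t, r < t ∧ t ≤ r + T ∧ exit t (Y t ω) ∧
        ∀ u, r ≤ u → u < t → alive u (Y u ω)} with hD
  have hsub : earlyEvent Y T S L ⊆ ⋃ r, D r := by
    rintro ω ⟨τ, h1, h2, e, h3, h4, h5, h6⟩
    refine Set.mem_iUnion.2 ⟨τ, ⟨⟨h1, h6 τ le_rfl h3⟩, h2⟩, e, h3, h4, h5, h6⟩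
  refine (measure_mono hsub).trans (measure_iUnion_le_of_disjoint
    (fun r => hX.F_le _ _ (hBm r)) ?_ fun r => ?_)
  · intro r r' hrr'
    refine Set.disjoint_left.2 ?_
    rintro ω ⟨⟨h1, _⟩, h2⟩ ⟨⟨h3, _⟩, h4⟩
    rcases lt_or_gt_of_ne hrr' with h | h
    · exact absurd (h4 r h) (not_lt.2 h1)
    · exact absurd (h2 r' h) (not_lt.2 h3)
  have hmain := hX.measure_exit_le hβ hlam hn (r := r) (R := r + T) (by omega) (hBm r)
    (fun t y => Real.exp (g * (r + T - t)) * Real.exp (-s * y)) (fun t y => by positivity)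
    alive exit (c := fun _ => 0) (fun _ => le_rfl)
    (fun t y h1 h2 => absurd h2.1 (by simp [show y = 0 from h1])) ?_ ?_
    (v := Real.exp (g * T - s * L)) (Real.exp_pos _).le ?_
  · simpa using hmain
  · intro t ht1 ht2 y hy
    have hm := le_stepMean hβ hlam hn hcrit (t := t) (by omega) y
    have hle : ((t : ℝ) + y + β ^ 2) / n ≤ (S + 1 + β ^ 2) / n := by
      have : ((t : ℝ) + y) ≤ S + 1 := by
        have := hy.2
        exact_mod_cast (by omega : t + y ≤ S + 1)
      gcongr
    have h1 := stepExp_exp_neg_le hβ hlam hn (lam := lam) (t := t) hy.1 (s := -s)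
      (by rw [abs_neg, abs_of_nonneg hs0]; exact hs1)
    have h2 : -s * (stepMean n β lam t y - 1) + momentConst β * (-s) ^ 2 ≤ g := by
      rw [hg]; nlinarith
    have h3 : stepExp n β lam t y (fun y' => Real.exp (g * (r + T - t)) * Real.exp (-s * y')) =
        Real.exp (g * (r + T - t)) * stepExp n β lam t y (fun y' => Real.exp (-s * y')) := by
      simp only [stepExp, Finset.mul_sum]
      exact Finset.sum_congr rfl fun k _ => by ring
    rw [h3, add_zero]
    have hcast : ((t - 1 : ℕ) : ℝ) = t - 1 := by
      rw [Nat.cast_sub (by omega)]; simp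
    calc _ ≤ Real.exp (g * (r + T - t)) * (Real.exp (-s * y) * Real.exp g) := by
          gcongr
          exact h1.trans (by gcongr)
      _ = _ := by
          rw [← Real.exp_add, ← Real.exp_add, ← Real.exp_add, hcast]
          ring_nf
  · intro t y ht1 ht2 hy
    have : (t : ℝ) ≤ r + T := by exact_mod_cast ht2
    have h0 : y = 0 := hy
    simp only [h0, Nat.cast_zero, mul_zero, Real.exp_zero, mul_one]
    exact Real.one_le_exp (mul_nonneg hg0 (by linarith))
  · rintro ω ⟨⟨h1, h2⟩, _⟩
    refine ⟨h2, ?_⟩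
    rw [← Real.exp_add]
    refine Real.exp_le_exp.2 ?_
    nlinarith

end IsReducedQuantumExploration

/-- The function `e^{-sL} (e^{sy} - s y + s L)` used to control the passage above level `L`. -/
def passageWeight (L s y : ℝ) : ℝ := Real.exp (-(s * L)) * (Real.exp (s * y) - s * y + s * L)

theorem passageWeight_nonneg {L s y : ℝ} (hL : 0 ≤ L) (hs : 0 ≤ s) : 0 ≤ passageWeight L s y := by
  have h1 := Real.add_one_le_exp (s * y)
  have h2 := mul_nonneg hs hL
  exact mul_nonneg (Real.exp_pos _).le (by linarith)

theorem one_le_passageWeight {L s y : ℝ} (hL : 0 ≤ L) (hs : 0 ≤ s) (hy : L ≤ y) :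
    1 ≤ passageWeight L s y := by
  have h1 := Real.add_one_le_exp (s * (y - L))
  have h2 : Real.exp (-(s * L)) * Real.exp (s * y) = Real.exp (s * (y - L)) := by
    rw [← Real.exp_add]; ring_nf
  have h3 : Real.exp (-(s * L)) ≤ 1 := Real.exp_le_one_iff.2 (by nlinarith)
  have h4 : 0 ≤ s * (y - L) := mul_nonneg hs (by linarith)
  have h5 : passageWeight L s y = Real.exp (s * (y - L)) - Real.exp (-(s * L)) * (s * (y - L)) := by
    rw [← h2]; unfold passageWeight; ring
  rw [h5]
  nlinarith

theorem passageWeight_anti {L s s' y : ℝ} (hs : 0 ≤ s) (hss : s ≤ s') (hy0 : 0 ≤ y)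
    (hy : y ≤ L) : passageWeight L s' y ≤ passageWeight L s y := by
  have ha : 0 ≤ L - y := by linarith
  have hform : ∀ s, passageWeight L s y =
      Real.exp (-(s * (L - y))) + s * (L - y) * Real.exp (-(s * L)) := by
    intro s
    have : Real.exp (-(s * (L - y))) = Real.exp (-(s * L)) * Real.exp (s * y) := by
      rw [← Real.exp_add]; ring_nf
    rw [this]; unfold passageWeight; ring
  rw [hform, hform]
  have h1 : Real.exp (-(s * (L - y))) =
      Real.exp (-(s' * (L - y))) * Real.exp ((s' - s) * (L - y)) := by
    rw [← Real.exp_add]; ring_nf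
  have h2 := Real.add_one_le_exp ((s' - s) * (L - y))
  have h3 : Real.exp (-(s' * L)) ≤ Real.exp (-(s' * (L - y))) := by
    apply Real.exp_le_exp.2; nlinarith
  have h4 : Real.exp (-(s' * L)) ≤ Real.exp (-(s * L)) := by
    apply Real.exp_le_exp.2; nlinarith
  have hd : 0 ≤ (s' - s) * (L - y) := mul_nonneg (by linarith) ha
  have h5 : Real.exp (-(s' * (L - y))) * ((s' - s) * (L - y)) ≤
      Real.exp (-(s * (L - y))) - Real.exp (-(s' * (L - y))) := by
    rw [h1]; nlinarith [Real.exp_pos (-(s' * (L - y)))]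
  have h6 : Real.exp (-(s' * L)) * ((s' - s) * (L - y)) ≤
      Real.exp (-(s' * (L - y))) * ((s' - s) * (L - y)) := mul_le_mul_of_nonneg_right h3 hd
  have h7 : 0 ≤ s * (L - y) * (Real.exp (-(s * L)) - Real.exp (-(s' * L))) :=
    mul_nonneg (mul_nonneg hs ha) (by linarith)
  linarith

theorem sum_Ioc_pow_pred_mul (q : ℝ) {r R : ℕ} (hrR : r ≤ R) :
    (∑ t ∈ Finset.Ioc r R, q ^ (t - 1)) * (1 - q) = q ^ r - q ^ R := by
  induction R, hrR using Nat.le_induction with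
  | base => simp
  | succ m hm ih =>
    rw [Finset.sum_Ioc_succ_top (by omega), add_mul, ih, Nat.add_sub_cancel]
    ring

theorem sum_sq_mul_exp_le {w L : ℝ} (hw : 0 < w) (hL : 0 < L) (hwL : w * L ≤ 1) (r R : ℕ) :
    ∑ t ∈ Finset.Ioc r R, (w * (t - 1 : ℕ)) ^ 2 * Real.exp (-(w * (t - 1 : ℕ) * L)) ≤
      32 / (w * L ^ 3) * Real.exp (-(w * r * L) / 2) := by
  rcases lt_or_ge R r with hlt | hrR
  · rw [Finset.Ioc_eq_empty (by omega), Finset.sum_empty]; positivity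
  set q := Real.exp (-(w * L / 2)) with hq
  have hqk : ∀ k : ℕ, q ^ k = Real.exp (-(w * k * L) / 2) := by
    intro k; rw [hq, ← Real.exp_nat_mul]; ring_nf
  have hterm : ∀ t ∈ Finset.Ioc r R, (w * (t - 1 : ℕ)) ^ 2 * Real.exp (-(w * (t - 1 : ℕ) * L)) ≤
      8 / L ^ 2 * q ^ (t - 1) := by
    intro t _
    rw [hqk]
    set k : ℝ := ((t - 1 : ℕ) : ℝ)
    have hk : 0 ≤ k := Nat.cast_nonneg _
    have h1 := Real.quadratic_le_exp_of_nonneg (x := w * k * L / 2) (by positivity)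
    have h2 : (w * k * L) ^ 2 ≤ 8 * Real.exp (w * k * L / 2) := by
      have : 0 ≤ w * k * L / 2 := by positivity
      nlinarith
    have h3 : Real.exp (-(w * k * L) / 2) =
        Real.exp (w * k * L / 2) * Real.exp (-(w * k * L)) := by
      rw [← Real.exp_add]; ring_nf
    rw [h3, div_mul_eq_mul_div, le_div_iff₀ (by positivity)]
    nlinarith [Real.exp_pos (-(w * k * L))]
  refine (Finset.sum_le_sum hterm).trans ?_
  rw [← Finset.mul_sum, ← hqk]
  have hq1 : w * L / 4 ≤ 1 - q := by
    have h1 : |(-(w * L / 2))| ≤ 1 := by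
      rw [abs_neg, abs_of_nonneg (by positivity)]; linarith
    have := (abs_le.1 (Real.abs_exp_sub_one_sub_id_le h1)).2
    have : 0 < w * L := by positivity
    nlinarith
  have hq0 : 0 < q := Real.exp_pos _
  have hsum : (∑ t ∈ Finset.Ioc r R, q ^ (t - 1)) ≤ 4 / (w * L) * q ^ r := by
    have h1 := sum_Ioc_pow_pred_mul q hrR
    have h0 : 0 ≤ ∑ t ∈ Finset.Ioc r R, q ^ (t - 1) := Finset.sum_nonneg fun t _ => by positivity
    have h2 : (∑ t ∈ Finset.Ioc r R, q ^ (t - 1)) * (w * L / 4) ≤ q ^ r :=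
      (mul_le_mul_of_nonneg_left hq1 h0).trans (by rw [h1]; linarith [pow_pos hq0 R])
    rw [div_mul_eq_mul_div, le_div_iff₀ (by positivity)]
    linarith
  calc 8 / L ^ 2 * ∑ t ∈ Finset.Ioc r R, q ^ (t - 1) ≤ 8 / L ^ 2 * (4 / (w * L) * q ^ r) := by
        gcongr
    _ = _ := by field_simp; ring

theorem stepMean_nonneg {n : ℕ} {β lam : ℝ} [IsProbabilityMeasure (cutGammaMeasure (lam * β))]
    (hβ : 0 < β) (hlam : 0 < lam) (hn : 0 < n) (t y : ℕ) :
    0 ≤ stepMean n β lam t y :=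
  mul_nonneg (Nat.cast_nonneg _) (meanLinkProb_nonneg hβ hlam hn)

theorem stepExp_passageWeight_le {n : ℕ} {β lam : ℝ}
    [IsProbabilityMeasure (cutGammaMeasure (lam * β))] (hβ : 0 < β) (hlam : 0 < lam) (hn : 0 < n)
    {t y : ℕ} {L s : ℝ} (hs0 : 0 ≤ s) (hs1 : s ≤ 1)
    (hs : momentConst β * s ≤ 1 - stepMean n β lam t y) :
    stepExp n β lam t y (fun y' => passageWeight L s y') ≤
      passageWeight L s y + (momentConst β + 1) * (s ^ 2 * Real.exp (-(s * L))) := by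
  have h1 := stepExp_exp_sub_le hβ hlam hn hs0 hs1 (stepMean_nonneg hβ hlam hn t y) hs
  have hsplit : stepExp n β lam t y (fun y' => passageWeight L s y') =
      Real.exp (-(s * L)) * (stepExp n β lam t y (fun y' => Real.exp (s * y') - s * y') +
        s * L) := by
    have h2 := sum_offspringProb hβ hlam hn (vacant n t y)
    have h3 : s * L = ∑ k ∈ Finset.range (vacant n t y + 1),
        offspringProb n β lam (vacant n t y) k * (s * L) := by
      rw [← Finset.sum_mul, h2, one_mul]
    rw [mul_add, h3, stepExp, stepExp, Finset.mul_sum, Finset.mul_sum, ← Finset.sum_add_distrib]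
    refine Finset.sum_congr rfl fun k _ => ?_
    rw [← h3, passageWeight]
    ring
  rw [hsplit]
  unfold passageWeight
  nlinarith [Real.exp_pos (-(s * L))]

namespace IsReducedQuantumExploration

variable {n : ℕ} {β lam : ℝ} {Ω : Type*} [m0 : MeasurableSpace Ω] {μ : Measure Ω}
  {F : ℕ → MeasurableSpace Ω} {Y η : ℕ → Ω → ℕ} {J : ℕ → Ω → ℝ}

theorem measure_lateEvent_le (hX : IsReducedQuantumExploration n β lam μ F Y η J)
    (hβ : 0 < β) (hlam : 0 < lam) (hn : 0 < n)
    (hcrit : lam⁻¹ * (2 * (1 - Real.exp (-(lam * β))) -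
      lam * β * Real.exp (-(lam * β))) = 1) {κ L : ℝ} (hκ0 : 0 < κ) (hκ1 : κ ≤ 1)
    (hκC : momentConst β * κ ≤ 1) (hL0 : 0 < L) (hLn : L ≤ n) (t0 : ℕ) :
    μ (lateEvent Y n t0 L) ≤ ENNReal.ofReal
      ((2 + 32 * (momentConst β + 1) * n / (κ * L ^ 3)) *
        Real.exp (-(κ * t0 * L / n) / 2)) := by
  have := hX.prob
  have := hX.isProbabilityMeasure_cutGamma
  have hn' : (0 : ℝ) < n := by exact_mod_cast hn
  have hC : 0 < momentConst β := by unfold momentConst; positivity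
  set w : ℝ := κ / n with hw
  have hw0 : 0 < w := by positivity
  have hwL : w * L ≤ 1 := by
    rw [hw, div_mul_eq_mul_div, div_le_one hn']; nlinarith
  set B : ℕ → Set Ω := fun r => {ω | Y r ω = 0 ∧ t0 < r ∧ r ≤ n} ∩
    {ω | ∀ u, (t0 < u ∧ u < r) → 0 < Y u ω} with hB
  have hBm : ∀ r, MeasurableSet[F r] (B r) := fun r =>
    (hX.measurableSet_Y le_rfl fun y => y = 0 ∧ t0 < r ∧ r ≤ n).inter
      (hX.measurableSet_Y_forall (fun u => t0 < u ∧ u < r) (fun y => 0 < y) fun u hu => hu.2.le)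
  set alive : ℕ → ℕ → Prop := fun _ y => (y : ℝ) < L
  set exit : ℕ → ℕ → Prop := fun _ y => L ≤ (y : ℝ)
  set D : ℕ → Set Ω := fun r => {ω | ω ∈ B r ∧ ∃ t, r < t ∧ t ≤ n ∧ exit t (Y t ω) ∧
        ∀ u, r ≤ u → u < t → alive u (Y u ω)} with hD
  have hsub : lateEvent Y n t0 L ⊆ ⋃ r, D r := by
    classical
    rintro ω ⟨τ, h1, h2, h3, hex⟩
    obtain ⟨h4, h5, h6⟩ := Nat.find_spec hex
    refine Set.mem_iUnion.2 ⟨Nat.find hex, ⟨⟨h6, h4, by omega⟩, fun u hu => ?_⟩, τ, h5, h3, h1,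
      fun u _ hu => h2 u hu⟩
    have := Nat.find_min hex hu.2
    by_contra h
    exact this ⟨hu.1, hu.2.trans h5, by omega⟩
  refine (measure_mono hsub).trans (measure_iUnion_le_of_disjoint
    (fun r => hX.F_le _ _ (hBm r)) ?_ fun r => ?_)
  · intro r r' hrr'
    refine Set.disjoint_left.2 ?_
    rintro ω ⟨⟨h1, h1', _⟩, h2⟩ ⟨⟨h3, h3', _⟩, h4⟩
    rcases lt_or_gt_of_ne hrr' with h | h
    · exact absurd (h4 r ⟨h1', h⟩) (by omega)
    · exact absurd (h2 r' ⟨h3', h⟩) (by omega)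
  by_cases hr : t0 < r ∧ r ≤ n
  swap
  · have : D r = ∅ := Set.eq_empty_iff_forall_notMem.2 fun ω hω => hr hω.1.1.2
    rw [this, measure_empty]; exact zero_le
  have hs0 : ∀ t : ℕ, 0 ≤ w * ((t - 1 : ℕ) : ℝ) := fun t => by positivity
  have hmain := hX.measure_exit_le hβ hlam hn hr.2 (hBm r)
    (fun t y => passageWeight L (w * (t - 1 : ℕ)) y)
    (fun t y => passageWeight_nonneg hL0.le (hs0 t))
    alive exit (c := fun t => (momentConst β + 1) *
      ((w * (t - 1 : ℕ)) ^ 2 * Real.exp (-(w * (t - 1 : ℕ) * L))))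
    (fun t => by positivity)
    (fun t y h1 h2 => absurd h2 (not_lt.2 h1)) ?_
    (fun t y _ _ hy => one_le_passageWeight hL0.le (hs0 t) hy)
    (v := passageWeight L (w * t0) 0) (passageWeight_nonneg hL0.le (by positivity)) ?_
  · refine hmain.trans ?_
    gcongr
    rw [← Finset.mul_sum]
    have hsum := sum_sq_mul_exp_le hw0 hL0 hwL r n
    have hr0 : (t0 : ℝ) ≤ r := by exact_mod_cast hr.1.le
    have he : Real.exp (-(w * r * L) / 2) ≤ Real.exp (-(κ * t0 * L / n) / 2) := by
      refine Real.exp_le_exp.2 ?_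
      have : κ * t0 * L / n = w * t0 * L := by rw [hw]; ring
      rw [this]
      have : w * t0 * L ≤ w * r * L := by gcongr
      linarith
    have hv : passageWeight L (w * t0) 0 ≤ 2 * Real.exp (-(κ * t0 * L / n) / 2) := by
      have e1 : κ * t0 * L / n = w * t0 * L := by rw [hw]; ring
      rw [e1]
      unfold passageWeight
      have h1 := Real.add_one_le_exp (w * t0 * L / 2)
      have h2 : Real.exp (-(w * t0 * L) / 2) =
          Real.exp (w * t0 * L / 2) * Real.exp (-(w * t0 * L)) := by
        rw [← Real.exp_add]; ring_nf
      rw [h2]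
      simp only [mul_zero, Real.exp_zero, sub_zero]
      nlinarith [Real.exp_pos (-(w * t0 * L))]
    calc _ ≤ 2 * Real.exp (-(κ * t0 * L / n) / 2) + (momentConst β + 1) *
          (32 / (w * L ^ 3) * Real.exp (-(κ * t0 * L / n) / 2)) := by
          refine add_le_add hv (mul_le_mul_of_nonneg_left (hsum.trans ?_) (by positivity))
          gcongr
      _ = _ := by rw [hw]; field_simp
  · intro t ht1 ht2 y hy
    have hn1 : ((t - 1 : ℕ) : ℝ) = t - 1 := by rw [Nat.cast_sub (by omega)]; simp
    have htn : (t : ℝ) ≤ n := by exact_mod_cast ht2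
    have ht1' : (1 : ℝ) ≤ t := by exact_mod_cast (by omega : 1 ≤ t)
    have hfrac : ((t : ℝ) - 1) / n ≤ 1 := (div_le_one hn').2 (by linarith)
    have hfrac0 : 0 ≤ ((t : ℝ) - 1) / n := div_nonneg (by linarith) hn'.le
    have hst : w * ((t - 1 : ℕ) : ℝ) = κ * (((t : ℝ) - 1) / n) := by rw [hn1, hw]; ring
    have hm := stepMean_le hβ hlam hn hcrit (t := t) (by omega) ht2 y
    refine (stepExp_passageWeight_le hβ hlam hn (hs0 t) ?_ ?_).trans ?_
    · rw [hst]; nlinarith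
    · rw [hst]; nlinarith
    · refine add_le_add (passageWeight_anti (hs0 _) ?_ (Nat.cast_nonneg _) hy.le) le_rfl
      gcongr
      omega
  · rintro ω ⟨⟨h1, h2, h3⟩, _⟩
    have h4 : (Y r ω : ℝ) = 0 := by rw [h1]; simp
    refine ⟨by change (Y r ω : ℝ) < L; rw [h4]; exact hL0, ?_⟩
    rw [h4]
    refine passageWeight_anti (by positivity) ?_ le_rfl hL0.le
    gcongr
    omega

end IsReducedQuantumExploration

theorem max_four_sq_sub_sq_le {L y' k : ℝ} (hL : 0 < L) (hy0 : 0 ≤ y') (hk0 : 0 ≤ k)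
    (hk : 2 * L < y' → L ≤ k ∧ y' ≤ 2 * k) :
    max (4 * L ^ 2 - y' ^ 2) 0 ≤ 4 * L ^ 2 - y' ^ 2 + 24 / L * Real.exp k := by
  have he : 0 ≤ 24 / L * Real.exp k := by positivity
  rcases le_or_gt y' (2 * L) with h | h
  · rw [max_eq_left (by nlinarith)]; linarith
  · obtain ⟨h1, h2⟩ := hk h
    rw [max_eq_right (by nlinarith)]
    have h3 : k ^ 3 / 6 ≤ Real.exp k := by
      have := Real.sum_le_exp_of_nonneg hk0 4
      simp only [Finset.sum_range_succ, Finset.sum_range_zero] at this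
      norm_num [Nat.factorial] at this
      nlinarith [sq_nonneg k]
    have h4 : y' ^ 2 ≤ 4 * k ^ 2 := by nlinarith
    have h5 : 4 * k ^ 2 ≤ 24 / L * Real.exp k := by
      rw [div_mul_eq_mul_div, le_div_iff₀ hL]
      nlinarith [mul_le_mul_of_nonneg_left h1 (sq_nonneg k)]
    nlinarith [sq_nonneg L]

theorem stepExp_max_four_sq_sub_sq_le {n : ℕ} {β lam : ℝ}
    [IsProbabilityMeasure (cutGammaMeasure (lam * β))] (hβ : 0 < β) (hlam : 0 < lam) (hn : 0 < n)
    (hcrit : lam⁻¹ * (2 * (1 - Real.exp (-(lam * β))) -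
      lam * β * Real.exp (-(lam * β))) = 1) {t t1 y : ℕ} {L : ℝ} (hL : 1 ≤ L)
    (hdrift : L * (t1 + L + β ^ 2) / n ≤ Real.exp (-β) / 8)
    (hjump : 24 * (2 + momentConst β) / L ≤ Real.exp (-β) / 4)
    (ht : 1 ≤ t) (htt : t ≤ t1) (htn : t1 ≤ n) (hy : (y : ℝ) < L) :
    stepExp n β lam t y (fun y' => max (4 * L ^ 2 - (y' : ℝ) ^ 2) 0) ≤
      4 * L ^ 2 - (y : ℝ) ^ 2 - Real.exp (-β) / 2 := by
  have hL0 : 0 < L := by linarith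
  have hn' : (0 : ℝ) < n := by exact_mod_cast hn
  have htt' : (t : ℝ) ≤ t1 := by exact_mod_cast htt
  have hy0 : (0 : ℝ) ≤ y := Nat.cast_nonneg _
  set N := vacant n t y with hN
  set p := offspringProb n β lam N with hp
  have hp0 : ∀ k, 0 ≤ p k := offspringProb_nonneg hβ hlam hn N
  have hp1 : ∑ k ∈ Finset.range (N + 1), p k = 1 := sum_offspringProb hβ hlam hn N
  set m := stepMean n β lam t y with hm
  have hpm : ∑ k ∈ Finset.range (N + 1), p k * k = m := sum_offspringProb_mul_id hβ hlam hn N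
  have hpe : ∑ k ∈ Finset.range (N + 1), p k * Real.exp k ≤ 2 + momentConst β := by
    have h1 := sum_offspringProb_mul_exp_le hβ hlam hn (N := N) (vacant_le n t y)
      (s := 1) (by simp)
    have h2 := stepMean_le hβ hlam hn hcrit ht (htt.trans htn) y
    have h3 : (0 : ℝ) ≤ (t - 1) / n :=
      div_nonneg (by have : (1 : ℝ) ≤ t := by exact_mod_cast ht
                     linarith) hn'.le
    simp only [one_mul, one_pow, mul_one] at h1
    have h4 : N * meanLinkProb n β lam = m := rfl
    linarith
  have hp00 : Real.exp (-β) ≤ p 0 := exp_neg_le_offspringProb_zero hβ hlam hn (vacant_le n t y)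
  have hml : 1 - (t1 + L + β ^ 2) / n ≤ m := by
    refine le_trans ?_ (le_stepMean hβ hlam hn hcrit ht y)
    have : ((t : ℝ) + y + β ^ 2) / n ≤ (t1 + L + β ^ 2) / n := by gcongr
    linarith
  have hd0 : 0 ≤ (t1 + L + β ^ 2) / n := by positivity
  have hd : L * ((t1 + L + β ^ 2) / n) ≤ Real.exp (-β) / 8 := by
    rwa [← mul_div_assoc]
  have he1 : Real.exp (-β) ≤ 1 := Real.exp_le_one_iff.2 (by linarith)
  have hmax : stepExp n β lam t y (fun y' => max (4 * L ^ 2 - (y' : ℝ) ^ 2) 0) ≤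
      4 * L ^ 2 - (∑ k ∈ Finset.range (N + 1), p k * (nextState y k : ℝ) ^ 2) +
        24 / L * (2 + momentConst β) := by
    calc _ ≤ ∑ k ∈ Finset.range (N + 1), p k *
          (4 * L ^ 2 - (nextState y k : ℝ) ^ 2 + 24 / L * Real.exp k) := by
          refine Finset.sum_le_sum fun k _ => mul_le_mul_of_nonneg_left ?_ (hp0 k)
          refine max_four_sq_sub_sq_le hL0 (Nat.cast_nonneg _) (Nat.cast_nonneg _) fun h => ?_
          have hk : (nextState y k : ℝ) ≤ y + k := by
            have : nextState y k ≤ y + k := by unfold nextState; split_ifs <;> omega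
            exact_mod_cast this
          constructor <;> linarith
      _ = 4 * L ^ 2 * (∑ k ∈ Finset.range (N + 1), p k) -
          (∑ k ∈ Finset.range (N + 1), p k * (nextState y k : ℝ) ^ 2) +
          24 / L * ∑ k ∈ Finset.range (N + 1), p k * Real.exp k := by
          rw [Finset.mul_sum, Finset.mul_sum, ← Finset.sum_sub_distrib, ← Finset.sum_add_distrib]
          exact Finset.sum_congr rfl fun k _ => by ring
      _ ≤ _ := by
          rw [hp1, mul_one]
          gcongr
  have hj : 24 / L * (2 + momentConst β) ≤ Real.exp (-β) / 4 := by
    rwa [div_mul_eq_mul_div]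
  suffices hsq : (y : ℝ) ^ 2 + 3 / 4 * Real.exp (-β) ≤
      ∑ k ∈ Finset.range (N + 1), p k * (nextState y k : ℝ) ^ 2 by linarith
  rcases Nat.eq_zero_or_pos y with h0 | hpos
  · have h1 : ∑ k ∈ Finset.range (N + 1), p k * k ≤
        ∑ k ∈ Finset.range (N + 1), p k * (nextState y k : ℝ) ^ 2 := by
      refine Finset.sum_le_sum fun k _ => mul_le_mul_of_nonneg_left ?_ (hp0 k)
      rw [nextState, if_neg (by omega)]
      exact_mod_cast Nat.le_self_pow two_ne_zero k
    rw [hpm] at h1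
    have : (y : ℝ) = 0 := by exact_mod_cast h0
    rw [this]
    nlinarith
  · have h1 : ∑ k ∈ Finset.range (N + 1), p k * (nextState y k : ℝ) ^ 2 =
        (y : ℝ) ^ 2 + 2 * y * (m - 1) + ∑ k ∈ Finset.range (N + 1), p k * ((k : ℝ) - 1) ^ 2 := by
      have : (y : ℝ) ^ 2 + 2 * y * (m - 1) =
          ((y : ℝ) ^ 2 - 2 * y) * ∑ k ∈ Finset.range (N + 1), p k +
            2 * y * ∑ k ∈ Finset.range (N + 1), p k * k := by
        rw [hp1, hpm]; ring
      rw [this, Finset.mul_sum, Finset.mul_sum, ← Finset.sum_add_distrib, ← Finset.sum_add_distrib]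
      refine Finset.sum_congr rfl fun k _ => ?_
      rw [nextState, if_pos hpos, Nat.cast_sub (by omega)]
      push_cast
      ring
    have h2 : p 0 ≤ ∑ k ∈ Finset.range (N + 1), p k * ((k : ℝ) - 1) ^ 2 := by
      have := Finset.single_le_sum (f := fun k : ℕ => p k * ((k : ℝ) - 1) ^ 2)
        (fun k _ => mul_nonneg (hp0 k) (sq_nonneg _))
        (Finset.mem_range.2 (Nat.succ_pos N))
      simpa using this
    rw [h1]
    have h3 : y * (1 - m) ≤ Real.exp (-β) / 8 := by
      refine le_trans ?_ hd
      rcases le_or_gt m 1 with h | h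
      · exact mul_le_mul hy.le (by linarith) (by linarith) hL0.le
      · exact le_trans (by nlinarith) (mul_nonneg hL0.le hd0)
    linarith

namespace IsReducedQuantumExploration

variable {n : ℕ} {β lam : ℝ} {Ω : Type*} [m0 : MeasurableSpace Ω] {μ : Measure Ω}
  {F : ℕ → MeasurableSpace Ω} {Y η : ℕ → Ω → ℕ} {J : ℕ → Ω → ℝ}

theorem measure_forall_lt_le (hX : IsReducedQuantumExploration n β lam μ F Y η J)
    (hβ : 0 < β) (hlam : 0 < lam) (hn : 0 < n)
    (hcrit : lam⁻¹ * (2 * (1 - Real.exp (-(lam * β))) -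
      lam * β * Real.exp (-(lam * β))) = 1) {t1 : ℕ} {L : ℝ} (hL : 1 ≤ L)
    (hdrift : L * (t1 + L + β ^ 2) / n ≤ Real.exp (-β) / 8)
    (hjump : 24 * (2 + momentConst β) / L ≤ Real.exp (-β) / 4) (htn : t1 ≤ n) :
    μ {ω | ∀ u, u ≤ t1 → (Y u ω : ℝ) < L} ≤
      ENNReal.ofReal (2 * Real.exp (-(Real.exp (-β) / 8 * (t1 / L ^ 2)))) := by
  have := hX.prob
  have := hX.isProbabilityMeasure_cutGamma
  have hL0 : 0 < L := by linarith
  have he1 : Real.exp (-β) ≤ 1 := Real.exp_le_one_iff.2 (by linarith)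
  rcases Nat.eq_zero_or_pos t1 with h0 | ht1
  · subst h0
    refine prob_le_one.trans ?_
    simp
  set γ : ℝ := Real.exp (-β) / 8 with hγ
  set ρ : ℝ := 1 - γ / L ^ 2 with hρ
  have hγL : γ / L ^ 2 ≤ 1 := by
    rw [div_le_one (by positivity)]
    nlinarith
  have hρ0 : 0 ≤ ρ := by linarith
  have hρe : ρ ^ t1 ≤ Real.exp (-(γ * (t1 / L ^ 2))) := by
    have h1 : ρ ≤ Real.exp (-(γ / L ^ 2)) := by
      have := Real.add_one_le_exp (-(γ / L ^ 2)); linarith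
    calc ρ ^ t1 ≤ Real.exp (-(γ / L ^ 2)) ^ t1 := pow_le_pow_left₀ hρ0 h1 _
      _ = _ := by rw [← Real.exp_nat_mul]; congr 1; ring
  set alive : ℕ → ℕ → Prop := fun t y => t < t1 ∧ (y : ℝ) < L
  set exit : ℕ → ℕ → Prop := fun t y => t = t1 ∧ (y : ℝ) < L
  have hmain := hX.measure_exit_le hβ hlam hn (r := 0) (R := t1) (Nat.zero_le _)
    (B := Set.univ) MeasurableSet.univ
    (fun t y => ρ ^ (t1 - t) / (3 * L ^ 2) * max (4 * L ^ 2 - (y : ℝ) ^ 2) 0)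
    (fun t y => by positivity) alive exit (c := fun _ => 0) (fun _ => le_rfl)
    (fun t y h1 h2 => absurd h1.1 h2.1.ne) ?_ ?_ (v := 2 * ρ ^ t1) (by positivity) ?_
  · rw [Finset.sum_const_zero, add_zero, measure_univ, mul_one] at hmain
    refine le_trans (measure_mono ?_) (hmain.trans (ENNReal.ofReal_le_ofReal (by linarith)))
    intro ω hω
    exact ⟨trivial, t1, ht1, le_rfl, ⟨rfl, hω t1 le_rfl⟩, fun u _ hu => ⟨hu, hω u hu.le⟩⟩
  · intro t ht1' ht2 y hy
    have h1 := stepExp_max_four_sq_sub_sq_le hβ hlam hn hcrit (t := t) hL hdrift hjump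
      (by omega) ht2 htn hy.2
    have h2 : stepExp n β lam t y (fun y' =>
        ρ ^ (t1 - t) / (3 * L ^ 2) * max (4 * L ^ 2 - (y' : ℝ) ^ 2) 0) =
        ρ ^ (t1 - t) / (3 * L ^ 2) *
          stepExp n β lam t y (fun y' => max (4 * L ^ 2 - (y' : ℝ) ^ 2) 0) := by
      simp only [stepExp, Finset.mul_sum]
      exact Finset.sum_congr rfl fun k _ => by ring
    rw [h2, add_zero, show t1 - (t - 1) = t1 - t + 1 by omega, pow_succ]
    have h3 : 4 * L ^ 2 - (y : ℝ) ^ 2 - Real.exp (-β) / 2 ≤ ρ * (4 * L ^ 2 - (y : ℝ) ^ 2) := by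
      have : γ / L ^ 2 * (4 * L ^ 2) = Real.exp (-β) / 2 := by
        rw [hγ]; field_simp; norm_num
      have h4 : 0 ≤ γ / L ^ 2 * (y : ℝ) ^ 2 := by positivity
      rw [hρ]; nlinarith
    calc _ ≤ ρ ^ (t1 - t) / (3 * L ^ 2) * (ρ * max (4 * L ^ 2 - (y : ℝ) ^ 2) 0) := by
          refine mul_le_mul_of_nonneg_left (h1.trans (h3.trans ?_)) (by positivity)
          gcongr
          exact le_max_left _ _
      _ = _ := by ring_nf
  · rintro t y _ _ ⟨rfl, hy⟩
    have hy0 : (0 : ℝ) ≤ y := Nat.cast_nonneg _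
    rw [Nat.sub_self, pow_zero, div_mul_eq_mul_div, le_div_iff₀ (by positivity)]
    refine le_trans ?_ (mul_le_mul_of_nonneg_left (le_max_left _ _) zero_le_one)
    nlinarith
  · intro ω _
    have hY0 : (Y 0 ω : ℝ) = 1 := by rw [hX.Y_zero]; simp
    by_cases h1L : 1 < L
    · refine ⟨⟨ht1, by rw [hY0]; exact h1L⟩, ?_⟩
      rw [hY0, Nat.sub_zero, max_eq_left (by nlinarith), div_mul_eq_mul_div,
        div_le_iff₀ (by positivity)]
      nlinarith [pow_nonneg hρ0 t1, mul_nonneg (pow_nonneg hρ0 t1) (sq_nonneg L)]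
    · exfalso
      have : L = 1 := by linarith
      have hC : 0 ≤ momentConst β := by unfold momentConst; positivity
      rw [this, div_one] at hjump
      linarith

end IsReducedQuantumExploration

theorem lateEvent_subset {Ω : Type*} {Y : ℕ → Ω → ℕ} {n t0 t1 : ℕ} {L : ℝ} (h : t1 ≤ t0) :
    lateEvent Y n t0 L ⊆ {ω | ∀ u, u ≤ t1 → (Y u ω : ℝ) < L} := by
  rintro ω ⟨τ, _, h2, _, σ, h4, h5, _⟩ u hu
  exact h2 u (by omega)

theorem exp_half_le_two : Real.exp (1 / 2) ≤ 2 := by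
  have h := Real.exp_bound_div_one_sub_of_interval (x := 1 / 2) (by norm_num) (by norm_num)
  norm_num at h ⊢
  linarith

theorem sq_div_le_of_scale {n T H Z : ℝ} (hn' : 0 < n) (hT1 : 1 ≤ T)
    (hZ : n ^ 2 = Z ^ 8 * T ^ 3) (hZ1 : 1 ≤ Z) (hK : H ^ 2 / T ≤ Z) :
    H ^ 2 / n ≤ 1 / Z ^ 3 := by
  set K := H ^ 2 / T with hKdef
  have hK0 : 0 ≤ K := by positivity
  have hHK : H ^ 2 = K * T := by rw [hKdef]; field_simp
  rw [div_le_div_iff₀ hn' (by positivity), one_mul]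
  have h1 : (H ^ 2 * Z ^ 3) ^ 2 ≤ (n : ℝ) ^ 2 := by
    rw [hZ, hHK]
    calc (K * T * Z ^ 3) ^ 2 = K ^ 2 * (T ^ 2 * Z ^ 6) := by ring
      _ ≤ Z ^ 2 * (T ^ 3 * Z ^ 6) := by
        gcongr ?_ * (?_ * _)
        · gcongr
        · exact pow_le_pow_right₀ hT1 (by omega)
      _ = _ := by ring
  exact (abs_le_of_sq_le_sq' h1 hn'.le).2

theorem sq_le_of_scale {n T H Z : ℝ} (hn' : 0 < n) (hT' : 0 < T) (hH0 : 0 < H)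
    (hZ : n ^ 2 = Z ^ 8 * T ^ 3) (hZ1 : 1 ≤ Z) (hK : H ^ 2 / T ≤ Z) :
    Z ^ 2 ≤ n / H * min 1 (H ^ 2 / T) / H ^ 2 := by
  set K := H ^ 2 / T with hKdef
  have hK0 : 0 < K := by positivity
  have hHK : H ^ 2 = K * T := by rw [hKdef]; field_simp
  have h1 : (Z ^ 2 * H ^ 3) ^ 2 ≤ (n * min 1 K) ^ 2 := by
    have h2 : (Z ^ 2 * H ^ 3) ^ 2 = Z ^ 4 * K ^ 3 * T ^ 3 := by
      calc _ = Z ^ 4 * (H ^ 2) ^ 3 := by ring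
        _ = _ := by rw [hHK]; ring
    rw [h2, mul_pow, hZ]
    rcases le_or_gt K 1 with h | h
    · rw [min_eq_right h]
      calc Z ^ 4 * K ^ 3 * T ^ 3 ≤ Z ^ 8 * K ^ 2 * T ^ 3 := by
            gcongr ?_ * ?_ * _
            · exact pow_le_pow_right₀ hZ1 (by omega)
            · exact pow_le_pow_of_le_one hK0.le h (by omega)
        _ = _ := by ring
    · rw [min_eq_left h.le]
      calc Z ^ 4 * K ^ 3 * T ^ 3 ≤ Z ^ 5 * Z ^ 3 * T ^ 3 := by
            gcongr ?_ * ?_ * _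
            · exact pow_le_pow_right₀ hZ1 (by omega)
            · gcongr
        _ = _ := by ring
  have h2 := (abs_le_of_sq_le_sq' h1 (by positivity)).2
  rw [le_div_iff₀ (by positivity), div_mul_eq_mul_div, le_div_iff₀ hH0]
  calc _ = Z ^ 2 * H ^ 3 := by ring
    _ ≤ _ := h2

namespace IsReducedQuantumExploration

variable {n : ℕ} {β lam : ℝ} {Ω : Type*} [m0 : MeasurableSpace Ω] {μ : Measure Ω}
  {F : ℕ → MeasurableSpace Ω} {Y η : ℕ → Ω → ℕ} {J : ℕ → Ω → ℝ}

theorem measure_earlyEvent_le_exp (hX : IsReducedQuantumExploration n β lam μ F Y η J)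
    (hβ : 0 < β) (hlam : 0 < lam) (hn : 0 < n)
    (hcrit : lam⁻¹ * (2 * (1 - Real.exp (-(lam * β))) -
      lam * β * Real.exp (-(lam * β))) = 1) {T : ℕ} {δ H κ : ℝ} (hδ0 : 0 < δ) (hT0 : 0 < T)
    (hTn : T ≤ n) (hκ0 : 0 < κ) (hκδ : κ ≤ δ) (hκC : momentConst β * κ ≤ δ / 8)
    (hHT : δ * H < T) (hH : 16 * (1 + β ^ 2) ≤ δ * H)
    (hTH : (T : ℝ) ^ 2 ≤ δ / 2 * (H * n)) :
    μ (earlyEvent Y T (⌊δ / 8 * (H * n / T)⌋₊ + T) (δ * H)) ≤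
      ENNReal.ofReal (Real.exp (-(δ * κ / 8 * (H ^ 2 / T)))) := by
  have hn' : (0 : ℝ) < n := by exact_mod_cast hn
  have hT' : (0 : ℝ) < T := by exact_mod_cast hT0
  have hH0 : 0 < H := pos_of_mul_pos_right (by nlinarith [sq_nonneg β]) hδ0.le
  have hC : 0 < momentConst β := by unfold momentConst; positivity
  set s := κ * H / T with hs
  have hs0 : 0 ≤ s := by positivity
  have hs1 : s ≤ 1 := by
    rw [hs, div_le_one hT']; nlinarith
  refine (hX.measure_earlyEvent_le hβ hlam hn hcrit hs0 hs1).trans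
    (ENNReal.ofReal_le_ofReal (Real.exp_le_exp.2 ?_))
  set t0 := ⌊δ / 8 * (H * n / T)⌋₊ with ht0
  have h1 : (t0 : ℝ) * T / n ≤ δ / 8 * H := by
    have : (t0 : ℝ) ≤ δ / 8 * (H * n / T) := Nat.floor_le (by positivity)
    calc (t0 : ℝ) * T / n ≤ δ / 8 * (H * n / T) * T / n := by gcongr
      _ = _ := by field_simp
  have h2 : (T : ℝ) ^ 2 / n ≤ δ / 2 * H := by
    rw [div_le_iff₀ hn']; linarith
  have h3 : (1 + β ^ 2) * T / n ≤ δ * H / 16 := by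
    have : (T : ℝ) / n ≤ 1 := (div_le_one hn').2 (by exact_mod_cast hTn)
    rw [mul_div_assoc]
    nlinarith [sq_nonneg β]
  have h4 : s * T = κ * H := by rw [hs]; field_simp
  have h5 : s * H = κ * (H ^ 2 / T) := by rw [hs]; ring
  have h6 : momentConst β * s ^ 2 * T ≤ δ / 8 * (s * H) := by
    have : momentConst β * s ^ 2 * T = momentConst β * κ * (s * H) := by
      calc _ = momentConst β * s * (s * T) := by ring
        _ = _ := by rw [h4]; ring
    rw [this]
    gcongr
  have h7 : s * (((t0 + T : ℕ) + 1 + β ^ 2) / n) * T =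
      s * (t0 * T / n + T ^ 2 / n + (1 + β ^ 2) * T / n) := by
    push_cast; field_simp; ring
  have h8 : s * (t0 * T / n + T ^ 2 / n + (1 + β ^ 2) * T / n) ≤
      s * (δ / 8 * H + δ / 2 * H + δ * H / 16) := by gcongr
  have h9 : δ * κ / 8 * (H ^ 2 / T) = δ / 8 * (s * H) := by rw [h5]; ring
  have h10 : 0 ≤ δ * (s * H) := by positivity
  rw [add_mul, h7, h9]
  nlinarith

theorem measure_lateEvent_le_exp (hX : IsReducedQuantumExploration n β lam μ F Y η J)
    (hβ : 0 < β) (hlam : 0 < lam) (hn : 0 < n)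
    (hcrit : lam⁻¹ * (2 * (1 - Real.exp (-(lam * β))) -
      lam * β * Real.exp (-(lam * β))) = 1) {T : ℕ} {δ H κ Z : ℝ} (hδ0 : 0 < δ) (hT0 : 0 < T)
    (hTn : T ≤ n) (hκ0 : 0 < κ) (hκ1 : κ ≤ 1) (hκC : momentConst β * κ ≤ 1)
    (hHT : δ * H < T) (hH0 : 0 < H)
    (hZ : (n : ℝ) ^ 2 = Z ^ 8 * T ^ 3) (hZ1 : 1 ≤ Z) (hK : Z ≤ H ^ 2 / T) :
    μ (lateEvent Y n ⌊δ / 8 * (H * n / T)⌋₊ (δ * H)) ≤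
      ENNReal.ofReal ((4 + 64 * (momentConst β + 1) / (κ * δ ^ 3) * (H ^ 2 / T) ^ 3) *
        Real.exp (-(κ * δ ^ 2 / 16 * (H ^ 2 / T)))) := by
  have hn' : (0 : ℝ) < n := by exact_mod_cast hn
  have hT' : (0 : ℝ) < T := by exact_mod_cast hT0
  have hTn' : (T : ℝ) ≤ n := by exact_mod_cast hTn
  have hC : 0 < momentConst β := by unfold momentConst; positivity
  refine (hX.measure_lateEvent_le hβ hlam hn hcrit hκ0 hκ1 hκC (by positivity)
    (by linarith) _).trans (ENNReal.ofReal_le_ofReal ?_)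
  set t0 := ⌊δ / 8 * (H * n / T)⌋₊ with ht0
  set K := H ^ 2 / T with hKdef
  have hK0 : 0 < K := by positivity
  have hHK : H ^ 2 = K * T := by rw [hKdef]; field_simp
  have h1 : n / H ^ 3 ≤ K ^ 3 := by
    have h2 : (n : ℝ) ^ 2 ≤ (K ^ 3 * H ^ 3) ^ 2 := by
      have : (K ^ 3 * H ^ 3) ^ 2 = K ^ 9 * T ^ 3 := by
        calc _ = K ^ 6 * (H ^ 2) ^ 3 := by ring
          _ = _ := by rw [hHK]; ring
      rw [this, hZ]
      have h3 : Z ^ 8 ≤ K ^ 9 := by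
        calc Z ^ 8 ≤ K ^ 8 := by gcongr
          _ ≤ K ^ 9 := pow_le_pow_right₀ (hZ1.trans hK) (by omega)
      gcongr
    have h4 := abs_le_of_sq_le_sq' h2 (by positivity)
    rw [div_le_iff₀ (by positivity)]
    exact h4.2
  have h2 : κ * δ ^ 2 / 8 * K - 1 ≤ κ * t0 * (δ * H) / n := by
    have h3 : δ / 8 * (H * n / T) - 1 ≤ t0 := (Nat.sub_one_lt_floor _).le
    have h4 : κ * (δ / 8 * (H * n / T) - 1) * (δ * H) / n ≤ κ * t0 * (δ * H) / n := by gcongr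
    have h5 : κ * (δ / 8 * (H * n / T) - 1) * (δ * H) / n =
        κ * δ ^ 2 / 8 * K - κ * (δ * H / n) := by
      rw [hKdef]; field_simp
    have h6 : δ * H / n ≤ 1 := (div_le_one hn').2 (by linarith)
    have h7 : κ * (δ * H / n) ≤ 1 * 1 := by gcongr
    linarith
  have h3 : Real.exp (-(κ * t0 * (δ * H) / n) / 2) ≤ 2 * Real.exp (-(κ * δ ^ 2 / 16 * K)) := by
    have h4 := exp_half_le_two
    calc _ ≤ Real.exp (1 / 2 + -(κ * δ ^ 2 / 16 * K)) := Real.exp_le_exp.2 (by linarith)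
      _ = Real.exp (1 / 2) * Real.exp (-(κ * δ ^ 2 / 16 * K)) := Real.exp_add _ _
      _ ≤ _ := by gcongr
  have h4 : 32 * (momentConst β + 1) * n / (κ * (δ * H) ^ 3) ≤
      32 * (momentConst β + 1) / (κ * δ ^ 3) * K ^ 3 := by
    calc _ = 32 * (momentConst β + 1) / (κ * δ ^ 3) * (n / H ^ 3) := by field_simp
      _ ≤ _ := by gcongr
  calc _ ≤ (2 + 32 * (momentConst β + 1) / (κ * δ ^ 3) * K ^ 3) *
        (2 * Real.exp (-(κ * δ ^ 2 / 16 * K))) := by gcongr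
    _ = _ := by ring

theorem measure_lateEvent_le_exp_sq (hX : IsReducedQuantumExploration n β lam μ F Y η J)
    (hβ : 0 < β) (hlam : 0 < lam) (hn : 0 < n)
    (hcrit : lam⁻¹ * (2 * (1 - Real.exp (-(lam * β))) -
      lam * β * Real.exp (-(lam * β))) = 1) {T : ℕ} {δ H ε Z : ℝ} (hδ0 : 0 < δ) (hδ1 : δ < 1)
    (hT0 : 0 < T) (hε0 : 0 < ε) (hεδ : ε ≤ δ / 8) (hεβ : ε ≤ Real.exp (-β) / 16)
    (hH : 1 ≤ δ * H) (hjump : 24 * (2 + momentConst β) / (δ * H) ≤ Real.exp (-β) / 4)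
    (hZ : (n : ℝ) ^ 2 = Z ^ 8 * T ^ 3) (hZ1 : 1 ≤ Z)
    (hZβ : (1 + β ^ 2) / Z ^ 3 ≤ Real.exp (-β) / 16) (hK : H ^ 2 / T ≤ Z) :
    μ (lateEvent Y n ⌊δ / 8 * (H * n / T)⌋₊ (δ * H)) ≤
      ENNReal.ofReal (4 * Real.exp (-(Real.exp (-β) / 8 * ε * Z ^ 2))) := by
  have hn' : (0 : ℝ) < n := by exact_mod_cast hn
  have hT' : (0 : ℝ) < T := by exact_mod_cast hT0
  have hT1 : (1 : ℝ) ≤ T := by exact_mod_cast hT0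
  have hH1 : 1 ≤ H := by nlinarith
  have hH0 : 0 < H := by linarith
  have he1 : Real.exp (-β) ≤ 1 := Real.exp_le_one_iff.2 (by linarith)
  set K := H ^ 2 / T with hKdef
  have hK0 : 0 < K := by positivity
  have hHK : H ^ 2 = K * T := by rw [hKdef]; field_simp
  set M : ℝ := n / H * min 1 K with hM
  have hM0 : 0 < M := by positivity
  set t1 := ⌊ε * M⌋₊ with ht1
  have ht1M : (t1 : ℝ) ≤ ε * M := Nat.floor_le (by positivity)
  have hMn : M ≤ n / H := mul_le_of_le_one_right (by positivity) (min_le_left _ _)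
  have ht10 : t1 ≤ ⌊δ / 8 * (H * n / T)⌋₊ := by
    refine Nat.floor_le_floor ?_
    have : M ≤ H * n / T := by
      calc M ≤ n / H * K := by rw [hM]; gcongr; exact min_le_right _ _
        _ = _ := by rw [hKdef]; field_simp
    gcongr
  have ht1H : (t1 : ℝ) ≤ ε * (n / H) := ht1M.trans (by gcongr)
  have hHn : H ^ 2 / n ≤ 1 / Z ^ 3 := sq_div_le_of_scale hn' hT1 hZ hZ1 hK
  have hdrift : δ * H * (t1 + δ * H + β ^ 2) / n ≤ Real.exp (-β) / 8 := by
    have h1 : H * t1 / n ≤ ε := by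
      rw [div_le_iff₀ hn']
      calc H * t1 ≤ H * (ε * (n / H)) := by gcongr
        _ = _ := by field_simp
    have h2 : δ * H * (δ * H + β ^ 2) ≤ (1 + β ^ 2) * H ^ 2 := by
      have h3 : δ * H ≤ H := mul_le_of_le_one_left hH0.le hδ1.le
      have h4 : H ≤ H ^ 2 := by nlinarith
      have h5 : (δ * H) * (δ * H) ≤ H * H := by gcongr
      have h6 : (δ * H) * β ^ 2 ≤ H ^ 2 * β ^ 2 := by
        gcongr; linarith
      nlinarith
    calc δ * H * (t1 + δ * H + β ^ 2) / n =
          δ * (H * t1 / n) + δ * H * (δ * H + β ^ 2) / n := by ring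
      _ ≤ 1 * ε + (1 + β ^ 2) * H ^ 2 / n := by gcongr
      _ = ε + (1 + β ^ 2) * (H ^ 2 / n) := by ring
      _ ≤ ε + (1 + β ^ 2) * (1 / Z ^ 3) := by gcongr
      _ ≤ _ := by
        have : (1 + β ^ 2) * (1 / Z ^ 3) = (1 + β ^ 2) / Z ^ 3 := by ring
        linarith
  have ht1n : t1 ≤ n := by
    have h1 : ε * (n / H) ≤ 1 * (n / 1) := by
      gcongr
      linarith
    have : (t1 : ℝ) ≤ n := by linarith
    exact_mod_cast this
  refine (measure_mono (lateEvent_subset ht10)).trans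
    ((hX.measure_forall_lt_le hβ hlam hn hcrit hH hdrift hjump ht1n).trans
      (ENNReal.ofReal_le_ofReal ?_))
  have hMZ : Z ^ 2 ≤ M / H ^ 2 := sq_le_of_scale hn' hT' hH0 hZ hZ1 hK
  have hlow : ε * Z ^ 2 - 1 ≤ t1 / (δ * H) ^ 2 := by
    have h1 : ε * M - 1 ≤ t1 := (Nat.sub_one_lt_floor _).le
    have h2 : ε * Z ^ 2 * (δ * H) ^ 2 ≤ ε * M := by
      have h3 : Z ^ 2 * H ^ 2 ≤ M := by rwa [le_div_iff₀ (by positivity)] at hMZ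
      have h4 : (δ * H) ^ 2 ≤ H ^ 2 :=
        pow_le_pow_left₀ (by positivity) (mul_le_of_le_one_left hH0.le hδ1.le) 2
      calc _ ≤ ε * Z ^ 2 * H ^ 2 := by gcongr
        _ = ε * (Z ^ 2 * H ^ 2) := by ring
        _ ≤ _ := by gcongr
    have h5 : 1 ≤ (δ * H) ^ 2 := one_le_pow₀ hH
    rw [le_div_iff₀ (by positivity), sub_mul, one_mul]
    linarith
  have h8 : Real.exp (Real.exp (-β) / 8) ≤ 2 :=
    (Real.exp_le_exp.2 (by linarith)).trans exp_half_le_two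
  calc 2 * Real.exp (-(Real.exp (-β) / 8 * (t1 / (δ * H) ^ 2))) ≤
        2 * Real.exp (Real.exp (-β) / 8 + -(Real.exp (-β) / 8 * ε * Z ^ 2)) := by
        gcongr
        have := mul_le_mul_of_nonneg_left hlow (by positivity : 0 ≤ Real.exp (-β) / 8)
        linarith
    _ ≤ 2 * (2 * Real.exp (-(Real.exp (-β) / 8 * ε * Z ^ 2))) := by
        rw [Real.exp_add]; gcongr
    _ = _ := by ring

end IsReducedQuantumExploration

theorem tendsto_pow_mul_exp_neg_mul (k : ℕ) {a : ℝ} (ha : 0 < a) :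
    Tendsto (fun x : ℝ => x ^ k * Real.exp (-(a * x))) atTop (nhds 0) := by
  refine (isLittleO_pow_exp_pos_mul_atTop (k := k) ha).tendsto_div_nhds_zero.congr fun x => ?_
  rw [Real.exp_neg, div_eq_mul_inv]

theorem eventually_exp_add_le {c c1 c2 : ℝ} (hc1 : c < c1) (hc2 : c < c2) (D1 D2 : ℝ) :
    ∀ᶠ x : ℝ in atTop, Real.exp (-(c1 * x)) + (D1 + D2 * x ^ 3) * Real.exp (-(c2 * x)) ≤
      Real.exp (-(c * x)) := by
  have h1 := tendsto_pow_mul_exp_neg_mul 0 (sub_pos.2 hc1)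
  have h2 := (tendsto_pow_mul_exp_neg_mul 0 (sub_pos.2 hc2)).const_mul D1
  have h3 := (tendsto_pow_mul_exp_neg_mul 3 (sub_pos.2 hc2)).const_mul D2
  have h4 := h1.add (h2.add h3)
  simp only [mul_zero, add_zero] at h4
  filter_upwards [h4.eventually_le_const zero_lt_one] with x hx
  have e : ∀ b, Real.exp (-(b * x)) = Real.exp (-((b - c) * x)) * Real.exp (-(c * x)) := by
    intro b; rw [← Real.exp_add]; ring_nf
  rw [e c1, e c2]
  have := mul_le_mul_of_nonneg_right hx (Real.exp_pos (-(c * x))).le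
  simp only [pow_zero] at this
  linarith

theorem eventually_forall_exp_add_le {c c1 a : ℝ} (hc0 : 0 < c) (hc1 : c < c1) (ha : 0 < a) :
    ∀ᶠ z : ℝ in atTop, ∀ x, 1 / z ^ 8 ≤ x → x ≤ z →
      Real.exp (-(c1 * x)) + 4 * Real.exp (-(a * z ^ 2)) ≤ Real.exp (-(c * x)) := by
  have hd : 0 < c1 - c := sub_pos.2 hc1
  have h1 := (tendsto_pow_mul_exp_neg_mul 8 zero_lt_one).const_mul 4
  rw [mul_zero] at h1
  filter_upwards [h1.eventually_le_const hd, eventually_ge_atTop ((c1 + 1) / a),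
    eventually_gt_atTop 0] with z hz hza hz0 x hx1 hx2
  rw [div_le_iff₀ ha] at hza
  have hx0 : 0 < x := lt_of_lt_of_le (by positivity) hx1
  have h2 : Real.exp (-(c * x)) = Real.exp (-(c1 * x)) * Real.exp ((c1 - c) * x) := by
    rw [← Real.exp_add]; ring_nf
  have h3 := Real.add_one_le_exp ((c1 - c) * x)
  have h4 : Real.exp (-(a * z ^ 2)) ≤ Real.exp (-(1 * z)) * Real.exp (-(c1 * x)) := by
    rw [← Real.exp_add]
    refine Real.exp_le_exp.2 ?_
    have : c1 * x ≤ c1 * z := mul_le_mul_of_nonneg_left hx2 (by linarith)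
    nlinarith
  have h5 : 4 * Real.exp (-(1 * z)) ≤ (c1 - c) * x := by
    have h6 : 4 * Real.exp (-(1 * z)) ≤ (c1 - c) * (1 / z ^ 8) := by
      rw [mul_one_div, le_div_iff₀ (by positivity)]
      linarith
    exact h6.trans (mul_le_mul_of_nonneg_left hx1 hd.le)
  have h7 := Real.exp_pos (-(c1 * x))
  rw [h2]
  nlinarith

theorem tendsto_sq_div_Tof_cube {A : ℕ → ℝ} (hA : Tendsto A atTop atTop) :
    Tendsto (fun n : ℕ => (n : ℝ) ^ 2 / (Tof n (A n) : ℝ) ^ 3) atTop atTop := by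
  have hpow : Tendsto (fun n : ℕ => (n : ℝ) ^ ((2 : ℝ) / 3)) atTop atTop :=
    (tendsto_rpow_atTop (by norm_num)).comp tendsto_natCast_atTop_atTop
  have hpos : ∀ᶠ n : ℕ in atTop, 0 < (Tof n (A n) : ℝ) / (n : ℝ) ^ ((2 : ℝ) / 3) := by
    filter_upwards [hA.eventually_gt_atTop 0, hpow.eventually_gt_atTop 0] with n h1 h2
    have : 0 < Tof n (A n) := Nat.ceil_pos.2 (by positivity)
    positivity
  have hle : ∀ᶠ n : ℕ in atTop, (Tof n (A n) : ℝ) / (n : ℝ) ^ ((2 : ℝ) / 3) ≤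
      (A n)⁻¹ + ((n : ℝ) ^ ((2 : ℝ) / 3))⁻¹ := by
    filter_upwards [hA.eventually_gt_atTop 0, hpow.eventually_gt_atTop 0] with n h1 h2
    have := (Nat.ceil_lt_add_one (a := (n : ℝ) ^ ((2 : ℝ) / 3) / A n) (by positivity)).le
    rw [div_le_iff₀ h2]
    calc (Tof n (A n) : ℝ) ≤ (n : ℝ) ^ ((2 : ℝ) / 3) / A n + 1 := this
      _ = _ := by field_simp
  have hlim : Tendsto (fun n : ℕ => (A n)⁻¹ + ((n : ℝ) ^ ((2 : ℝ) / 3))⁻¹) atTop (nhds 0) := by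
    simpa using hA.inv_tendsto_atTop.add hpow.inv_tendsto_atTop
  have h0 : Tendsto (fun n : ℕ => (Tof n (A n) : ℝ) / (n : ℝ) ^ ((2 : ℝ) / 3)) atTop
      (nhdsWithin 0 (Set.Ioi 0)) :=
    tendsto_nhdsWithin_iff.2 ⟨tendsto_of_tendsto_of_tendsto_of_le_of_le' tendsto_const_nhds hlim
      (hpos.mono fun _ h => h.le) hle, hpos⟩
  refine ((tendsto_pow_atTop three_ne_zero).comp
    (tendsto_inv_nhdsGT_zero.comp h0)).congr fun n => ?_
  have h2 : ((n : ℝ) ^ ((2 : ℝ) / 3)) ^ 3 = (n : ℝ) ^ 2 := by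
    rw [← Real.rpow_natCast, ← Real.rpow_mul (Nat.cast_nonneg n)]
    norm_num
  simp only [Function.comp_apply, inv_div, div_pow, h2]

theorem long_excursion_given_many_active_quantum (β lam : ℝ) (hβ : 0 < β) (hlam : 0 < lam)
    (hcrit : lam⁻¹ * (2 * (1 - Real.exp (-(lam * β))) - lam * β * Real.exp (-(lam * β))) = 1)
    (δ : ℝ) (hδ : δ ∈ Set.Ioo (0 : ℝ) 1)
    (h m : ℕ → ℕ) (hh : Tendsto h atTop atTop)
    (A : ℕ → ℝ) (hA : Tendsto A atTop atTop)
    (hAO : A =O[atTop] (fun n : ℕ => (n : ℝ) ^ ((5 : ℝ) / 12)))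
    (hmh : (fun n : ℕ => (m n * (h n) ^ 2 : ℝ) / n) =O[atTop] (fun _ : ℕ => (1 : ℝ)))
    (hT : ∀ n : ℕ, ((Tof n (A n) : ℝ)) ^ 2 / (h n * n) ≤ δ / 2) :
    ∃ c > (0 : ℝ),
      ∀ᶠ n : ℕ in atTop,
        ∀ (Ω : Type) [MeasurableSpace Ω] (μ : Measure Ω) (F : ℕ → MeasurableSpace Ω)
          (Y η : ℕ → Ω → ℕ) (J : ℕ → Ω → ℝ),
          IsReducedQuantumExploration n β lam μ F Y η J →
          μ ({ω | ∀ i, 1 ≤ i → hitZero Y ω i - hitZero Y ω (i - 1) < Tof n (A n)} ∩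
              {ω | ∃ t, 1 ≤ t ∧ t ≤ m n * (h n) ^ 2 ∧ (h n : ℝ) * δ ≤ (Y t ω : ℝ)})
            ≤ ENNReal.ofReal
                (max (Real.exp (-(c * h n)))
                  (Real.exp (-(c * (h n : ℝ) ^ 2 / Tof n (A n))))) := by
  obtain ⟨hδ0, hδ1⟩ := hδ
  have hC : 0 < momentConst β := by unfold momentConst; positivity
  set κ₁ := min δ (δ / 8 / momentConst β) with hκ₁
  have hκ₁0 : 0 < κ₁ := by positivity
  have hκ₁C : momentConst β * κ₁ ≤ δ / 8 := by
    rw [mul_comm, ← le_div_iff₀ hC]; exact min_le_right _ _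
  set κ₂ := min 1 (1 / momentConst β) with hκ₂
  have hκ₂0 : 0 < κ₂ := by positivity
  have hκ₂C : momentConst β * κ₂ ≤ 1 := by
    rw [mul_comm, ← le_div_iff₀ hC]; exact min_le_right _ _
  set ε := min (δ / 8) (Real.exp (-β) / 16) with hε
  have hε0 : 0 < ε := by positivity
  set c₁ := δ * κ₁ / 8 with hc₁
  set c₂ := κ₂ * δ ^ 2 / 16 with hc₂
  have hc₁0 : 0 < c₁ := by positivity
  have hc₂0 : 0 < c₂ := by positivity
  set c := min c₁ c₂ / 2 with hc
  have hc0 : 0 < c := by positivity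
  have hcc₁ : c < c₁ := by have := min_le_left c₁ c₂; linarith
  have hcc₂ : c < c₂ := by have := min_le_right c₁ c₂; linarith
  refine ⟨c, hc0, ?_⟩
  have hX8 := tendsto_sq_div_Tof_cube hA
  have hZ : Tendsto (fun n : ℕ => ((n : ℝ) ^ 2 / (Tof n (A n) : ℝ) ^ 3) ^ ((1 : ℝ) / 8))
      atTop atTop := (tendsto_rpow_atTop (by norm_num)).comp hX8
  have hδH : Tendsto (fun n => δ * (h n : ℝ)) atTop atTop :=
    (tendsto_natCast_atTop_atTop.comp hh).const_mul_atTop hδ0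
  have hjump : ∀ᶠ n in atTop,
      24 * (2 + momentConst β) / (δ * (h n : ℝ)) ≤ Real.exp (-β) / 4 :=
    (hδH.const_div_atTop _).eventually_le_const (by positivity)
  have hZβ : ∀ᶠ z : ℝ in atTop, (1 + β ^ 2) / z ^ 3 ≤ Real.exp (-β) / 16 :=
    ((tendsto_pow_atTop three_ne_zero).const_div_atTop _).eventually_le_const (by positivity)
  obtain ⟨K₀, hK₀⟩ := eventually_atTop.1 (eventually_exp_add_le hcc₁ hcc₂ 4
    (64 * (momentConst β + 1) / (κ₂ * δ ^ 3)))
  filter_upwards [eventually_gt_atTop 0, hA.eventually_gt_atTop 0, hX8.eventually_ge_atTop 1,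
    hδH.eventually_ge_atTop (16 * (1 + β ^ 2)), hjump, hZ.eventually hZβ,
    hZ.eventually (eventually_forall_exp_add_le hc0 hcc₁ (by positivity :
      0 < Real.exp (-β) / 8 * ε)), hZ.eventually_ge_atTop 1, hZ.eventually_ge_atTop K₀]
    with n hn hAn hX1 hH hj hzβ hzA hz1 hzK Ω _ μ F Y η J hX
  set T := Tof n (A n) with hTdef
  set H : ℝ := (h n : ℝ) with hHdef
  set Z : ℝ := ((n : ℝ) ^ 2 / (T : ℝ) ^ 3) ^ ((1 : ℝ) / 8) with hZdef
  have hn' : (0 : ℝ) < n := by exact_mod_cast hn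
  have hT0 : 0 < T := Nat.ceil_pos.2 (by positivity)
  have hT' : (0 : ℝ) < T := by exact_mod_cast hT0
  have hH0 : 0 < H := pos_of_mul_pos_right (by nlinarith [sq_nonneg β]) hδ0.le
  have hZ8 : Z ^ 8 = (n : ℝ) ^ 2 / (T : ℝ) ^ 3 := by
    rw [hZdef, ← Real.rpow_natCast, ← Real.rpow_mul (by positivity)]
    norm_num
  have hZT : (n : ℝ) ^ 2 = Z ^ 8 * T ^ 3 := by rw [hZ8]; field_simp
  have hTn : T ≤ n := by
    rw [le_div_iff₀ (by positivity), one_mul] at hX1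
    have h1 : T ^ 3 ≤ n ^ 2 := by exact_mod_cast hX1
    exact (Nat.pow_le_pow_iff_left three_ne_zero).1
      (h1.trans (Nat.pow_le_pow_right hn (by omega)))
  have hTH : (T : ℝ) ^ 2 ≤ δ / 2 * (H * n) := by
    have := hT n
    rwa [div_le_iff₀ (by positivity)] at this
  have hL1 : 1 < δ * H := by nlinarith [sq_nonneg β]
  have hbound := hX.measure_short_excursions_le hβ hlam hn (T := T)
    ⌊δ / 8 * (H * n / T)⌋₊ (m n * h n ^ 2) hL1
  rw [mul_comm H δ]
  refine hbound.trans ?_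
  split_ifs with hHT
  swap
  · exact zero_le
  have hearly := hX.measure_earlyEvent_le_exp hβ hlam hn hcrit hδ0 hT0 hTn hκ₁0
    (min_le_left _ _) hκ₁C hHT hH hTH
  rw [mul_div_assoc c (H ^ 2)]
  refine le_trans ?_ (ENNReal.ofReal_le_ofReal (le_max_right _ _))
  rcases le_total (H ^ 2 / T) Z with hK | hK
  · refine (add_le_add hearly (hX.measure_lateEvent_le_exp_sq hβ hlam hn hcrit hδ0 hδ1 hT0 hε0
      (min_le_left _ _) (min_le_right _ _) hL1.le hj hZT hz1 hzβ hK)).trans ?_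
    rw [← ENNReal.ofReal_add (by positivity) (by positivity)]
    refine ENNReal.ofReal_le_ofReal (hzA _ ?_ hK)
    rw [hZ8, one_div_div, div_le_div_iff₀ (by positivity) hT']
    have h1 : (T : ℝ) ^ 2 ≤ H * n := by
      have : 0 < H * n := by positivity
      nlinarith
    calc (T : ℝ) ^ 3 * T = (T ^ 2) ^ 2 := by ring
      _ ≤ (H * n) ^ 2 := by gcongr
      _ = _ := by ring
  · refine (add_le_add hearly (hX.measure_lateEvent_le_exp hβ hlam hn hcrit hδ0 hT0 hTn hκ₂0
      (min_le_left _ _) hκ₂C hHT hH0 hZT hz1 hK)).trans ?_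
    rw [← ENNReal.ofReal_add (by positivity) (by positivity)]
    exact ENNReal.ofReal_le_ofReal (hK₀ _ (hzK.trans hK))

end
end
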